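/- Let (ΛV,d) be a pure elliptic minimal Sullivan model which is formal. Then for every integer r ≥ 2, TC_r(ΛV) = r·cat(ΛV) + χ_π(ΛV). -/

import Mathlib

noncomputable section

namespace RHT

/-- A graded-commutative differential graded algebra over `ℚ`, graded by `ℕ`,
with a degree `+1` differential satisfying the graded Leibniz rule. -/
class GCDGA (A : Type) extends Ring A, Algebra ℚ A where
  grading : ℕ → Submodule ℚ A
  gradedAlgebra : GradedAlgebra grading
  grading_comm : ∀ (i j : ℕ) (a b : A), a ∈ grading i → b ∈ grading j →
    a * b = ((-1 : ℚ) ^ (i * j)) • (b * a)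
  d : A →ₗ[ℚ] A
  d_sq : ∀ a : A, d (d a) = 0
  d_grading : ∀ (i : ℕ) (a : A), a ∈ grading i → d a ∈ grading (i + 1)
  d_leibniz : ∀ (i : ℕ) (a b : A), a ∈ grading i →
    d (a * b) = d a * b + ((-1 : ℚ) ^ i) • (a * d b)

/-- The grading of a gcdga, with the algebra explicit. -/
def Gr (A : Type) [GCDGA A] : ℕ → Submodule ℚ A := GCDGA.grading

/-- The differential of a gcdga, with the algebra explicit. -/
def Dd (A : Type) [GCDGA A] : A →ₗ[ℚ] A := GCDGA.d

/-- Morphisms of cdga's: `ℚ`-algebra morphisms preserving the grading and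
commuting with the differentials. -/
def IsDGAHom {A B : Type} [GCDGA A] [GCDGA B] (f : A →ₐ[ℚ] B) : Prop :=
  (∀ a : A, f (Dd A a) = Dd B (f a)) ∧
    ∀ (i : ℕ) (a : A), a ∈ Gr A i → f a ∈ Gr B i

theorem isDGAHom_id (A : Type) [GCDGA A] : IsDGAHom (AlgHom.id ℚ A) :=
  ⟨fun _ => rfl, fun _ _ h => h⟩

/-- A quasi-isomorphism: a morphism inducing an isomorphism in cohomology
(stated elementwise: surjectivity and injectivity on cohomology classes). -/
def QuasiIso {A B : Type} [GCDGA A] [GCDGA B] (f : A →ₐ[ℚ] B) : Prop :=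
  (∀ b : B, Dd B b = 0 → ∃ a : A, Dd A a = 0 ∧ ∃ c : B, f a - b = Dd B c) ∧
    ∀ a : A, Dd A a = 0 → (∃ c : B, f a = Dd B c) → ∃ e : A, a = Dd A e

/-- Injectivity in cohomology, stated elementwise. -/
def CohomologyInjective {A B : Type} [GCDGA A] [GCDGA B] (f : A →ₐ[ℚ] B) : Prop :=
  ∀ a : A, Dd A a = 0 → (∃ c : B, f a = Dd B c) → ∃ e : A, a = Dd A e

/-- A homotopy retraction for a morphism `ρ` of cdga's: a factorization of `ρ`
through a surjective quasi-isomorphism `q : C → Q` (playing the role of the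
relative Sullivan model of `ρ`) together with a cdga retraction `τ`. -/
structure HtpyRetraction {T Q : Type} [GCDGA T] [GCDGA Q] (ρ : T →ₐ[ℚ] Q) where
  C : Type
  [instC : GCDGA C]
  j : T →ₐ[ℚ] C
  q : C →ₐ[ℚ] Q
  τ : C →ₐ[ℚ] T
  j_dga : IsDGAHom j
  q_dga : IsDGAHom q
  τ_dga : IsDGAHom τ
  q_surj : Function.Surjective q
  q_quasi : QuasiIso q
  hqj : q.comp j = ρ
  hτj : τ.comp j = AlgHom.id ℚ T

attribute [instance] HtpyRetraction.instC

/-- A homotopy retraction of `T`-modules for a morphism `ρ : T → Q` of cdga's: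
as above, but the retraction `τ` is only required to be a morphism of
differential `T`-modules. -/
structure ModHtpyRetraction {T Q : Type} [GCDGA T] [GCDGA Q] (ρ : T →ₐ[ℚ] Q) where
  C : Type
  [instC : GCDGA C]
  j : T →ₐ[ℚ] C
  q : C →ₐ[ℚ] Q
  τ : C →ₗ[ℚ] T
  j_dga : IsDGAHom j
  q_dga : IsDGAHom q
  q_surj : Function.Surjective q
  q_quasi : QuasiIso q
  hqj : q.comp j = ρ
  τ_chain : ∀ c : C, τ (Dd C c) = Dd T (τ c)
  τ_mod : ∀ (t : T) (c : C), τ (j t * c) = t * τ c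
  hτj : ∀ t : T, τ (j t) = t

attribute [instance] ModHtpyRetraction.instC

/-- `T`, together with the morphisms `ι j : A → T`, is the `r`-fold (graded)
tensor power of `A`, characterized as the `r`-fold coproduct of copies of `A`
in the category of cdga's. -/
structure TensorPower (A : Type) [GCDGA A] (r : ℕ) (T : Type) [GCDGA T] where
  ι : Fin r → (A →ₐ[ℚ] T)
  ι_dga : ∀ j, IsDGAHom (ι j)
  coprod : ∀ (B : Type) [GCDGA B] (f : Fin r → (A →ₐ[ℚ] B)), (∀ j, IsDGAHom (f j)) →
    ∃! g : T →ₐ[ℚ] B, IsDGAHom g ∧ ∀ j, g.comp (ι j) = f j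

/-- The `r`-fold multiplication morphism `μ : A^{⊗ r} → A`, i.e. the fold map
of the coproduct. -/
noncomputable def TensorPower.mu {A : Type} [GCDGA A] {r : ℕ} {T : Type} [GCDGA T]
    (TP : TensorPower A r T) : T →ₐ[ℚ] A :=
  (TP.coprod A (fun _ => AlgHom.id ℚ A) (fun _ => isDGAHom_id A)).choose

/-- The kernel of the `r`-fold multiplication, as a `ℚ`-submodule (ideal). -/
noncomputable def TensorPower.kerMu {A : Type} [GCDGA A] {r : ℕ} {T : Type} [GCDGA T]
    (TP : TensorPower A r T) : Submodule ℚ T :=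
  LinearMap.ker TP.mu.toLinearMap

/-- A witness that `TC_r(ΛV) ≤ n`: the projection
`ρ^r_n : (ΛV)^{⊗ r} → (ΛV)^{⊗ r}/(ker μ^r)^{n+1}` admits a homotopy retraction
of cdga's.  The quotient is encoded as a surjective cdga morphism with kernel
`(ker μ^r)^{n+1}`. -/
structure TCWitness (A : Type) [GCDGA A] (r n : ℕ) where
  T : Type
  [instT : GCDGA T]
  TP : TensorPower A r T
  Q : Type
  [instQ : GCDGA Q]
  ρ : T →ₐ[ℚ] Q
  ρ_dga : IsDGAHom ρ
  ρ_surj : Function.Surjective ρ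
  ρ_ker : LinearMap.ker ρ.toLinearMap = TP.kerMu ^ (n + 1)
  retr : Nonempty (HtpyRetraction ρ)

/-- The higher rational topological complexity `TC_r`. -/
noncomputable def TC (A : Type) [GCDGA A] (r : ℕ) : ℕ :=
  sInf {n | Nonempty (TCWitness A r n)}

/-- A witness that `MTC_r(ΛV) ≤ n`: `ρ^r_n` admits a homotopy retraction of
`(ΛV)^{⊗ r}`-modules. -/
structure MTCWitness (A : Type) [GCDGA A] (r n : ℕ) where
  T : Type
  [instT : GCDGA T]
  TP : TensorPower A r T
  Q : Type
  [instQ : GCDGA Q]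
  ρ : T →ₐ[ℚ] Q
  ρ_dga : IsDGAHom ρ
  ρ_surj : Function.Surjective ρ
  ρ_ker : LinearMap.ker ρ.toLinearMap = TP.kerMu ^ (n + 1)
  retr : Nonempty (ModHtpyRetraction ρ)

/-- The higher module rational topological complexity `MTC_r`. -/
noncomputable def MTC (A : Type) [GCDGA A] (r : ℕ) : ℕ :=
  sInf {n | Nonempty (MTCWitness A r n)}

/-- A witness that `HTC_r(ΛV) ≤ n`: `ρ^r_n` is injective in cohomology. -/
structure HTCWitness (A : Type) [GCDGA A] (r n : ℕ) where
  T : Type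
  [instT : GCDGA T]
  TP : TensorPower A r T
  Q : Type
  [instQ : GCDGA Q]
  ρ : T →ₐ[ℚ] Q
  ρ_dga : IsDGAHom ρ
  ρ_surj : Function.Surjective ρ
  ρ_ker : LinearMap.ker ρ.toLinearMap = TP.kerMu ^ (n + 1)
  inj : CohomologyInjective ρ

/-- The invariant `HTC_r`. -/
noncomputable def HTC (A : Type) [GCDGA A] (r : ℕ) : ℕ :=
  sInf {n | Nonempty (HTCWitness A r n)}

/-- A minimal Sullivan model structure on a gcdga `A`: a simply-connected
graded space of generators `V` of finite type, the word-length grading `lam`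
(`lam k` is `Λ^k V`), freeness of `A` over `V` as a graded-commutative
algebra (expressed by the universal property), and minimality `d V ⊆ Λ^{≥2}V`. -/
structure MinimalSullivan (A : Type) [GCDGA A] where
  V : ℕ → Submodule ℚ A
  lam : ℕ → Submodule ℚ A
  V_le : ∀ n, V n ≤ Gr A n
  V0 : V 0 = ⊥
  V1 : V 1 = ⊥
  V_fin : ∀ n, FiniteDimensional ℚ (V n)
  lam_zero : lam 0 = 1
  lam_one : lam 1 = ⨆ n, V n
  lam_mul : ∀ p q, lam p * lam q ≤ lam (p + q)
  lam_internal : DirectSum.IsInternal lam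
  minimal : ∀ (n : ℕ), ∀ v ∈ V n, Dd A v ∈ ⨆ k, ⨆ (_ : 2 ≤ k), lam k
  free : ∀ (B : Type) [GCDGA B] (f : ∀ n, V n →ₗ[ℚ] B),
    (∀ (n : ℕ) (v : V n), f n v ∈ Gr B n) →
    ∃! g : A →ₐ[ℚ] B, (∀ (i : ℕ) (a : A), a ∈ Gr A i → g a ∈ Gr B i) ∧
      ∀ (n : ℕ) (v : V n), g (v : A) = f n v

namespace MinimalSullivan

variable {A : Type} [GCDGA A] (S : MinimalSullivan A)

/-- The even part of the space of generators. -/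
def Veven : Submodule ℚ A := ⨆ n, S.V (2 * n)

/-- The odd part of the space of generators. -/
def Vodd : Submodule ℚ A := ⨆ n, S.V (2 * n + 1)

/-- The homotopy characteristic `χ_π = dim V^even - dim V^odd`. -/
noncomputable def chiPi : ℤ :=
  (Module.finrank ℚ S.Veven : ℤ) - (Module.finrank ℚ S.Vodd : ℤ)

/-- Purity: `d V^even = 0` and `d V^odd ⊆ Λ V^even`. -/
def Pure : Prop :=
  (∀ a ∈ S.Veven, Dd A a = 0) ∧
    ∀ a ∈ S.Vodd, Dd A a ∈ Algebra.adjoin ℚ (S.Veven : Set A)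

/-- Coformality: the differential is quadratic, `d V ⊆ Λ² V`. -/
def Coformal : Prop := ∀ (n : ℕ), ∀ v ∈ S.V n, Dd A v ∈ S.lam 2

/-- Constant length `l` of the differential: `d V ⊆ Λ^l V`. -/
def ConstantLength (l : ℕ) : Prop := ∀ (n : ℕ), ∀ v ∈ S.V n, Dd A v ∈ S.lam l

end MinimalSullivan

/-- The cohomology of a gcdga, as a `ℚ`-module. -/
def CohClasses (A : Type) [GCDGA A] :=
  LinearMap.ker (Dd A) ⧸ ((LinearMap.range (Dd A)).comap (LinearMap.ker (Dd A)).subtype)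

instance (A : Type) [GCDGA A] : AddCommGroup (CohClasses A) := by
  unfold CohClasses; infer_instance

instance (A : Type) [GCDGA A] : Module ℚ (CohClasses A) := by
  unfold CohClasses; infer_instance

/-- Ellipticity: both the generating space `V` and the cohomology are
finite-dimensional. -/
def Elliptic (A : Type) [GCDGA A] (S : MinimalSullivan A) : Prop :=
  FiniteDimensional ℚ (⨆ n, S.V n : Submodule ℚ A) ∧ FiniteDimensional ℚ (CohClasses A)

/-- A witness of formality: a quasi-isomorphism to a gcdga with zero
differential. -/
structure FormalityWitness (A : Type) [GCDGA A] where
  B : Type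
  [instB : GCDGA B]
  hd : Dd B = 0
  ψ : A →ₐ[ℚ] B
  ψ_dga : IsDGAHom ψ
  ψ_quasi : QuasiIso ψ

/-- Formality of a (Sullivan) cdga. -/
def Formal (A : Type) [GCDGA A] : Prop := Nonempty (FormalityWitness A)

/-- A witness that `cat(ΛV) ≤ n`: the projection `ΛV → ΛV/Λ^{>n}V` admits a
homotopy retraction.  The quotient is encoded as a surjective cdga morphism
whose kernel is `Λ^{>n}V`. -/
structure CatWitness (A : Type) [GCDGA A] (S : MinimalSullivan A) (n : ℕ) where
  Q : Type
  [instQ : GCDGA Q]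
  π : A →ₐ[ℚ] Q
  π_dga : IsDGAHom π
  π_surj : Function.Surjective π
  π_ker : LinearMap.ker π.toLinearMap = ⨆ k, ⨆ (_ : n < k), S.lam k
  retr : Nonempty (HtpyRetraction π)

/-- The rational LS-category. -/
noncomputable def cat (A : Type) [GCDGA A] (S : MinimalSullivan A) : ℕ :=
  sInf {n | Nonempty (CatWitness A S n)}

/-- A witness that `zcl_r(ΛV) ≥ p`: `p` cocycles in `(ΛV)^{⊗ r}` whose classes
are zero-divisors (killed by `H(μ^r)`) and whose product is not exact. -/
structure ZclWitness (A : Type) [GCDGA A] (r p : ℕ) where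
  T : Type
  [instT : GCDGA T]
  TP : TensorPower A r T
  a : Fin p → T
  closed : ∀ i, Dd T (a i) = 0
  zero_div : ∀ i, ∃ b : A, TP.mu (a i) = Dd A b
  prod_ne : ∀ b : T, (List.ofFn a).prod ≠ Dd T b

/-- The `r`-zero-divisor-cuplength `zcl_r`. -/
noncomputable def zcl (A : Type) [GCDGA A] (r : ℕ) : ℕ :=
  sSup {p | Nonempty (ZclWitness A r p)}

/-- A witness that `cl_ℚ(ΛV) ≥ p`: `p` cocycles of positive degree with
non-exact product. -/
structure ClWitness (A : Type) [GCDGA A] (p : ℕ) where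
  a : Fin p → A
  pos : ∀ i, a i ∈ ⨆ k, ⨆ (_ : 0 < k), Gr A k
  closed : ∀ i, Dd A (a i) = 0
  prod_ne : ∀ b : A, (List.ofFn a).prod ≠ Dd A b

/-- The rational cuplength `cl_ℚ`. -/
noncomputable def clQ (A : Type) [GCDGA A] : ℕ :=
  sSup {p | Nonempty (ClWitness A p)}


instance instGradedAlgebraGr (A : Type) [GCDGA A] : GradedAlgebra (Gr A) := GCDGA.gradedAlgebra

/-- The projection of a gcdga onto its homogeneous component of degree `n`. -/
def pr (A : Type) [GCDGA A] (n : ℕ) : A →ₗ[ℚ] A := GradedAlgebra.proj (Gr A) n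

/-- A submodule is homogeneous if it is stable under all the projections `pr`. -/
def Homog {A : Type} [GCDGA A] (I : Submodule ℚ A) : Prop := ∀ n, ∀ a ∈ I, pr A n a ∈ I

section Basic

variable {A B : Type} [GCDGA A] [GCDGA B]

theorem pr_mem (n : ℕ) (a : A) : pr A n a ∈ Gr A n :=
  SetLike.coe_mem (DirectSum.decompose (Gr A) a n)

theorem pr_of_mem {n : ℕ} {a : A} (h : a ∈ Gr A n) : pr A n a = a :=
  DirectSum.decompose_of_mem_same (Gr A) h

theorem pr_of_mem_ne {m n : ℕ} {a : A} (h : a ∈ Gr A m) (hmn : m ≠ n) : pr A n a = 0 :=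
  DirectSum.decompose_of_mem_ne (Gr A) h hmn

theorem one_mem_Gr : (1 : A) ∈ Gr A 0 := SetLike.GradedOne.one_mem

theorem mul_mem_Gr {i j : ℕ} {a b : A} (ha : a ∈ Gr A i) (hb : b ∈ Gr A j) :
    a * b ∈ Gr A (i + j) := SetLike.GradedMul.mul_mem ha hb

theorem Dd_mem {i : ℕ} {a : A} (ha : a ∈ Gr A i) : Dd A a ∈ Gr A (i + 1) :=
  GCDGA.d_grading i a ha

theorem Dd_Dd (a : A) : Dd A (Dd A a) = 0 := GCDGA.d_sq a

theorem Gr_comm {i j : ℕ} {a b : A} (ha : a ∈ Gr A i) (hb : b ∈ Gr A j) :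
    a * b = ((-1 : ℚ) ^ (i * j)) • (b * a) := GCDGA.grading_comm i j a b ha hb

theorem iSup_Gr (A : Type) [GCDGA A] : ⨆ n, Gr A n = ⊤ :=
  (DirectSum.Decomposition.isInternal (Gr A)).submodule_iSup_eq_top

theorem iSupIndep_Gr (A : Type) [GCDGA A] : iSupIndep (Gr A) :=
  (DirectSum.Decomposition.isInternal (Gr A)).submodule_iSupIndep

@[elab_as_elim]
theorem Gr_induction {P : A → Prop} (a : A) (h0 : P 0) (hadd : ∀ a b, P a → P b → P (a + b))
    (hom : ∀ n, ∀ a ∈ Gr A n, P a) : P a := by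
  have : a ∈ ⨆ n, Gr A n := by rw [iSup_Gr]; trivial
  exact Submodule.iSup_induction _ (motive := P) this hom h0 hadd

theorem exists_bound (a : A) : ∃ N, (∀ n, N ≤ n → pr A n a = 0) ∧
    ∀ M, N ≤ M → a = ∑ n ∈ Finset.range M, pr A n a := by
  classical
  suffices h : ∃ N, ∀ n, N ≤ n → pr A n a = 0 by
    obtain ⟨N, hN⟩ := h
    refine ⟨N, hN, fun M hM => ?_⟩
    conv_lhs => rw [← DirectSum.sum_support_decompose (Gr A) a]
    refine Finset.sum_subset (fun n hn => ?_) (fun n _ hn => ?_)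
    · rw [Finset.mem_range]
      by_contra hlt
      rw [DFinsupp.mem_support_iff] at hn
      exact hn (Subtype.ext (hN n (by omega)))
    · rw [DFinsupp.notMem_support_iff] at hn
      rw [hn]; rfl
  refine Gr_induction a ⟨0, fun n _ => map_zero _⟩ ?_ ?_
  · rintro a b ⟨N, hN⟩ ⟨M, hM⟩
    refine ⟨max N M, fun n hn => ?_⟩
    rw [map_add, hN n (le_of_max_le_left hn), hM n (le_of_max_le_right hn), add_zero]
  · intro n a ha
    exact ⟨n + 1, fun m hm => pr_of_mem_ne ha (by omega)⟩

theorem eq_of_pr {a b : A} (h : ∀ n, pr A n a = pr A n b) : a = b := by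
  obtain ⟨N, -, hN⟩ := exists_bound a
  obtain ⟨M, -, hM⟩ := exists_bound b
  rw [hN (max N M) (le_max_left _ _), hM (max N M) (le_max_right _ _)]
  exact Finset.sum_congr rfl fun n _ => h n

theorem map_pr_of_graded {f : A →ₗ[ℚ] B} (hf : ∀ (i : ℕ) (a : A), a ∈ Gr A i → f a ∈ Gr B i)
    (n : ℕ) (a : A) : f (pr A n a) = pr B n (f a) := by
  refine Gr_induction a (by simp) (fun a b ha hb => by simp [ha, hb]) fun m a ha => ?_
  by_cases h : m = n
  · subst h; rw [pr_of_mem ha, pr_of_mem (hf _ _ ha)]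
  · rw [pr_of_mem_ne ha h, pr_of_mem_ne (hf _ _ ha) h, map_zero]

theorem pr_Dd (n : ℕ) (a : A) : pr A (n + 1) (Dd A a) = Dd A (pr A n a) := by
  refine Gr_induction a (by simp) (fun a b ha hb => by simp [ha, hb]) fun m a ha => ?_
  by_cases h : m = n
  · subst h; rw [pr_of_mem ha, pr_of_mem (Dd_mem ha)]
  · rw [pr_of_mem_ne ha h, pr_of_mem_ne (Dd_mem ha) (by omega), map_zero]

theorem pr_zero_Dd (a : A) : pr A 0 (Dd A a) = 0 := by
  refine Gr_induction a (by simp) (fun a b ha hb => by simp [ha, hb]) fun m a ha => ?_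
  exact pr_of_mem_ne (Dd_mem ha) (by omega)

theorem pr_zero_mul (a b : A) : pr A 0 (a * b) = pr A 0 a * pr A 0 b :=
  map_mul (GradedRing.projZeroRingHom (Gr A)) a b

/-- The involution acting on degree `n` as `(-1)^n`, as a linear map. -/
def epsLin (A : Type) [GCDGA A] : A →ₗ[ℚ] A :=
  (DirectSum.toModule ℚ ℕ A fun n => ((-1 : ℚ) ^ n) • (Gr A n).subtype) ∘ₗ
    (DirectSum.decomposeLinearEquiv (Gr A)).toLinearMap

theorem epsLin_of_mem {n : ℕ} {a : A} (h : a ∈ Gr A n) : epsLin A a = ((-1 : ℚ) ^ n) • a := by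
  change DirectSum.toModule ℚ ℕ A _ (DirectSum.decompose (Gr A) a) = _
  rw [DirectSum.decompose_of_mem _ h, ← DirectSum.lof_eq_of ℚ, DirectSum.toModule_lof]
  rfl

/-- The sign involution of a gcdga, acting on degree `n` as `(-1)^n`. -/
def eps (A : Type) [GCDGA A] : A →ₐ[ℚ] A :=
  AlgHom.ofLinearMap (epsLin A)
    (by rw [epsLin_of_mem one_mem_Gr]; simp)
    (fun a b => by
      refine Gr_induction a (by simp) (fun a b ha hb => by simp [add_mul, ha, hb]) fun m a ha => ?_
      refine Gr_induction b (by simp) (fun a b ha hb => by simp [mul_add, ha, hb]) fun n b hb => ?_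
      rw [epsLin_of_mem ha, epsLin_of_mem hb, epsLin_of_mem (mul_mem_Gr ha hb),
        smul_mul_smul_comm, pow_add])

theorem eps_of_mem {n : ℕ} {a : A} (h : a ∈ Gr A n) : eps A a = ((-1 : ℚ) ^ n) • a :=
  epsLin_of_mem h

theorem eps_even {n : ℕ} {a : A} (h : a ∈ Gr A n) (hn : Even n) : eps A a = a := by
  rw [eps_of_mem h, hn.neg_one_pow, one_smul]

theorem eps_odd {n : ℕ} {a : A} (h : a ∈ Gr A n) (hn : Odd n) : eps A a = -a := by
  rw [eps_of_mem h, hn.neg_one_pow, neg_smul, one_smul]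

theorem eps_mem {n : ℕ} {a : A} (h : a ∈ Gr A n) : eps A a ∈ Gr A n := by
  rw [eps_of_mem h]; exact Submodule.smul_mem _ _ h

@[simp] theorem eps_eps (a : A) : eps A (eps A a) = a := by
  refine Gr_induction a (by simp) (fun a b ha hb => by simp [ha, hb]) fun m a ha => ?_
  rw [eps_of_mem ha, map_smul, eps_of_mem ha, smul_smul, ← mul_pow]; simp

theorem Dd_eps (a : A) : Dd A (eps A a) = -eps A (Dd A a) := by
  refine Gr_induction a (by simp) (fun a b ha hb => by simp [ha, hb, add_comm]) fun m a ha => ?_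
  rw [eps_of_mem ha, eps_of_mem (Dd_mem ha), map_smul, pow_succ]; simp

theorem Dd_mul (a b : A) : Dd A (a * b) = Dd A a * b + eps A a * Dd A b := by
  refine Gr_induction a (by simp) (fun a b ha hb => ?_) fun m a ha => ?_
  · rw [add_mul, map_add, ha, hb, map_add, map_add]; noncomm_ring
  · rw [eps_of_mem ha, smul_mul_assoc]; exact GCDGA.d_leibniz m a b ha

@[simp] theorem Dd_one : Dd A 1 = 0 := by
  have := Dd_mul (1 : A) 1
  simpa using this

theorem graded_eps {f : A →ₐ[ℚ] B} (hf : ∀ (i : ℕ) (a : A), a ∈ Gr A i → f a ∈ Gr B i) (a : A) :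
    f (eps A a) = eps B (f a) := by
  refine Gr_induction a (by simp) (fun a b ha hb => by simp [ha, hb]) fun m a ha => ?_
  rw [eps_of_mem ha, eps_of_mem (hf _ _ ha), map_smul]

theorem odd_mul {n : ℕ} {e : A} (he : e ∈ Gr A n) (hn : Odd n) (b : A) :
    e * b = eps A b * e := by
  refine Gr_induction b (by simp) (fun a b ha hb => by simp [mul_add, add_mul, ha, hb])
    fun m b hb => ?_
  rw [eps_of_mem hb, Gr_comm he hb, smul_mul_assoc, pow_mul, hn.neg_one_pow]

theorem mul_odd {n : ℕ} {e : A} (he : e ∈ Gr A n) (hn : Odd n) (b : A) :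
    b * e = e * eps A b := by
  rw [odd_mul he hn, eps_eps]

theorem odd_mul_self {n : ℕ} {e : A} (he : e ∈ Gr A n) (hn : Odd n) : e * e = 0 := by
  have h : e * e = -(e * e) := by
    conv_lhs => rw [odd_mul he hn, eps_odd he hn, neg_mul]
  have h2 : (2 : ℚ) • (e * e) = 0 := by
    rw [two_smul]; nth_rewrite 1 [h]; simp
  exact (smul_eq_zero.mp h2).resolve_left two_ne_zero

theorem even_mul {n : ℕ} {e : A} (he : e ∈ Gr A n) (hn : Even n) (b : A) :
    e * b = b * e := by
  refine Gr_induction b (by simp) (fun a b ha hb => by simp [mul_add, add_mul, ha, hb])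
    fun m b hb => ?_
  rw [Gr_comm he hb, (hn.mul_right m).neg_one_pow, one_smul]

/-- The subalgebra of cocycles. -/
def cocycles (A : Type) [GCDGA A] : Subalgebra ℚ A where
  carrier := {a | Dd A a = 0}
  mul_mem' := by
    intro a b ha hb
    simp only [Set.mem_ofPred_eq] at *
    rw [Dd_mul, ha, hb]; simp
  add_mem' := by
    intro a b ha hb
    simp only [Set.mem_ofPred_eq] at *
    rw [map_add, ha, hb, add_zero]
  algebraMap_mem' := by
    intro r
    simp [Algebra.algebraMap_eq_smul_one]

/-- The subalgebra of central elements fixed by the sign involution. -/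
def evenSub (A : Type) [GCDGA A] : Subalgebra ℚ A :=
  Subalgebra.center ℚ A ⊓ AlgHom.equalizer (eps A) (AlgHom.id ℚ A)

theorem mem_evenSub {n : ℕ} {a : A} (h : a ∈ Gr A n) (hn : Even n) : a ∈ evenSub A :=
  ⟨Subalgebra.mem_center_iff.mpr fun b => (even_mul h hn b).symm, eps_even h hn⟩

theorem evenSub_comm {a : A} (h : a ∈ evenSub A) (b : A) : a * b = b * a :=
  (Subalgebra.mem_center_iff.mp h.1 b).symm

theorem evenSub_eps {a : A} (h : a ∈ evenSub A) : eps A a = a := h.2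

/-- A graded morphism commutes with the differentials if it does so on generators. -/
theorem isDGAHom_of_adjoin {f : A →ₐ[ℚ] B} (hf : ∀ (i : ℕ) (a : A), a ∈ Gr A i → f a ∈ Gr B i)
    {s : Set A} (hs : Algebra.adjoin ℚ s = ⊤) (h : ∀ a ∈ s, f (Dd A a) = Dd B (f a)) :
    IsDGAHom f := by
  refine ⟨fun a => ?_, hf⟩
  have ha : a ∈ Algebra.adjoin ℚ s := hs ▸ Algebra.mem_top
  induction ha using Algebra.adjoin_induction with
  | mem x hx => exact h x hx
  | algebraMap r => simp [Algebra.algebraMap_eq_smul_one]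
  | add x y _ _ hx hy => simp [hx, hy]
  | mul x y _ _ hx hy => rw [Dd_mul, map_add, map_mul, map_mul, map_mul, hx, hy, Dd_mul,
      graded_eps hf]

theorem IsDGAHom.comp {C : Type} [GCDGA C] {g : B →ₐ[ℚ] C} {f : A →ₐ[ℚ] B} (hg : IsDGAHom g)
    (hf : IsDGAHom f) : IsDGAHom (g.comp f) :=
  ⟨fun a => by simp [hf.1, hg.1], fun i a ha => hg.2 i _ (hf.2 i a ha)⟩

end Basic

/-- A criterion for a family of submodules to be an internal grading, in terms of a family of
linear maps separating the components. -/
theorem isInternal_of_separating {M N : Type} [AddCommGroup M] [Module ℚ M] [AddCommGroup N]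
    [Module ℚ N] (G : ℕ → Submodule ℚ M) (φ : ℕ → M →ₗ[ℚ] N)
    (h0 : ∀ m n a, m ≠ n → a ∈ G m → φ n a = 0) (h1 : ∀ n a, a ∈ G n → φ n a = 0 → a = 0)
    (htop : ∀ a, a ∈ ⨆ n, G n) : DirectSum.IsInternal G := by
  refine DirectSum.isInternal_submodule_of_iSupIndep_of_iSup_eq_top ?_
    (eq_top_iff.mpr fun a _ => htop a)
  rw [iSupIndep_def]
  intro n
  rw [Submodule.disjoint_def]
  intro a ha hb
  refine h1 n a ha ?_
  have : (⨆ j, ⨆ (_ : j ≠ n), G j) ≤ LinearMap.ker (φ n) :=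
    iSup₂_le fun j hj a ha => h0 j n a hj ha
  exact this hb

/-- Constructor for gcdga's, where the directness of the grading is witnessed by a family of
linear maps separating the components. -/
@[reducible] def mkGCDGA {T N : Type} [Ring T] [Algebra ℚ T] [AddCommGroup N] [Module ℚ N]
    (G : ℕ → Submodule ℚ T) (φ : ℕ → T →ₗ[ℚ] N)
    (h0 : ∀ m n a, m ≠ n → a ∈ G m → φ n a = 0) (h1 : ∀ n a, a ∈ G n → φ n a = 0 → a = 0)
    (htop : ∀ a, a ∈ ⨆ n, G n) (hone : (1 : T) ∈ G 0)
    (hmul : ∀ i j a b, a ∈ G i → b ∈ G j → a * b ∈ G (i + j))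
    (hcomm : ∀ i j a b, a ∈ G i → b ∈ G j → a * b = ((-1 : ℚ) ^ (i * j)) • (b * a))
    (d : T →ₗ[ℚ] T) (hd : ∀ a, d (d a) = 0) (hdG : ∀ i a, a ∈ G i → d a ∈ G (i + 1))
    (hdmul : ∀ i a b, a ∈ G i → d (a * b) = d a * b + ((-1 : ℚ) ^ i) • (a * d b)) : GCDGA T :=
  { ‹Ring T›, ‹Algebra ℚ T› with
    grading := G
    gradedAlgebra :=
      letI : SetLike.GradedMonoid G :=
        { one_mem := hone, mul_mem := fun i j a b ha hb => hmul i j a b ha hb }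
      DirectSum.IsInternal.gradedAlgebra (isInternal_of_separating G φ h0 h1 htop)
    grading_comm := hcomm
    d := d
    d_sq := hd
    d_grading := hdG
    d_leibniz := hdmul }

/-- A linear map killing the kernel of a surjection factors through it. -/
theorem exists_descend {M N P : Type} [AddCommGroup M] [Module ℚ M] [AddCommGroup N] [Module ℚ N]
    [AddCommGroup P] [Module ℚ P] (p : M →ₗ[ℚ] N) (hp : Function.Surjective p) (f : M →ₗ[ℚ] P)
    (h : ∀ a, p a = 0 → f a = 0) : ∃ g : N →ₗ[ℚ] P, ∀ a, g (p a) = f a := by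
  refine ⟨((LinearMap.ker p).liftQ f fun a ha => h a ha) ∘ₗ
    (p.quotKerEquivOfSurjective hp).symm.toLinearMap, fun a => ?_⟩
  have : (p.quotKerEquivOfSurjective hp).symm (p a) = (LinearMap.ker p).mkQ a := by
    rw [LinearEquiv.symm_apply_eq]; rfl
  simp only [LinearMap.comp_apply, LinearEquiv.coe_coe, this]
  exact Submodule.liftQ_apply _ _ _

/-- An algebra which is a quotient of a gcdga by a homogeneous differential ideal is a gcdga. -/
theorem exists_gcdga_of_surjective {A T : Type} [GCDGA A] [rT : Ring T] [aT : Algebra ℚ T]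
    (p : A →ₐ[ℚ] T) (hp : Function.Surjective p) (hpr : ∀ n a, p a = 0 → p (pr A n a) = 0)
    (hd : ∀ a, p a = 0 → p (Dd A a) = 0) :
    ∃ (Q : Type) (_ : GCDGA Q) (π : A →ₐ[ℚ] Q), IsDGAHom π ∧ Function.Surjective π ∧
      ∀ a, π a = 0 ↔ p a = 0 := by
  choose φ hφ using fun n => exists_descend p.toLinearMap hp (p.toLinearMap ∘ₗ pr A n) (hpr n)
  obtain ⟨d, hdp⟩ := exists_descend p.toLinearMap hp (p.toLinearMap ∘ₗ Dd A) hd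
  simp only [AlgHom.toLinearMap_apply, LinearMap.comp_apply] at hφ hdp
  let I : GCDGA T := mkGCDGA (fun n => (Gr A n).map p.toLinearMap) φ
    (by
      rintro m n _ hmn ⟨a, ha, rfl⟩
      rw [AlgHom.toLinearMap_apply, hφ, pr_of_mem_ne ha hmn, map_zero])
    (by
      rintro n _ ⟨a, ha, rfl⟩ h
      rwa [AlgHom.toLinearMap_apply, hφ, pr_of_mem ha] at h)
    (by
      intro t
      obtain ⟨a, rfl⟩ := hp t
      rw [← Submodule.map_iSup, iSup_Gr]
      exact ⟨a, trivial, rfl⟩)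
    ⟨1, one_mem_Gr, map_one p⟩
    (by
      rintro i j _ _ ⟨a, ha, rfl⟩ ⟨b, hb, rfl⟩
      exact ⟨a * b, mul_mem_Gr ha hb, map_mul p a b⟩)
    (by
      rintro i j _ _ ⟨a, ha, rfl⟩ ⟨b, hb, rfl⟩
      simp only [AlgHom.toLinearMap_apply, ← map_mul, ← map_smul, Gr_comm ha hb])
    d
    (by
      intro t
      obtain ⟨a, rfl⟩ := hp t
      rw [hdp, hdp, Dd_Dd, map_zero])
    (by
      rintro i _ ⟨a, ha, rfl⟩
      exact ⟨Dd A a, Dd_mem ha, (hdp a).symm⟩)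
    (by
      rintro i _ t ⟨a, ha, rfl⟩
      obtain ⟨b, rfl⟩ := hp t
      simp only [AlgHom.toLinearMap_apply, ← map_mul, hdp, ← map_smul, ← map_add]
      rw [Dd_mul, eps_of_mem ha, smul_mul_assoc])
  exact ⟨T, I, p, ⟨fun a => (hdp a).symm, fun i a ha => ⟨a, ha, rfl⟩⟩, hp, fun _ => Iff.rfl⟩

/-- The quotient of a gcdga by a two-sided homogeneous differential ideal. -/
theorem exists_quotient {A : Type} [GCDGA A] (I : Submodule ℚ A)
    (hl : ∀ a b, b ∈ I → a * b ∈ I) (hr : ∀ a b, a ∈ I → a * b ∈ I) (hI : Homog I)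
    (hd : ∀ a ∈ I, Dd A a ∈ I) :
    ∃ (Q : Type) (_ : GCDGA Q) (π : A →ₐ[ℚ] Q), IsDGAHom π ∧ Function.Surjective π ∧
      ∀ a, π a = 0 ↔ a ∈ I := by
  let J : Ideal A :=
    { carrier := I, add_mem' := I.add_mem, zero_mem' := I.zero_mem, smul_mem' := fun a b => hl a b }
  have : J.IsTwoSided := ⟨fun {a} b ha => hr a b ha⟩
  have key : ∀ a, Ideal.Quotient.mkₐ ℚ J a = 0 ↔ a ∈ I := fun a =>
    Ideal.Quotient.eq_zero_iff_mem
  obtain ⟨Q, iQ, π, h1, h2, h3⟩ := exists_gcdga_of_surjective (Ideal.Quotient.mkₐ ℚ J)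
    (Ideal.Quotient.mkₐ_surjective ℚ J)
    (fun n a ha => (key _).2 (hI n a ((key a).1 ha))) (fun a ha => (key _).2 (hd a ((key a).1 ha)))
  exact ⟨Q, iQ, π, h1, h2, fun a => (h3 a).trans (key a)⟩

/-- A subalgebra of a product of two gcdga's stable under projections and differential
is a gcdga. -/
theorem exists_sub_prod {P T : Type} [GCDGA P] [GCDGA T] (S : Subalgebra ℚ (P × T))
    (hpr : ∀ n, ∀ x ∈ S, (pr P n x.1, pr T n x.2) ∈ S)
    (hd : ∀ x ∈ S, (Dd P x.1, Dd T x.2) ∈ S) :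
    ∃ (C : Type) (_ : GCDGA C) (f : C →ₐ[ℚ] P) (g : C →ₐ[ℚ] T), IsDGAHom f ∧ IsDGAHom g ∧
      (∀ x y, f x = f y → g x = g y → x = y) ∧ (∀ x, (f x, g x) ∈ S) ∧
      (∀ x ∈ S, ∃ y, f y = x.1 ∧ g y = x.2) ∧
      ∀ n x, f x ∈ Gr P n → g x ∈ Gr T n → x ∈ Gr C n := by
  let f : S →ₐ[ℚ] P := (AlgHom.fst ℚ P T).comp S.val
  let g : S →ₐ[ℚ] T := (AlgHom.snd ℚ P T).comp S.val
  have inj : ∀ x y, f x = f y → g x = g y → x = y := fun x y h1 h2 =>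
    Subtype.ext (Prod.ext h1 h2)
  let φ : ℕ → S →ₗ[ℚ] S := fun n =>
    ((pr P n).prodMap (pr T n)).restrict (p := S.toSubmodule) (q := S.toSubmodule)
      fun x hx => hpr n x hx
  let d : S →ₗ[ℚ] S :=
    ((Dd P).prodMap (Dd T)).restrict (p := S.toSubmodule) (q := S.toSubmodule) fun x hx => hd x hx
  have hφf : ∀ n x, f (φ n x) = pr P n (f x) := fun n x => rfl
  have hφg : ∀ n x, g (φ n x) = pr T n (g x) := fun n x => rfl
  have hdf : ∀ x, f (d x) = Dd P (f x) := fun x => rfl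
  have hdg : ∀ x, g (d x) = Dd T (g x) := fun x => rfl
  have hfgS : ∀ x, (f x, g x) ∈ S := fun x => x.2
  have hSfg : ∀ x ∈ S, ∃ y, f y = x.1 ∧ g y = x.2 := fun x hx => ⟨⟨x, hx⟩, rfl, rfl⟩
  clear_value f g φ d
  let G : ℕ → Submodule ℚ S := fun n =>
    (Gr P n).comap f.toLinearMap ⊓ (Gr T n).comap g.toLinearMap
  have hφG : ∀ n x, φ n x ∈ G n := fun n x =>
    ⟨by simp [hφf, pr_mem], by simp [hφg, pr_mem]⟩
  let I : GCDGA S := mkGCDGA G φ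
    (by
      rintro m n a hmn ⟨h1, h2⟩
      replace h1 : f a ∈ Gr P m := h1
      replace h2 : g a ∈ Gr T m := h2
      refine inj _ _ ?_ ?_
      · rw [hφf, pr_of_mem_ne h1 hmn, map_zero]
      · rw [hφg, pr_of_mem_ne h2 hmn, map_zero])
    (by
      rintro n a ⟨h1, h2⟩ h
      rw [← h]
      refine inj _ _ ?_ ?_
      · rw [hφf]; exact (pr_of_mem h1).symm
      · rw [hφg]; exact (pr_of_mem h2).symm)
    (by
      intro a
      obtain ⟨N, -, hN⟩ := exists_bound (f a)
      obtain ⟨M, -, hM⟩ := exists_bound (g a)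
      have : a = ∑ n ∈ Finset.range (max N M), φ n a := by
        refine inj _ _ ?_ ?_
        · rw [map_sum]; simp only [hφf]; exact hN _ (le_max_left _ _)
        · rw [map_sum]; simp only [hφg]; exact hM _ (le_max_right _ _)
      rw [this]
      exact Submodule.sum_mem _ fun n _ => Submodule.mem_iSup_of_mem n (hφG n a))
    ⟨by simpa using one_mem_Gr, by simpa using one_mem_Gr⟩
    (by
      rintro i j a b ⟨h1, h2⟩ ⟨h3, h4⟩
      exact ⟨by simpa using mul_mem_Gr h1 h3, by simpa using mul_mem_Gr h2 h4⟩)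
    (by
      rintro i j a b ⟨h1, h2⟩ ⟨h3, h4⟩
      refine inj _ _ ?_ ?_
      · rw [map_smul, map_mul, map_mul]; exact Gr_comm h1 h3
      · rw [map_smul, map_mul, map_mul]; exact Gr_comm h2 h4)
    d
    (fun a => inj _ _ (by rw [hdf, hdf, Dd_Dd, map_zero]) (by rw [hdg, hdg, Dd_Dd, map_zero]))
    (by
      rintro i a ⟨h1, h2⟩
      exact ⟨by simpa [hdf] using Dd_mem h1, by simpa [hdg] using Dd_mem h2⟩)
    (by
      rintro i a b ⟨h1, h2⟩
      replace h1 : f a ∈ Gr P i := h1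
      replace h2 : g a ∈ Gr T i := h2
      refine inj _ _ ?_ ?_
      · rw [hdf, map_mul, Dd_mul, eps_of_mem h1, map_add, map_smul, map_mul, map_mul, hdf, hdf,
          smul_mul_assoc]
      · rw [hdg, map_mul, Dd_mul, eps_of_mem h2, map_add, map_smul, map_mul, map_mul, hdg, hdg,
          smul_mul_assoc])
  exact ⟨S, I, f, g, ⟨fun a => hdf a, fun i a h => h.1⟩, ⟨fun a => hdg a, fun i a h => h.2⟩, inj,
    hfgS, hSfg, fun n x h1 h2 => ⟨h1, h2⟩⟩

/-- The kernel of `f` is acyclic. -/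
def KerAcyclic {A B : Type} [GCDGA A] [GCDGA B] (f : A →ₐ[ℚ] B) : Prop :=
  ∀ a, Dd A a = 0 → f a = 0 → ∃ e, f e = 0 ∧ a = Dd A e

/-- An algebra morphism whose kernel contains that of a surjection factors through it. -/
theorem exists_algHom_descend {A B C : Type} [Ring A] [Algebra ℚ A] [Ring B] [Algebra ℚ B]
    [Ring C] [Algebra ℚ C] (p : A →ₐ[ℚ] B) (hp : Function.Surjective p) (f : A →ₐ[ℚ] C)
    (h : ∀ a, p a = 0 → f a = 0) : ∃ g : B →ₐ[ℚ] C, ∀ a, g (p a) = f a := by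
  obtain ⟨g, hg⟩ := exists_descend p.toLinearMap hp f.toLinearMap h
  simp only [AlgHom.toLinearMap_apply] at hg
  refine ⟨AlgHom.ofLinearMap g ?_ ?_, hg⟩
  · rw [← map_one p, hg, map_one]
  · intro x y
    obtain ⟨a, rfl⟩ := hp x
    obtain ⟨b, rfl⟩ := hp y
    rw [← map_mul, hg, hg, hg, map_mul]

theorem isDGAHom_descend {A B C : Type} [GCDGA A] [GCDGA B] [GCDGA C] {p : A →ₐ[ℚ] B}
    (hp : IsDGAHom p) (hps : Function.Surjective p) {f : A →ₐ[ℚ] C} (hf : IsDGAHom f)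
    {g : B →ₐ[ℚ] C} (hg : ∀ a, g (p a) = f a) : IsDGAHom g := by
  constructor
  · intro b
    obtain ⟨a, rfl⟩ := hps b
    rw [← hp.1, hg, hg, hf.1]
  · intro i b hb
    obtain ⟨a, rfl⟩ := hps b
    have h := map_pr_of_graded (f := p.toLinearMap) hp.2 i a
    simp only [AlgHom.toLinearMap_apply, pr_of_mem hb] at h
    rw [← h, hg]
    exact hf.2 _ _ (pr_mem i a)

/-- A surjection `ρ` through which a morphism `p` with acyclic kernel to an algebra with zero
differential factors admits a homotopy retraction. -/
theorem nonempty_htpyRetraction {T H Q : Type} [GCDGA T] [GCDGA H] [GCDGA Q] {p : T →ₐ[ℚ] H}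
    (hp : IsDGAHom p) (hpk : KerAcyclic p) (hH : Dd H = 0)
    {ρ : T →ₐ[ℚ] Q} (hρ : IsDGAHom ρ) (hρs : Function.Surjective ρ)
    (hk : ∀ a, ρ a = 0 → p a = 0) : Nonempty (HtpyRetraction ρ) := by
  obtain ⟨σ, hσ⟩ := exists_algHom_descend ρ hρs p hk
  have hσd := isDGAHom_descend hρ hρs hp hσ
  have hpd : ∀ t, p (Dd T t) = 0 := fun t => by rw [hp.1, hH]; rfl
  let S : Subalgebra ℚ (Q × T) :=
    AlgHom.equalizer (σ.comp (AlgHom.fst ℚ Q T)) (p.comp (AlgHom.snd ℚ Q T))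
  have hS : ∀ x, x ∈ S ↔ σ x.1 = p x.2 := fun x => Iff.rfl
  obtain ⟨C, iC, q, τ, hq, hτ, inj, hC, hC', hCG⟩ := exists_sub_prod S
    (fun n x hx => by
      have h1 := map_pr_of_graded (f := σ.toLinearMap) hσd.2 n x.1
      have h2 := map_pr_of_graded (f := p.toLinearMap) hp.2 n x.2
      rw [hS] at hx ⊢
      simp only [AlgHom.toLinearMap_apply] at h1 h2
      rw [h1, h2, hx])
    (fun x hx => by
      rw [hS]
      simp only [hσd.1, hp.1, hH]; rfl)
  choose j₀ hj₀ using fun t : T => hC' (ρ t, t) ((hS _).2 (hσ t))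
  simp only at hj₀
  let j : T →ₐ[ℚ] C := AlgHom.ofLinearMap
    { toFun := j₀
      map_add' := fun a b => inj _ _ (by simp [(hj₀ _).1]) (by simp [(hj₀ _).2])
      map_smul' := fun a b => inj _ _ (by simp [(hj₀ _).1]) (by simp [(hj₀ _).2]) }
    (inj _ _ (by simp [(hj₀ _).1]) (by simp [(hj₀ _).2]))
    (fun a b => inj _ _ (by simp [(hj₀ _).1]) (by simp [(hj₀ _).2]))
  have hj1 : ∀ t, q (j t) = ρ t := fun t => (hj₀ t).1
  have hj2 : ∀ t, τ (j t) = t := fun t => (hj₀ t).2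
  clear_value j
  refine ⟨{ C := C, j := j, q := q, τ := τ, j_dga := ⟨fun a => inj _ _ ?_ ?_, fun i a h => hCG _ _ ?_ ?_⟩
            q_dga := hq, τ_dga := hτ, q_surj := fun x => ?_, q_quasi := ⟨?_, ?_⟩
            hqj := AlgHom.ext hj1, hτj := AlgHom.ext hj2 }⟩
  · rw [hj1, hq.1, hj1, hρ.1]
  · rw [hj2, hτ.1, hj2]
  · rw [hj1]; exact hρ.2 _ _ h
  · rwa [hj2]
  · obtain ⟨t, rfl⟩ := hρs x
    exact ⟨j t, hj1 t⟩
  · intro b hb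
    obtain ⟨t, rfl⟩ := hρs b
    obtain ⟨e, he, hde⟩ := hpk (Dd T t) (Dd_Dd t) (hpd t)
    obtain ⟨c, hc1, hc2⟩ := hC' (ρ t, t - e) ((hS _).2 (by simp [hσ, he]))
    simp only at hc1 hc2
    refine ⟨c, inj _ _ ?_ ?_, 0, ?_⟩
    · rw [hq.1, hc1, hb, map_zero]
    · rw [hτ.1, hc2, map_sub, ← hde, sub_self, map_zero]
    · rw [hc1]; simp
  · rintro c hc ⟨b, hb⟩
    obtain ⟨t, rfl⟩ := hρs b
    have hcS := (hS _).1 (hC c)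
    simp only [hb, hσd.1, hH] at hcS
    obtain ⟨e, he, hde⟩ := hpk (Dd T t - τ c) (by rw [map_sub, Dd_Dd, ← hτ.1, hc]; simp)
      (by rw [map_sub, hpd, ← hcS]; simp)
    obtain ⟨c', hc1, hc2⟩ := hC' (ρ t, t - e) ((hS _).2 (by simp [hσ, he]))
    simp only at hc1 hc2
    refine ⟨c', inj _ _ ?_ ?_⟩
    · rw [hq.1, hc1, hb]
    · rw [hτ.1, hc2, map_sub, ← hde]; abel

/-- The underlying module of the extension of `C` by an odd generator `u`:
the pair `(a, b)` stands for `a + b u`. -/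
def OddExt (C : Type) : Type := C × C

namespace OddExt

variable {C : Type} [GCDGA C]

instance : AddCommGroup (OddExt C) := inferInstanceAs (AddCommGroup (C × C))
instance : Module ℚ (OddExt C) := inferInstanceAs (Module ℚ (C × C))
instance : Mul (OddExt C) := ⟨fun x y => (x.1 * y.1, x.1 * y.2 + x.2 * eps C y.1)⟩
instance : One (OddExt C) := ⟨((1 : C), (0 : C))⟩

/-- The element `a + b u`. -/
def mk {C : Type} (a b : C) : OddExt C := (a, b)

@[simp] theorem fst_mk {C : Type} (a b : C) : (mk a b).1 = a := rfl
@[simp] theorem snd_mk {C : Type} (a b : C) : (mk a b).2 = b := rfl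

@[ext] theorem ext {C : Type} {x y : OddExt C} (h1 : x.1 = y.1) (h2 : x.2 = y.2) : x = y := Prod.ext h1 h2

@[simp] theorem fst_add (x y : OddExt C) : (x + y).1 = x.1 + y.1 := rfl
@[simp] theorem snd_add (x y : OddExt C) : (x + y).2 = x.2 + y.2 := rfl
@[simp] theorem fst_zero : (0 : OddExt C).1 = 0 := rfl
@[simp] theorem snd_zero : (0 : OddExt C).2 = 0 := rfl
@[simp] theorem fst_one : (1 : OddExt C).1 = 1 := rfl
@[simp] theorem snd_one : (1 : OddExt C).2 = 0 := rfl
@[simp] theorem fst_smul (r : ℚ) (x : OddExt C) : (r • x).1 = r • x.1 := rfl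
@[simp] theorem snd_smul (r : ℚ) (x : OddExt C) : (r • x).2 = r • x.2 := rfl
@[simp] theorem fst_mul (x y : OddExt C) : (x * y).1 = x.1 * y.1 := rfl
@[simp] theorem snd_mul (x y : OddExt C) : (x * y).2 = x.1 * y.2 + x.2 * eps C y.1 := rfl

instance : Ring (OddExt C) :=
  { (inferInstance : AddCommGroup (OddExt C)), (inferInstance : Mul (OddExt C)),
    (inferInstance : One (OddExt C)) with
    mul_assoc := fun x y z => ext (by simp [mul_assoc]) (by simp; noncomm_ring)
    one_mul := fun x => ext (by simp) (by simp)
    mul_one := fun x => ext (by simp) (by simp)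
    zero_mul := fun x => ext (by simp) (by simp)
    mul_zero := fun x => ext (by simp) (by simp)
    left_distrib := fun x y z => ext (by simp [mul_add]) (by simp; noncomm_ring)
    right_distrib := fun x y z => ext (by simp [add_mul]) (by simp; noncomm_ring) }

instance : Algebra ℚ (OddExt C) :=
  Algebra.ofModule (fun r x y => ext (by simp) (by simp))
    (fun r x y => ext (by simp) (by simp))

/-- The grading on the second component, shifted by the degree `l` of the new generator. -/
def shiftGr (C : Type) [GCDGA C] (l n : ℕ) : Submodule ℚ C := ⨆ m, ⨆ (_ : m + l = n), Gr C m

theorem mem_shiftGr {l n : ℕ} {b : C} (h : b ∈ shiftGr C l n) :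
    b = 0 ∨ ∃ m, m + l = n ∧ b ∈ Gr C m := by
  by_cases hl : l ≤ n
  · refine Or.inr ⟨n - l, by omega, ?_⟩
    have : shiftGr C l n ≤ Gr C (n - l) := iSup₂_le fun m hm => by
      have : m = n - l := by omega
      rw [this]
    exact this h
  · left
    have : shiftGr C l n ≤ ⊥ := iSup₂_le fun m hm => by omega
    exact this h

theorem shiftGr_mem {l m : ℕ} {b : C} (h : b ∈ Gr C m) : b ∈ shiftGr C l (m + l) :=
  Submodule.mem_iSup_of_mem m (Submodule.mem_iSup_of_mem rfl h)

/-- The degree `n` component of the odd extension. -/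
def grading (C : Type) [GCDGA C] (l n : ℕ) : Submodule ℚ (OddExt C) :=
  (Gr C n).prod (shiftGr C l n)

/-- The inclusion of the base. -/
def inl (C : Type) [GCDGA C] : C →ₐ[ℚ] OddExt C :=
  AlgHom.ofLinearMap
    { toFun := fun a => mk a 0
      map_add' := fun a b => ext (by simp) (by simp)
      map_smul' := fun r a => ext (by simp) (by simp) }
    rfl (fun a b => ext (by simp) (by simp))

@[simp] theorem fst_inl (a : C) : (inl C a).1 = a := rfl
@[simp] theorem snd_inl (a : C) : (inl C a).2 = 0 := rfl

/-- The new generator. -/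
def gen (C : Type) [GCDGA C] : OddExt C := mk 0 1

@[simp] theorem fst_gen : (gen C).1 = 0 := rfl
@[simp] theorem snd_gen : (gen C).2 = 1 := rfl

/-- The differential of the odd extension with `d u = c`. -/
def diff (c : C) : OddExt C →ₗ[ℚ] OddExt C where
  toFun x := mk (Dd C x.1 + eps C x.2 * c) (Dd C x.2)
  map_add' x y := ext (by simp; noncomm_ring) (by simp)
  map_smul' r x := ext (by simp) (by simp)

@[simp] theorem fst_diff (c : C) (x : OddExt C) : (diff c x).1 = Dd C x.1 + eps C x.2 * c := rfl
@[simp] theorem snd_diff (c : C) (x : OddExt C) : (diff c x).2 = Dd C x.2 := rfl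

/-- The odd extension as a gcdga. -/
@[reducible] def gcdga {l : ℕ} (hl : Odd l) {c : C} (hc : c ∈ Gr C (l + 1)) (hdc : Dd C c = 0) :
    GCDGA (OddExt C) :=
  mkGCDGA (grading C l)
    (fun n => (pr C n).prodMap (if l ≤ n then pr C (n - l) else 0))
    (by
      rintro m n ⟨a, b⟩ hmn ⟨h1, h2⟩
      refine ext (pr_of_mem_ne h1 hmn) ?_
      rcases mem_shiftGr h2 with h2 | ⟨k, hk, h2⟩
      · simp only at h2
        subst h2
        exact map_zero (if l ≤ n then pr C (n - l) else 0)
      · change (if l ≤ n then pr C (n - l) else 0) b = 0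
        split_ifs
        · exact pr_of_mem_ne h2 (by omega)
        · rfl)
    (by
      rintro n ⟨a, b⟩ ⟨h1, h2⟩ h
      refine ext ((pr_of_mem h1).symm.trans (congrArg Prod.fst h)) ?_
      rcases mem_shiftGr h2 with h2 | ⟨k, hk, h2⟩
      · exact h2
      · have h3 : (if l ≤ n then pr C (n - l) else 0) b = 0 := congrArg Prod.snd h
        rw [if_pos (by omega), show n - l = k by omega] at h3
        exact (pr_of_mem h2).symm.trans h3)
    (by
      rintro ⟨a, b⟩
      have h1 : mk a (0 : C) ∈ ⨆ n, grading C l n := by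
        refine Gr_induction a (Submodule.zero_mem _) (fun a b ha hb => ?_) fun n a ha => ?_
        · have := Submodule.add_mem _ ha hb
          convert this using 1
          exact ext (by simp) (by simp)
        · exact Submodule.mem_iSup_of_mem n ⟨ha, Submodule.zero_mem _⟩
      have h2 : mk (0 : C) b ∈ ⨆ n, grading C l n := by
        refine Gr_induction b (Submodule.zero_mem _) (fun a b ha hb => ?_) fun n a ha => ?_
        · have := Submodule.add_mem _ ha hb
          convert this using 1
          exact ext (by simp) (by simp)
        · exact Submodule.mem_iSup_of_mem (n + l) ⟨Submodule.zero_mem _, shiftGr_mem ha⟩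
      have h3 : mk a b = mk a 0 + mk 0 b := ext (by simp) (by simp)
      change mk a b ∈ _
      rw [h3]
      exact Submodule.add_mem _ h1 h2)
    ⟨one_mem_Gr, Submodule.zero_mem _⟩
    (by
      rintro i j ⟨a, b⟩ ⟨a', b'⟩ ⟨h1, h2⟩ ⟨h3, h4⟩
      simp only at h1 h2 h3 h4
      refine ⟨mul_mem_Gr h1 h3, Submodule.add_mem _ ?_ ?_⟩
      · rcases mem_shiftGr h4 with rfl | ⟨k, rfl, h4'⟩
        · simp
        · rw [← add_assoc]; exact shiftGr_mem (mul_mem_Gr (b := b') h1 h4')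
      · rcases mem_shiftGr h2 with rfl | ⟨k, rfl, h2'⟩
        · simp
        · rw [show k + l + j = k + j + l by ring]
          exact shiftGr_mem (mul_mem_Gr (a := b) h2' (eps_mem h3)))
    (by
      rintro i j ⟨a, b⟩ ⟨a', b'⟩ ⟨h1, h2⟩ ⟨h3, h4⟩
      simp only at h1 h2 h3 h4
      refine ext (Gr_comm h1 h3) ?_
      change a * b' + b * eps C a' = ((-1 : ℚ) ^ (i * j)) • (a' * b + b' * eps C a)
      rw [smul_add, add_comm]
      congr 1
      · rcases mem_shiftGr h2 with rfl | ⟨k, rfl, h2'⟩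
        · simp
        · rw [eps_of_mem h3, mul_smul_comm, Gr_comm h2' h3, smul_smul, add_mul, pow_add, mul_comm,
            pow_mul _ l, hl.neg_one_pow]
      · rcases mem_shiftGr h4 with rfl | ⟨k, rfl, h4'⟩
        · simp
        · rw [eps_of_mem h1, mul_smul_comm, Gr_comm h1 h4', smul_smul, mul_add, pow_add,
            mul_comm i l, pow_mul _ l, hl.neg_one_pow, mul_assoc, ← mul_pow]
          simp)
    (diff c)
    (fun x => ext (by simp [Dd_Dd, Dd_mul, Dd_eps, hdc]) (by simp [Dd_Dd]))
    (by
      rintro i ⟨a, b⟩ ⟨h1, h2⟩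
      simp only at h1 h2
      rcases mem_shiftGr h2 with rfl | ⟨k, rfl, h2'⟩
      · refine ⟨?_, ?_⟩
        · change Dd C a + eps C 0 * c ∈ Gr C _
          simpa using Dd_mem h1
        · change Dd C 0 ∈ shiftGr C _ _
          simp
      · refine ⟨Submodule.add_mem _ (Dd_mem h1) ?_, ?_⟩
        · rw [add_assoc]; exact mul_mem_Gr (eps_mem (a := b) h2') hc
        · change Dd C b ∈ _
          rw [show k + l + 1 = k + 1 + l by ring]
          exact shiftGr_mem (Dd_mem (a := b) h2'))
    (by
      rintro i x y hx
      obtain ⟨h1, h2⟩ : x.1 ∈ Gr C i ∧ x.2 ∈ shiftGr C l i := hx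
      have hb : eps C x.2 = -((-1 : ℚ) ^ i • x.2) := by
        rcases mem_shiftGr h2 with h | ⟨k, rfl, h2'⟩
        · simp [h]
        · rw [eps_of_mem h2', pow_add, hl.neg_one_pow]; simp
      have hcc : ∀ z, c * z = z * c := even_mul hc hl.add_one
      refine ext ?_ ?_
      · simp only [fst_diff, fst_mul, snd_mul, fst_add, fst_smul, Dd_mul, map_add, map_mul, eps_eps,
          mul_add, add_mul, smul_add, hb]
        rw [eps_of_mem h1]
        simp only [smul_mul_assoc, neg_mul, mul_assoc, hcc]
        abel
      · simp only [snd_diff, snd_mul, snd_add, fst_diff, snd_smul, Dd_mul, map_add, map_mul,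
          mul_add, add_mul, smul_add, Dd_eps, hb, eps_eps]
        rw [eps_of_mem h1]
        have hce : eps C c = c := eps_even hc hl.add_one
        simp only [smul_mul_assoc, neg_mul, mul_neg, neg_neg, mul_assoc, hce, hcc]
        abel)

end OddExt

/-- `ι : C → E` exhibits `E` as the extension of `C` by an odd generator `u` of degree `l`
with `d u = c`. -/
structure IsOddExt {C E : Type} [GCDGA C] [GCDGA E] (ι : C →ₐ[ℚ] E) (u : E) (l : ℕ) (c : C) :
    Prop where
  dga : IsDGAHom ι
  mem : u ∈ Gr E l
  d_gen : Dd E u = ι c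
  exists_rep : ∀ x, ∃ a b, x = ι a + ι b * u
  indep : ∀ a b, ι a + ι b * u = 0 → a = 0 ∧ b = 0
  lift : ∀ (W : Type) [GCDGA W] (f : C →ₐ[ℚ] W), IsDGAHom f → ∀ w ∈ Gr W l, Dd W w = f c →
    ∃ g : E →ₐ[ℚ] W, IsDGAHom g ∧ (∀ a, g (ι a) = f a) ∧ g u = w

theorem exists_oddExt {C : Type} [GCDGA C] {l : ℕ} (hl : Odd l) {c : C} (hc : c ∈ Gr C (l + 1))
    (hdc : Dd C c = 0) :
    ∃ (E : Type) (_ : GCDGA E) (ι : C →ₐ[ℚ] E) (u : E), IsOddExt ι u l c := by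
  refine ⟨OddExt C, OddExt.gcdga hl hc hdc, OddExt.inl C, OddExt.gen C, ?_⟩
  let _ := OddExt.gcdga hl hc hdc
  have hd : ∀ x : OddExt C, Dd (OddExt C) x = OddExt.diff c x := fun _ => rfl
  have hrep : ∀ x : OddExt C, x = OddExt.inl C x.1 + OddExt.inl C x.2 * OddExt.gen C := fun x =>
    OddExt.ext (by simp) (by simp)
  refine ⟨⟨fun a => ?_, fun i a ha => ⟨ha, Submodule.zero_mem _⟩⟩, ⟨Submodule.zero_mem _, ?_⟩, ?_,
    fun x => ⟨x.1, x.2, hrep x⟩, fun a b h => ?_, ?_⟩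
  · rw [hd]; exact OddExt.ext (by simp) (by simp)
  · have := OddExt.shiftGr_mem (l := l) (one_mem_Gr (A := C))
    rwa [zero_add] at this
  · rw [hd]; exact OddExt.ext (by simp) (by simp)
  · exact ⟨by simpa using congrArg Prod.fst h, by simpa using congrArg Prod.snd h⟩
  · intro W _ f hf w hw hdw
    have hww := odd_mul_self hw hl
    let g : OddExt C →ₐ[ℚ] W := AlgHom.ofLinearMap
      { toFun := fun x => f x.1 + f x.2 * w
        map_add' := fun x y => by simp; noncomm_ring
        map_smul' := fun r x => by simp }
      (by simp)
      (fun x y => by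
        have h1 : w * f y.1 = f (eps C y.1) * w := by rw [odd_mul hw hl, graded_eps hf.2]
        have h2 : w * (f y.2 * w) = 0 := by rw [← mul_assoc, odd_mul hw hl, mul_assoc, hww, mul_zero]
        simp only [LinearMap.coe_mk, AddHom.coe_mk, OddExt.fst_mul, OddExt.snd_mul, map_add,
          map_mul, add_mul, mul_add, mul_assoc, h1, h2, mul_zero, add_zero]
        abel)
    have hg : ∀ x, g x = f x.1 + f x.2 * w := fun x => rfl
    refine ⟨g, ⟨fun x => ?_, fun i x hx => ?_⟩, fun a => by simp [hg], by simp [hg]⟩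
    · simp only [hg, hd, OddExt.fst_diff, OddExt.snd_diff, map_add, map_mul, hf.1, Dd_mul, hdw,
        graded_eps hf.2]
      abel
    · obtain ⟨h1, h2⟩ : x.1 ∈ Gr C i ∧ x.2 ∈ OddExt.shiftGr C l i := hx
      rw [hg]
      refine Submodule.add_mem _ (hf.2 _ _ h1) ?_
      rcases OddExt.mem_shiftGr h2 with h | ⟨k, rfl, h⟩
      · simp [h]
      · exact mul_mem_Gr (hf.2 _ _ h) hw

namespace IsOddExt

variable {A B E F : Type} [GCDGA A] [GCDGA B] [GCDGA E] [GCDGA F] {ι : A →ₐ[ℚ] E} {u : E}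
  {ι' : B →ₐ[ℚ] F} {u' : F} {l : ℕ} {c : A} {ψ : A →ₐ[ℚ] B}

theorem d_rep (hE : IsOddExt ι u l c) (a b : A) :
    Dd E (ι a + ι b * u) = ι (Dd A a + eps A b * c) + ι (Dd A b) * u := by
  rw [map_add, Dd_mul, hE.d_gen, ← graded_eps hE.dga.2, ← hE.dga.1, ← hE.dga.1, map_add, map_mul]
  abel

theorem d_eq_zero (hE : IsOddExt ι u l 0) (hA : Dd A = 0) : Dd E = 0 := by
  ext x
  obtain ⟨a, b, rfl⟩ := hE.exists_rep x
  rw [hE.d_rep, hA]; simp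

theorem kerAcyclic (hE : IsOddExt ι u l c) (hF : IsOddExt ι' u' l (ψ c)) (hψ : IsDGAHom ψ)
    (hk : KerAcyclic ψ) (hdc : Dd A c = 0) {Ψ : E →ₐ[ℚ] F} (h1 : ∀ a, Ψ (ι a) = ι' (ψ a)) (h2 : Ψ u = u') :
    KerAcyclic Ψ := by
  intro x hx hΨ
  obtain ⟨a, b, rfl⟩ := hE.exists_rep x
  rw [hE.d_rep] at hx
  obtain ⟨hda, hdb⟩ := hE.indep _ _ hx
  rw [map_add, map_mul, h1, h1, h2] at hΨ
  obtain ⟨ha, hb⟩ := hF.indep _ _ hΨ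
  obtain ⟨e, he, rfl⟩ := hk b hdb hb
  have he' : ψ (eps A e * c) = 0 := by
    rw [map_mul, graded_eps hψ.2, he, map_zero, zero_mul]
  obtain ⟨e', he1, he2⟩ := hk (a - eps A e * c) (by
    rw [map_sub, Dd_mul, hdc, Dd_eps, mul_zero, add_zero, neg_mul, sub_neg_eq_add, hda]) (by
    rw [map_sub, ha, he', sub_zero])
  refine ⟨ι e' + ι e * u, by rw [map_add, map_mul, h1, h1, he, he1]; simp, ?_⟩
  rw [hE.d_rep, ← he2, sub_add_cancel]

end IsOddExt

/-- A gcdga with zero differential can be extended by free odd generators. -/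
theorem exists_odd_generators {C : Type} [GCDGA C] (hC : Dd C = 0) :
    ∀ (m : ℕ) (deg : Fin m → ℕ), (∀ i, Odd (deg i)) →
    ∃ (G : Type) (_ : GCDGA G) (β : C →ₐ[ℚ] G) (e : Fin m → G), Dd G = 0 ∧ IsDGAHom β ∧
      (∀ i, e i ∈ Gr G (deg i)) ∧ ∀ c, c ≠ 0 → β c * (List.ofFn e).prod ≠ 0
  | 0, _, _ => ⟨C, inferInstance, AlgHom.id ℚ C, Fin.elim0, hC, isDGAHom_id C, fun i => i.elim0,
      fun c hc => by simpa using hc⟩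
  | m + 1, deg, hdeg => by
    obtain ⟨G, _, β, e, hG, hβ, he, hne⟩ :=
      exists_odd_generators hC m (fun i => deg i.castSucc) fun i => hdeg _
    obtain ⟨E, _, ι, u, hE⟩ := exists_oddExt (C := G) (hdeg (Fin.last m)) (Submodule.zero_mem _)
      (map_zero _)
    refine ⟨E, inferInstance, ι.comp β, Fin.snoc (fun i => ι (e i)) u, hE.d_eq_zero hG,
      hE.dga.comp hβ, fun i => ?_, fun c hc h => ?_⟩
    · refine Fin.lastCases ?_ (fun i => ?_) i
      · rw [Fin.snoc_last]; exact hE.mem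
      · rw [Fin.snoc_castSucc]; exact hE.dga.2 _ _ (he i)
    · rw [List.ofFn_succ', List.concat_eq_append, List.prod_append] at h
      simp only [Fin.snoc_castSucc, Fin.snoc_last, List.prod_singleton] at h
      have h3 : (List.ofFn fun i => ι (e i)).prod = ι (List.ofFn e).prod := by
        rw [map_list_prod, List.map_ofFn]; rfl
      rw [h3, ← mul_assoc, AlgHom.comp_apply, ← map_mul] at h
      exact hne c hc (hE.indep 0 _ (by rw [map_zero, zero_add]; exact h)).2

/-- Killing finitely many even cocycles by odd generators, compatibly with a morphism with
acyclic kernel. -/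
theorem exists_killing : ∀ (p : ℕ) {A B : Type} [GCDGA A] [GCDGA B] {ψ : A →ₐ[ℚ] B},
    IsDGAHom ψ → KerAcyclic ψ → ∀ (x : Fin p → A) (deg : Fin p → ℕ), (∀ i, Odd (deg i)) →
    (∀ i, x i ∈ Gr A (deg i + 1)) → (∀ i, Dd A (x i) = 0) →
    ∃ (D : Type) (_ : GCDGA D) (F : Type) (_ : GCDGA F) (α : A →ₐ[ℚ] D) (β : B →ₐ[ℚ] F)
      (Ψ : D →ₐ[ℚ] F) (u : Fin p → D), IsDGAHom α ∧ IsDGAHom Ψ ∧ KerAcyclic Ψ ∧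
      (∀ a, Ψ (α a) = β (ψ a)) ∧ (∀ i, u i ∈ Gr D (deg i)) ∧ (∀ i, Dd D (u i) = α (x i)) ∧
      ∀ (W : Type) [GCDGA W] (g : A →ₐ[ℚ] W), IsDGAHom g → (∀ i, g (x i) = 0) →
        ∃ h : D →ₐ[ℚ] W, IsDGAHom h ∧ (∀ a, h (α a) = g a) ∧ ∀ i, h (u i) = 0
  | 0, A, B, _, _, ψ, hψ, hk, _, _, _, _, _ =>
      ⟨A, inferInstance, B, inferInstance, AlgHom.id ℚ A, AlgHom.id ℚ B, ψ, Fin.elim0,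
        isDGAHom_id A, hψ, hk, fun _ => rfl, fun i => i.elim0, fun i => i.elim0,
        fun W _ g hg _ => ⟨g, hg, fun _ => rfl, fun i => i.elim0⟩⟩
  | p + 1, A, B, _, _, ψ, hψ, hk, x, deg, hdeg, hx, hdx => by
    obtain ⟨E, _, ι, v, hE⟩ := exists_oddExt (hdeg 0) (hx 0) (hdx 0)
    obtain ⟨E', _, ι', v', hE'⟩ := exists_oddExt (hdeg 0) (hψ.2 _ _ (hx 0))
      (by rw [← hψ.1, hdx, map_zero])
    obtain ⟨φ, hφ, hφ1, hφ2⟩ := hE.lift E' (ι'.comp ψ) (hE'.dga.comp hψ) v' hE'.mem hE'.d_gen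
    obtain ⟨D, _, F, _, α, β, Ψ, u, hα, hΨ, hkΨ, hc, hu, hdu, hlift⟩ :=
      exists_killing p hφ (hE.kerAcyclic hE' hψ hk (hdx 0) hφ1 hφ2) (fun i => ι (x i.succ))
        (fun i => deg i.succ) (fun i => hdeg _) (fun i => hE.dga.2 _ _ (hx _))
        (fun i => by rw [← hE.dga.1, hdx, map_zero])
    refine ⟨D, inferInstance, F, inferInstance, α.comp ι, β.comp ι', Ψ, Fin.cons (α v) u,
      hα.comp hE.dga, hΨ, hkΨ, fun a => ?_, fun i => ?_, fun i => ?_, fun W _ g hg hgx => ?_⟩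
    · simp [hc, hφ1]
    · refine Fin.cases ?_ (fun i => ?_) i
      · exact hα.2 _ _ hE.mem
      · exact hu i
    · refine Fin.cases ?_ (fun i => ?_) i
      · simp [← hα.1, hE.d_gen]
      · simp [hdu]
    · obtain ⟨g1, hg1, hg11, hg12⟩ := hE.lift W g hg 0 (Submodule.zero_mem _) (by simp [hgx])
      obtain ⟨h, hh, hh1, hh2⟩ := hlift W g1 hg1 (fun i => by rw [hg11, hgx])
      refine ⟨h, hh, fun a => by simp [hh1, hg11], fun i => ?_⟩
      refine Fin.cases ?_ (fun i => ?_) i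
      · simp [hh1, hg12]
      · simp [hh2]

open scoped TensorProduct

section TensorAux

variable (A C : Type) [GCDGA A] [GCDGA C]

/-- The algebra underlying the (graded) tensor product of two gcdga's. -/
abbrev TensorAlg : Type := GradedTensorProduct ℚ (Gr A) (Gr C)

/-- The canonical map from the tensor product to its graded version. -/
def toTensorAlg : A ⊗[ℚ] C →ₗ[ℚ] TensorAlg A C :=
  (GradedTensorProduct.of ℚ (Gr A) (Gr C)).toLinearMap

/-- The linear endomorphism of `TensorAlg A C` induced by one of the tensor product. -/
def tensorEnd (f : A ⊗[ℚ] C →ₗ[ℚ] A ⊗[ℚ] C) : TensorAlg A C →ₗ[ℚ] TensorAlg A C :=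
  toTensorAlg A C ∘ₗ f ∘ₗ (GradedTensorProduct.of ℚ (Gr A) (Gr C)).symm.toLinearMap

/-- The differential of the tensor product. -/
def tensorDiff : A ⊗[ℚ] C →ₗ[ℚ] A ⊗[ℚ] C :=
  TensorProduct.map (Dd A) LinearMap.id + TensorProduct.map (eps A).toLinearMap (Dd C)

/-- The homogeneous components of the tensor product. -/
def tensorGr (n : ℕ) : Submodule ℚ (TensorAlg A C) :=
  Submodule.span ℚ {x | ∃ i j a c, i + j = n ∧ a ∈ Gr A i ∧ c ∈ Gr C j ∧
    x = toTensorAlg A C (a ⊗ₜ c)}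

/-- The projections of the tensor product onto its homogeneous components. -/
def tensorPr (n : ℕ) : A ⊗[ℚ] C →ₗ[ℚ] A ⊗[ℚ] C :=
  ∑ x ∈ Finset.HasAntidiagonal.antidiagonal n, TensorProduct.map (pr A x.1) (pr C x.2)

variable {A C}

@[simp] theorem tensorEnd_apply (f : A ⊗[ℚ] C →ₗ[ℚ] A ⊗[ℚ] C) (x : A ⊗[ℚ] C) :
    tensorEnd A C f (toTensorAlg A C x) = toTensorAlg A C (f x) := rfl

@[elab_as_elim]
theorem tensorAlg_induction {P : TensorAlg A C → Prop} (x : TensorAlg A C) (h0 : P 0)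
    (hadd : ∀ x y, P x → P y → P (x + y))
    (hom : ∀ i j, ∀ a ∈ Gr A i, ∀ c ∈ Gr C j, P (toTensorAlg A C (a ⊗ₜ c))) : P x := by
  change A ⊗[ℚ] C at x
  change P (toTensorAlg A C x)
  induction x using TensorProduct.induction_on with
  | zero => exact h0
  | add x y hx hy => rw [map_add]; exact hadd _ _ hx hy
  | tmul a c =>
    induction a using Gr_induction with
    | h0 => rw [TensorProduct.zero_tmul]; exact h0
    | hadd a b ha hb => rw [TensorProduct.add_tmul, map_add]; exact hadd _ _ ha hb
    | hom i a ha =>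
      induction c using Gr_induction with
      | h0 => rw [TensorProduct.tmul_zero]; exact h0
      | hadd a b ha hb => rw [TensorProduct.tmul_add, map_add]; exact hadd _ _ ha hb
      | hom j c hc => exact hom i j a ha c hc

theorem tensor_mul {j i' : ℕ} (a : A) {c : C} (hc : c ∈ Gr C j) {a' : A} (ha' : a' ∈ Gr A i')
    (c' : C) : toTensorAlg A C (a ⊗ₜ c) * toTensorAlg A C (a' ⊗ₜ c') =
      ((-1 : ℚ) ^ (j * i')) • toTensorAlg A C ((a * a') ⊗ₜ (c * c')) := by
  have h := GradedTensorProduct.tmul_coe_mul_coe_tmul (R := ℚ) (Gr A) (Gr C) a ⟨c, hc⟩ ⟨a', ha'⟩ c'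
  refine h.trans ?_
  rw [Units.smul_def, ← Int.cast_smul_eq_zsmul ℚ]
  congr 1
  simp

theorem tensorPr_tmul (n : ℕ) {i j : ℕ} {a : A} {c : C} (ha : a ∈ Gr A i) (hc : c ∈ Gr C j) :
    tensorPr A C n (a ⊗ₜ c) = if i + j = n then a ⊗ₜ c else 0 := by
  rw [tensorPr, LinearMap.sum_apply]
  simp only [TensorProduct.map_tmul]
  split_ifs with h
  · rw [Finset.sum_eq_single (i, j)]
    · rw [pr_of_mem ha, pr_of_mem hc]
    · rintro ⟨k, l⟩ - hne
      by_cases hk : i = k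
      · rw [pr_of_mem_ne hc (n := l) (by rintro rfl; exact hne (by rw [hk])), TensorProduct.tmul_zero]
      · rw [pr_of_mem_ne ha hk, TensorProduct.zero_tmul]
    · intro h'; exact absurd (Finset.HasAntidiagonal.mem_antidiagonal.2 h) h'
  · refine Finset.sum_eq_zero ?_
    rintro ⟨k, l⟩ hkl
    rw [Finset.HasAntidiagonal.mem_antidiagonal] at hkl
    by_cases hk : i = k
    · rw [pr_of_mem_ne hc (n := l) (by simp only at hkl; omega), TensorProduct.tmul_zero]
    · rw [pr_of_mem_ne ha hk, TensorProduct.zero_tmul]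

theorem tmul_mem_tensorGr {i j : ℕ} {a : A} {c : C} (ha : a ∈ Gr A i) (hc : c ∈ Gr C j) :
    toTensorAlg A C (a ⊗ₜ c) ∈ tensorGr A C (i + j) :=
  Submodule.subset_span ⟨i, j, a, c, rfl, ha, hc, rfl⟩

@[elab_as_elim]
theorem tensorGr_induction {n : ℕ} {P : TensorAlg A C → Prop} {x : TensorAlg A C}
    (hx : x ∈ tensorGr A C n) (h0 : P 0) (hadd : ∀ x y, P x → P y → P (x + y))
    (hsmul : ∀ (r : ℚ) x, P x → P (r • x))
    (hom : ∀ i j, i + j = n → ∀ a ∈ Gr A i, ∀ c ∈ Gr C j, P (toTensorAlg A C (a ⊗ₜ c))) : P x := by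
  induction hx using Submodule.span_induction with
  | zero => exact h0
  | add x y _ _ hx hy => exact hadd _ _ hx hy
  | smul r x _ hx => exact hsmul r x hx
  | mem x hx =>
    obtain ⟨i, j, a, c, hij, ha, hc, rfl⟩ := hx
    exact hom i j hij a ha c hc

theorem tensorDiff_tmul {i : ℕ} {a : A} (ha : a ∈ Gr A i) (c : C) :
    tensorDiff A C (a ⊗ₜ c) = Dd A a ⊗ₜ c + ((-1 : ℚ) ^ i) • (a ⊗ₜ Dd C c) := by
  simp [tensorDiff, eps_of_mem ha, TensorProduct.smul_tmul']

theorem tensorPr_of_mem_ne {m n : ℕ} {x : TensorAlg A C} (hmn : m ≠ n) (hx : x ∈ tensorGr A C m) :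
    tensorEnd A C (tensorPr A C n) x = 0 := by
  refine tensorGr_induction hx (map_zero _) (fun x y hx hy => by rw [map_add, hx, hy, add_zero])
    (fun r x hx => by rw [map_smul, hx, smul_zero]) fun i j hij a ha c hc => ?_
  rw [tensorEnd_apply, tensorPr_tmul n ha hc, if_neg (by omega), map_zero]

theorem tensorPr_of_mem {n : ℕ} {x : TensorAlg A C} (hx : x ∈ tensorGr A C n) :
    tensorEnd A C (tensorPr A C n) x = x := by
  refine tensorGr_induction hx (map_zero _) (fun x y hx hy => by rw [map_add, hx, hy])
    (fun r x hx => by rw [map_smul, hx]) fun i j hij a ha c hc => ?_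
  rw [tensorEnd_apply, tensorPr_tmul n ha hc, if_pos hij]

theorem mul_mem_tensorGr {m n : ℕ} {x y : TensorAlg A C} (hx : x ∈ tensorGr A C m)
    (hy : y ∈ tensorGr A C n) : x * y ∈ tensorGr A C (m + n) := by
  refine tensorGr_induction hx ?_ (fun x x' h h' => ?_) (fun r x h => ?_) fun i j hij a ha c hc => ?_
  · rw [zero_mul]; exact Submodule.zero_mem _
  · rw [add_mul]; exact Submodule.add_mem _ h h'
  · rw [smul_mul_assoc]; exact Submodule.smul_mem _ _ h
  refine tensorGr_induction hy ?_ (fun x x' h h' => ?_) (fun r x h => ?_)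
    fun i' j' hij' a' ha' c' hc' => ?_
  · rw [mul_zero]; exact Submodule.zero_mem _
  · rw [mul_add]; exact Submodule.add_mem _ h h'
  · rw [mul_smul_comm]; exact Submodule.smul_mem _ _ h
  rw [tensor_mul a hc ha' c', show m + n = (i + i') + (j + j') by omega]
  exact Submodule.smul_mem _ _ (tmul_mem_tensorGr (mul_mem_Gr ha ha') (mul_mem_Gr hc hc'))

theorem tensorGr_comm {m n : ℕ} {x y : TensorAlg A C} (hx : x ∈ tensorGr A C m)
    (hy : y ∈ tensorGr A C n) : x * y = ((-1 : ℚ) ^ (m * n)) • (y * x) := by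
  refine tensorGr_induction hx ?_ (fun x x' h h' => ?_) (fun r x h => ?_) fun i j hij a ha c hc => ?_
  · rw [zero_mul, mul_zero, smul_zero]
  · rw [add_mul, mul_add, smul_add, h, h']
  · rw [smul_mul_assoc, mul_smul_comm, h, smul_comm]
  refine tensorGr_induction hy ?_ (fun x x' h h' => ?_) (fun r x h => ?_)
    fun i' j' hij' a' ha' c' hc' => ?_
  · rw [zero_mul, mul_zero, smul_zero]
  · rw [add_mul, mul_add, smul_add, h, h']
  · rw [smul_mul_assoc, mul_smul_comm, h, smul_comm]
  have e1 : (a * a') ⊗ₜ[ℚ] (c * c') =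
      ((-1 : ℚ) ^ (i * i' + j * j')) • ((a' * a) ⊗ₜ[ℚ] (c' * c)) := by
    rw [Gr_comm ha ha', Gr_comm hc hc', TensorProduct.smul_tmul_smul, pow_add]
  rw [tensor_mul a hc ha' c', tensor_mul a' hc' ha c, e1, map_smul, smul_smul, smul_smul,
    ← pow_add, ← pow_add]
  congr 1
  subst hij hij'
  rw [show (i + j) * (i' + j') + j' * i = j * i' + (i * i' + j * j') + 2 * (i * j') by ring,
    pow_add _ _ (2 * (i * j')), pow_mul]
  simp

theorem tensorDiff_tensorDiff (x : TensorAlg A C) :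
    tensorEnd A C (tensorDiff A C) (tensorEnd A C (tensorDiff A C) x) = 0 := by
  refine tensorAlg_induction x ?_ (fun x y hx hy => ?_) fun i j a ha c hc => ?_
  · rw [map_zero, map_zero]
  · rw [map_add, map_add, hx, hy, add_zero]
  rw [tensorEnd_apply, tensorEnd_apply, tensorDiff_tmul ha, map_add, map_smul,
    tensorDiff_tmul (Dd_mem ha), tensorDiff_tmul ha, Dd_Dd, Dd_Dd, TensorProduct.tmul_zero,
    TensorProduct.zero_tmul, smul_zero, zero_add, add_zero, pow_succ, mul_neg_one, neg_smul,
    neg_add_cancel, map_zero]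

theorem tensorDiff_mem {n : ℕ} {x : TensorAlg A C} (hx : x ∈ tensorGr A C n) :
    tensorEnd A C (tensorDiff A C) x ∈ tensorGr A C (n + 1) := by
  refine tensorGr_induction hx ?_ (fun x x' h h' => ?_) (fun r x h => ?_) fun i j hij a ha c hc => ?_
  · rw [map_zero]; exact Submodule.zero_mem _
  · rw [map_add]; exact Submodule.add_mem _ h h'
  · rw [map_smul]; exact Submodule.smul_mem _ _ h
  subst hij
  rw [tensorEnd_apply, tensorDiff_tmul ha, map_add, map_smul]
  refine Submodule.add_mem _ ?_ (Submodule.smul_mem _ _ ?_)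
  · rw [show i + j + 1 = i + 1 + j by ring]
    exact tmul_mem_tensorGr (Dd_mem ha) hc
  · rw [add_assoc]
    exact tmul_mem_tensorGr ha (Dd_mem hc)

theorem tensorDiff_mul {m : ℕ} {x : TensorAlg A C} (y : TensorAlg A C)
    (hx : x ∈ tensorGr A C m) :
    tensorEnd A C (tensorDiff A C) (x * y) = tensorEnd A C (tensorDiff A C) x * y +
      ((-1 : ℚ) ^ m) • (x * tensorEnd A C (tensorDiff A C) y) := by
  refine tensorGr_induction hx ?_ (fun x x' h h' => ?_) (fun r x h => ?_) fun i j hij a ha c hc => ?_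
  · simp only [zero_mul, map_zero, smul_zero, add_zero]
  · rw [add_mul, map_add, h, h', map_add, add_mul, add_mul, smul_add]; abel
  · rw [smul_mul_assoc, map_smul, h, map_smul, smul_mul_assoc, smul_mul_assoc, smul_add,
      smul_comm r]
  refine tensorAlg_induction y ?_ (fun x x' h h' => ?_) fun i' j' a' ha' c' hc' => ?_
  · simp only [mul_zero, map_zero, smul_zero, add_zero]
  · rw [mul_add, map_add, h, h', map_add, mul_add, mul_add, smul_add]; abel
  subst hij
  rw [tensor_mul a hc ha' c', map_smul, tensorEnd_apply, tensorEnd_apply, tensorEnd_apply,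
    tensorDiff_tmul ha, tensorDiff_tmul ha', tensorDiff_tmul (mul_mem_Gr ha ha'), map_add, map_add,
    map_add, add_mul, mul_add, map_smul, map_smul, map_smul, smul_mul_assoc, mul_smul_comm,
    tensor_mul (Dd A a) hc ha' c', tensor_mul a (Dd_mem hc) ha' c',
    tensor_mul a hc (Dd_mem ha') c', tensor_mul a hc ha' (Dd C c'), Dd_mul, Dd_mul,
    eps_of_mem ha, eps_of_mem hc, TensorProduct.add_tmul, TensorProduct.tmul_add,
    smul_mul_assoc, smul_mul_assoc, TensorProduct.tmul_smul,
    ← TensorProduct.smul_tmul', map_add, map_add, map_smul, map_smul]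
  generalize toTensorAlg A C _ = x1
  generalize toTensorAlg A C _ = x2
  generalize toTensorAlg A C _ = x3
  generalize toTensorAlg A C _ = x4
  have hj : ((-1 : ℚ) ^ j) * (-1) ^ j = 1 := by rw [← mul_pow]; simp
  simp only [pow_add, add_mul, mul_add, mul_one, one_mul]
  generalize (-1 : ℚ) ^ j = u at *
  generalize (-1 : ℚ) ^ (j * i') = v at *
  match_scalars <;> first | ring1 | linear_combination (-v * (-1) ^ i) * hj

theorem toTensorAlg_one : toTensorAlg A C (1 ⊗ₜ 1) = 1 := rfl

theorem one_mem_tensorGr : (1 : TensorAlg A C) ∈ tensorGr A C 0 := by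
  rw [← toTensorAlg_one, ← add_zero 0]
  exact tmul_mem_tensorGr one_mem_Gr one_mem_Gr

theorem mem_iSup_tensorGr (x : TensorAlg A C) : x ∈ ⨆ n, tensorGr A C n := by
  refine tensorAlg_induction x ?_ (fun x y hx hy => ?_) fun i j a ha c hc => ?_
  · exact Submodule.zero_mem _
  · exact Submodule.add_mem _ hx hy
  · exact Submodule.mem_iSup_of_mem (i + j) (tmul_mem_tensorGr ha hc)

variable (A C) in
/-- The tensor product of two gcdga's. -/
@[reducible] def tensorGCDGA : GCDGA (TensorAlg A C) :=
  mkGCDGA (N := TensorAlg A C) (tensorGr A C) (fun n => tensorEnd A C (tensorPr A C n))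
    (fun _ _ _ hmn hx => tensorPr_of_mem_ne hmn hx)
    (fun _ _ hx h => by rw [← tensorPr_of_mem hx]; exact h)
    mem_iSup_tensorGr one_mem_tensorGr
    (fun _ _ _ _ hx hy => mul_mem_tensorGr hx hy)
    (fun _ _ _ _ hx hy => tensorGr_comm hx hy)
    (tensorEnd A C (tensorDiff A C)) tensorDiff_tensorDiff
    (fun _ _ hx => tensorDiff_mem hx)
    (fun _ _ y hx => tensorDiff_mul y hx)

end TensorAux

section IsTensor

variable {A C T : Type} [GCDGA A] [GCDGA C] [GCDGA T]

/-- The linear map `a ⊗ c ↦ i a * k c`. -/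
def tensorMap (i : A →ₐ[ℚ] T) (k : C →ₐ[ℚ] T) : A ⊗[ℚ] C →ₗ[ℚ] T :=
  TensorProduct.lift ((LinearMap.mul ℚ T).compl₁₂ i.toLinearMap k.toLinearMap)

@[simp] theorem tensorMap_tmul (i : A →ₐ[ℚ] T) (k : C →ₐ[ℚ] T) (a : A) (c : C) :
    tensorMap i k (a ⊗ₜ c) = i a * k c := rfl

/-- `T` is the graded tensor product of `A` and `C`. -/
structure IsTensor (i : A →ₐ[ℚ] T) (k : C →ₐ[ℚ] T) : Prop where
  left_dga : IsDGAHom i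
  right_dga : IsDGAHom k
  bij : Function.Bijective (tensorMap i k)
  lift : ∀ (W : Type) [GCDGA W] (f : A →ₐ[ℚ] W) (g : C →ₐ[ℚ] W), IsDGAHom f → IsDGAHom g →
    ∃ h : T →ₐ[ℚ] W, IsDGAHom h ∧ (∀ a, h (i a) = f a) ∧ ∀ c, h (k c) = g c

theorem anticommute {W : Type} [GCDGA W] {f : A →ₐ[ℚ] W} {g : C →ₐ[ℚ] W} (hf : IsDGAHom f)
    (hg : IsDGAHom g) ⦃i j : ℕ⦄ (a : Gr A i) (b : Gr C j) :
    f a * g b = (-1 : ℤˣ) ^ (j * i) • (g b * f a) := by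
  rw [Gr_comm (hf.2 i a a.2) (hg.2 j b b.2), Units.smul_def, ← Int.cast_smul_eq_zsmul ℚ]
  congr 1
  simp [mul_comm]

theorem tensorDiff_lift {W : Type} [GCDGA W] {f : A →ₐ[ℚ] W} {g : C →ₐ[ℚ] W} (hf : IsDGAHom f)
    (hg : IsDGAHom g) (x : TensorAlg A C) :
    GradedTensorProduct.lift (Gr A) (Gr C) f g (anticommute hf hg)
      (tensorEnd A C (tensorDiff A C) x) =
    Dd W (GradedTensorProduct.lift (Gr A) (Gr C) f g (anticommute hf hg) x) := by
  set h := GradedTensorProduct.lift (Gr A) (Gr C) f g (anticommute hf hg)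
  have key : ∀ a c, h (toTensorAlg A C (a ⊗ₜ c)) = f a * g c := fun a c => rfl
  refine tensorAlg_induction x ?_ (fun x y hx hy => ?_) fun i j a ha c hc => ?_
  · rw [map_zero, map_zero, map_zero]
  · rw [map_add, map_add, hx, hy, map_add, map_add]
  · rw [tensorEnd_apply, tensorDiff_tmul ha, map_add, map_add, map_smul, map_smul, key, key, key,
      hf.1, hg.1, Dd_mul, eps_of_mem (hf.2 i a ha), smul_mul_assoc]

theorem lift_mem_Gr {W : Type} [GCDGA W] {f : A →ₐ[ℚ] W} {g : C →ₐ[ℚ] W} (hf : IsDGAHom f)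
    (hg : IsDGAHom g) {n : ℕ} {x : TensorAlg A C} (hx : x ∈ tensorGr A C n) :
    GradedTensorProduct.lift (Gr A) (Gr C) f g (anticommute hf hg) x ∈ Gr W n := by
  refine tensorGr_induction hx ?_ (fun x y hx hy => ?_) (fun r x hx => ?_)
    fun i j hij a ha c hc => ?_
  · rw [map_zero]; exact Submodule.zero_mem _
  · rw [map_add]; exact Submodule.add_mem _ hx hy
  · rw [map_smul]; exact Submodule.smul_mem _ _ hx
  · subst hij
    exact mul_mem_Gr (hf.2 i a ha) (hg.2 j c hc)

theorem exists_tensor (A C : Type) [GCDGA A] [GCDGA C] :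
    ∃ (T : Type) (_ : GCDGA T) (i : A →ₐ[ℚ] T) (k : C →ₐ[ℚ] T), IsTensor i k := by
  refine ⟨TensorAlg A C, tensorGCDGA A C, GradedTensorProduct.includeLeft (Gr A) (Gr C),
    GradedTensorProduct.includeRight (Gr A) (Gr C),
    @IsTensor.mk A C (TensorAlg A C) _ _ (tensorGCDGA A C) _ _ ⟨fun a => ?_, fun n a ha => ?_⟩
      ⟨fun c => ?_, fun n c hc => ?_⟩ ?_ fun W _ f g hf hg => ?_⟩
  · change toTensorAlg A C (Dd A a ⊗ₜ 1) = toTensorAlg A C (tensorDiff A C (a ⊗ₜ 1))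
    simp [tensorDiff, Dd_one]
  · have h := tmul_mem_tensorGr ha (one_mem_Gr (A := C))
    rw [add_zero] at h
    exact h
  · change toTensorAlg A C (1 ⊗ₜ Dd C c) = toTensorAlg A C (tensorDiff A C (1 ⊗ₜ c))
    simp [tensorDiff, Dd_one]
  · have := tmul_mem_tensorGr (one_mem_Gr (A := A)) hc
    rw [zero_add] at this
    exact this
  · have : ∀ x, toTensorAlg A C x = @tensorMap A C (TensorAlg A C) _ _ (tensorGCDGA A C)
        (GradedTensorProduct.includeLeft (Gr A) (Gr C))
        (GradedTensorProduct.includeRight (Gr A) (Gr C)) x := fun x => by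
      induction x using TensorProduct.induction_on with
      | zero => rw [map_zero, map_zero]
      | add x y hx hy => rw [map_add, map_add, hx, hy]
      | tmul a c => exact (GradedTensorProduct.tmul_one_mul_one_tmul (Gr A) (Gr C) a c).symm
    rw [← funext this]
    exact (GradedTensorProduct.of ℚ (Gr A) (Gr C)).bijective
  · refine ⟨GradedTensorProduct.lift (Gr A) (Gr C) f g (anticommute hf hg),
      ⟨fun x => tensorDiff_lift hf hg x, fun n x hx => lift_mem_Gr hf hg hx⟩, fun a => ?_,
      fun c => ?_⟩
    · exact (GradedTensorProduct.lift_tmul (Gr A) (Gr C) f g (anticommute hf hg) a 1).trans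
        (by rw [map_one, mul_one])
    · exact (GradedTensorProduct.lift_tmul (Gr A) (Gr C) f g (anticommute hf hg) 1 c).trans
        (by rw [map_one, one_mul])

end IsTensor

section Contraction

variable {A B : Type} [GCDGA A] [GCDGA B]

/-- An acyclic kernel admits a contracting homotopy anticommuting with the degree involution. -/
theorem exists_contraction {ψ : A →ₐ[ℚ] B} (hψ : IsDGAHom ψ) (hk : KerAcyclic ψ) :
    ∃ h : A →ₗ[ℚ] A, (∀ a, ψ a = 0 → ψ (h a) = 0) ∧
      (∀ a, ψ a = 0 → Dd A (h a) + h (Dd A a) = a) ∧ ∀ a, h (eps A a) = -eps A (h a) := by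
  let K : Submodule ℚ A := LinearMap.ker ψ.toLinearMap
  have hK : ∀ a, a ∈ K ↔ ψ a = 0 := fun a => Iff.rfl
  let Z : Submodule ℚ A := K ⊓ LinearMap.ker (Dd A)
  have hdK : ∀ a, ψ a = 0 → ψ (Dd A a) = 0 := fun a ha => by rw [hψ.1, ha, map_zero]
  have hmem : ∀ x : K, (Dd A ∘ₗ K.subtype) x ∈ Z := fun x => ⟨hdK _ x.2, Dd_Dd _⟩
  obtain ⟨s, hs⟩ := ((Dd A ∘ₗ K.subtype).codRestrict Z hmem).exists_rightInverse_of_surjective (by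
    rw [LinearMap.range_eq_top]
    rintro ⟨z, hz1, hz2⟩
    obtain ⟨e, he, rfl⟩ := hk z hz2 hz1
    exact ⟨⟨e, he⟩, rfl⟩)
  obtain ⟨g, hg⟩ := (K.subtype ∘ₗ s).exists_extend
  have g1 : ∀ z (hz : z ∈ Z), g z = s ⟨z, hz⟩ := fun z hz => LinearMap.congr_fun hg ⟨z, hz⟩
  have gK : ∀ z ∈ Z, ψ (g z) = 0 := fun z hz => by rw [g1 z hz]; exact (s ⟨z, hz⟩).2
  have gd : ∀ z ∈ Z, Dd A (g z) = z := fun z hz => by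
    rw [g1 z hz]; exact congrArg Subtype.val (LinearMap.congr_fun hs ⟨z, hz⟩)
  have hZ : ∀ a, ψ a = 0 → Dd A a ∈ Z := fun a ha => ⟨hdK a ha, Dd_Dd _⟩
  have hZ' : ∀ a, ψ a = 0 → a - g (Dd A a) ∈ Z := fun a ha =>
    ⟨by change ψ _ = 0; rw [map_sub, ha, gK _ (hZ a ha), sub_zero],
      by change Dd A _ = 0; rw [map_sub, gd _ (hZ a ha), sub_self]⟩
  let h0 : A →ₗ[ℚ] A := g ∘ₗ (LinearMap.id - g ∘ₗ Dd A)
  have h0a : ∀ a, h0 a = g (a - g (Dd A a)) := fun a => rfl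
  have h0K : ∀ a, ψ a = 0 → ψ (h0 a) = 0 := fun a ha => gK _ (hZ' a ha)
  have h0d : ∀ a, ψ a = 0 → Dd A (h0 a) + h0 (Dd A a) = a := fun a ha => by
    rw [h0a, h0a, gd _ (hZ' a ha), Dd_Dd, map_zero, sub_zero, sub_add_cancel]
  have heK : ∀ a, ψ a = 0 → ψ (eps A a) = 0 := fun a ha => by
    rw [graded_eps hψ.2, ha, map_zero]
  let h : A →ₗ[ℚ] A := (1 / 2 : ℚ) • (h0 - (eps A).toLinearMap ∘ₗ h0 ∘ₗ (eps A).toLinearMap)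
  have hh : ∀ a, h a = (1 / 2 : ℚ) • (h0 a - eps A (h0 (eps A a))) := fun a => rfl
  refine ⟨h, fun a ha => ?_, fun a ha => ?_, fun a => ?_⟩
  · rw [hh, map_smul, map_sub, h0K a ha, heK _ (h0K _ (heK a ha)), sub_zero, smul_zero]
  · have e1 := h0d a ha
    have e2 := congrArg (eps A) (h0d _ (heK a ha))
    rw [eps_eps, map_add, Dd_eps, map_neg, map_neg] at e2
    rw [hh, hh, map_smul, map_sub, Dd_eps, ← smul_add]
    calc (1 / 2 : ℚ) • (Dd A (h0 a) - -eps A (Dd A (h0 (eps A a))) +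
          (h0 (Dd A a) - eps A (h0 (eps A (Dd A a)))))
        = (1 / 2 : ℚ) • ((Dd A (h0 a) + h0 (Dd A a)) +
          (eps A (Dd A (h0 (eps A a))) + -eps A (h0 (eps A (Dd A a))))) := by
          congr 1; abel
      _ = a := by rw [e1, e2, ← two_smul ℚ a, smul_smul]; norm_num
  · rw [hh, hh, map_smul, map_sub, eps_eps, eps_eps, ← smul_neg, neg_sub]

theorem kerAcyclic_of_span {φ : A →ₐ[ℚ] B} (s : Set A) (hs : ∀ a, φ a = 0 → a ∈ Submodule.span ℚ s)
    (H : A →ₗ[ℚ] A) (hH : ∀ a ∈ s, φ (H a) = 0) (hd : ∀ a ∈ s, Dd A (H a) + H (Dd A a) = a) :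
    KerAcyclic φ := by
  intro a hda ha
  have h1 : Submodule.span ℚ s ≤ LinearMap.ker (φ.toLinearMap ∘ₗ H) :=
    Submodule.span_le.2 fun a ha => hH a ha
  have h2 : Submodule.span ℚ s ≤ LinearMap.ker (Dd A ∘ₗ H + H ∘ₗ Dd A - LinearMap.id) :=
    Submodule.span_le.2 fun a ha => sub_eq_zero.2 (hd a ha)
  refine ⟨H a, h1 (hs a ha), ?_⟩
  have h3 : Dd A (H a) + H (Dd A a) = a := sub_eq_zero.1 (h2 (hs a ha))
  rw [hda, map_zero, add_zero] at h3
  exact h3.symm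

theorem KerAcyclic.comp {C : Type} [GCDGA C] {g : B →ₐ[ℚ] C} {f : A →ₐ[ℚ] B} (hf : IsDGAHom f)
    (hfs : Function.Surjective f) (hfk : KerAcyclic f) (hgk : KerAcyclic g) :
    KerAcyclic (g.comp f) := by
  intro a hda ha
  obtain ⟨b, hb, hab⟩ := hgk (f a) (by rw [← hf.1, hda, map_zero]) ha
  obtain ⟨a', rfl⟩ := hfs b
  obtain ⟨e, he, hea⟩ := hfk (a - Dd A a') (by rw [map_sub, hda, Dd_Dd, sub_zero])
    (by rw [map_sub, hf.1, ← hab, sub_self])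
  refine ⟨a' + e, ?_, ?_⟩
  · simp only [AlgHom.comp_apply] at hb ⊢
    rw [map_add, map_add, hb, he, map_zero, add_zero]
  · rw [map_add, ← hea, add_sub_cancel]

end Contraction

theorem tmul_ne_zero {M N : Type} [AddCommGroup M] [Module ℚ M] [AddCommGroup N] [Module ℚ N]
    {m : M} {n : N} (hm : m ≠ 0) (hn : n ≠ 0) : m ⊗ₜ[ℚ] n ≠ 0 := by
  intro h
  have h1 := mt (Module.forall_dual_apply_eq_zero_iff ℚ m).1 hm
  have h2 := mt (Module.forall_dual_apply_eq_zero_iff ℚ n).1 hn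
  push Not at h1 h2
  obtain ⟨f, hf⟩ := h1
  obtain ⟨g, hg⟩ := h2
  have := congrArg (TensorProduct.lift ((LinearMap.mul ℚ ℚ).compl₁₂ f g)) h
  rw [map_zero] at this
  exact mul_ne_zero hf hg this

section Tensor

variable {A C T A' C' T' : Type} [GCDGA A] [GCDGA C] [GCDGA T] [GCDGA A'] [GCDGA C'] [GCDGA T']
  {i : A →ₐ[ℚ] T} {k : C →ₐ[ℚ] T} {i' : A' →ₐ[ℚ] T'} {k' : C' →ₐ[ℚ] T'}

theorem IsTensor.induction (h : IsTensor i k) {P : T → Prop} (t : T) (h0 : P 0)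
    (hadd : ∀ x y, P x → P y → P (x + y)) (hmul : ∀ a c, P (i a * k c)) : P t := by
  obtain ⟨x, rfl⟩ := h.bij.2 t
  induction x using TensorProduct.induction_on with
  | zero => rw [map_zero]; exact h0
  | add x y hx hy => rw [map_add]; exact hadd _ _ hx hy
  | tmul a c => exact hmul a c

theorem IsTensor.eq_top (h : IsTensor i k) (S : Subalgebra ℚ T) (hi : ∀ a, i a ∈ S)
    (hk : ∀ c, k c ∈ S) : S = ⊤ :=
  top_unique fun t _ => h.induction t S.zero_mem (fun _ _ => S.add_mem)
    fun a c => S.mul_mem (hi a) (hk c)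

theorem IsTensor.mul_ne_zero (h : IsTensor i k) {a : A} {c : C} (ha : a ≠ 0) (hc : c ≠ 0) :
    i a * k c ≠ 0 := fun h0 =>
  tmul_ne_zero ha hc (h.bij.1 (by rw [tensorMap_tmul, h0, map_zero]))

theorem IsTensor.Dd_mul (h : IsTensor i k) (a : A) (c : C) :
    Dd T (i a * k c) = i (Dd A a) * k c + i (eps A a) * k (Dd C c) := by
  rw [RHT.Dd_mul, h.left_dga.1, h.right_dga.1, graded_eps h.left_dga.2]

theorem IsTensor.Dd_eq_zero (h : IsTensor i k) (hA : Dd A = 0) (hC : Dd C = 0) : Dd T = 0 := by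
  ext t
  refine h.induction (P := fun t => Dd T t = 0) t (map_zero _) (fun x y hx hy => ?_) fun a c => ?_
  · rw [map_add, hx, hy, add_zero]
  · rw [h.Dd_mul, hA, hC]; simp

/-- Linear maps on a tensor product are given by bilinear maps. -/
theorem IsTensor.exists_map (h : IsTensor i k) (f : A →ₗ[ℚ] A) (g : C →ₗ[ℚ] C) :
    ∃ H : T →ₗ[ℚ] T, ∀ a c, H (i a * k c) = i (f a) * k (g c) := by
  let E := LinearEquiv.ofBijective (tensorMap i k) h.bij
  refine ⟨E.toLinearMap ∘ₗ TensorProduct.map f g ∘ₗ E.symm.toLinearMap, fun a c => ?_⟩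
  have : E.symm (i a * k c) = a ⊗ₜ c := E.symm_apply_eq.2 rfl
  simp only [LinearMap.comp_apply, LinearEquiv.coe_coe, this]
  rfl

theorem IsTensor.kerAcyclic_left {k' : C →ₐ[ℚ] T'} (h : IsTensor i k) (h' : IsTensor i' k')
    {ψ : A →ₐ[ℚ] A'} (hψ : IsDGAHom ψ) (hs : Function.Surjective ψ) (hk : KerAcyclic ψ)
    {φ : T →ₐ[ℚ] T'} (hi : ∀ a, φ (i a) = i' (ψ a)) (hc : ∀ c, φ (k c) = k' c) :
    KerAcyclic φ := by
  obtain ⟨η, η1, η2, η3⟩ := exists_contraction hψ hk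
  obtain ⟨H, hH⟩ := h.exists_map η LinearMap.id
  refine kerAcyclic_of_span {t | ∃ a c, ψ a = 0 ∧ t = i a * k c} (fun t ht => ?_) H ?_ ?_
  · obtain ⟨x, rfl⟩ := h.bij.2 t
    have e : φ.toLinearMap ∘ₗ tensorMap i k =
        tensorMap i' k' ∘ₗ LinearMap.rTensor C ψ.toLinearMap := by
      ext a c
      simp [hi, hc]
    have hx : LinearMap.rTensor C ψ.toLinearMap x = 0 :=
      h'.bij.1 ((LinearMap.congr_fun e x).symm.trans (ht.trans (map_zero _).symm))
    obtain ⟨y, rfl⟩ := (rTensor_exact C (f := (LinearMap.ker ψ.toLinearMap).subtype)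
      (g := ψ.toLinearMap) (LinearMap.exact_subtype_ker_map _) hs x).1 hx
    clear hx ht
    induction y using TensorProduct.induction_on with
    | zero => simp
    | add x y hx hy => rw [map_add, map_add]; exact Submodule.add_mem _ hx hy
    | tmul a c => exact Submodule.subset_span ⟨a, c, a.2, rfl⟩
  · rintro _ ⟨a, c, ha, rfl⟩
    rw [hH, map_mul, hi, η1 a ha, map_zero, zero_mul]
  · rintro _ ⟨a, c, ha, rfl⟩
    rw [hH, h.Dd_mul, h.Dd_mul, map_add, hH, hH, η3, map_neg, neg_mul]
    simp only [LinearMap.id_apply]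
    conv_rhs => rw [← η2 a ha, map_add, add_mul]
    abel

theorem IsTensor.kerAcyclic_right {i' : A →ₐ[ℚ] T'} (h : IsTensor i k) (h' : IsTensor i' k')
    {χ : C →ₐ[ℚ] C'} (hχ : IsDGAHom χ) (hs : Function.Surjective χ) (hk : KerAcyclic χ)
    {φ : T →ₐ[ℚ] T'} (hi : ∀ a, φ (i a) = i' a) (hc : ∀ c, φ (k c) = k' (χ c)) :
    KerAcyclic φ := by
  obtain ⟨η, η1, η2, -⟩ := exists_contraction hχ hk
  obtain ⟨H, hH⟩ := h.exists_map (eps A).toLinearMap η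
  refine kerAcyclic_of_span {t | ∃ a c, χ c = 0 ∧ t = i a * k c} (fun t ht => ?_) H ?_ ?_
  · obtain ⟨x, rfl⟩ := h.bij.2 t
    have e : φ.toLinearMap ∘ₗ tensorMap i k =
        tensorMap i' k' ∘ₗ LinearMap.lTensor A χ.toLinearMap := by
      ext a c
      simp [hi, hc]
    have hx : LinearMap.lTensor A χ.toLinearMap x = 0 :=
      h'.bij.1 ((LinearMap.congr_fun e x).symm.trans (ht.trans (map_zero _).symm))
    obtain ⟨y, rfl⟩ := (lTensor_exact A (f := (LinearMap.ker χ.toLinearMap).subtype)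
      (g := χ.toLinearMap) (LinearMap.exact_subtype_ker_map _) hs x).1 hx
    clear hx ht
    induction y using TensorProduct.induction_on with
    | zero => simp
    | add x y hx hy => rw [map_add, map_add]; exact Submodule.add_mem _ hx hy
    | tmul a c => exact Submodule.subset_span ⟨a, c, c.2, rfl⟩
  · rintro _ ⟨a, c, hc', rfl⟩
    rw [hH, map_mul, hc, η1 c hc', map_zero, mul_zero]
  · rintro _ ⟨a, c, hc', rfl⟩
    rw [hH, h.Dd_mul, h.Dd_mul, map_add, hH, hH]
    simp only [AlgHom.toLinearMap_apply, eps_eps, Dd_eps, map_neg, neg_mul]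
    conv_rhs => rw [← η2 c hc', map_add, mul_add]
    abel

end Tensor

section TensorPower

variable {A B : Type} [GCDGA A] [GCDGA B]

/-- Tensor powers of gcdga's exist, together with the tensor power of a morphism with acyclic
kernel onto a gcdga with zero differential. -/
theorem exists_tensorPower {ψ : A →ₐ[ℚ] B} (hψ : IsDGAHom ψ) (hs : Function.Surjective ψ)
    (hk : KerAcyclic ψ) (hB : Dd B = 0) (r : ℕ) :
    ∃ (T : Type) (_ : GCDGA T) (TP : TensorPower A (r + 1) T) (H : Type) (_ : GCDGA H)
      (ι' : Fin (r + 1) → (B →ₐ[ℚ] H)) (p : T →ₐ[ℚ] H), Dd H = 0 ∧ (∀ j, IsDGAHom (ι' j)) ∧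
      IsDGAHom p ∧ Function.Surjective p ∧ KerAcyclic p ∧ (∀ j a, p (TP.ι j a) = ι' j (ψ a)) ∧
      (∀ S : Subalgebra ℚ T, (∀ j a, TP.ι j a ∈ S) → S = ⊤) ∧
      ∀ b, b ≠ 0 → (List.ofFn fun j => ι' j b).prod ≠ 0 := by
  induction r with
  | zero =>
    refine ⟨A, inferInstance, ⟨fun _ => AlgHom.id ℚ A, fun _ => isDGAHom_id A,
      fun W _ f hf => ⟨f 0, ⟨hf 0, fun j => ?_⟩, fun g hg => hg.2 0⟩⟩, B, inferInstance,
      fun _ => AlgHom.id ℚ B, ψ, hB, fun _ => isDGAHom_id B, hψ, hs, hk, fun _ _ => rfl,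
      fun S h => ?_, fun b hb => ?_⟩
    · rw [Fin.fin_one_eq_zero j]; rfl
    · exact top_unique fun a _ => h 0 a
    · simpa using hb
  | succ r ih =>
    obtain ⟨T, _, TP, H, _, ι', p, hH, hι', hp, hps, hpk, hpι, htop, hne⟩ := ih
    obtain ⟨T₁, _, i, k, h⟩ := exists_tensor A T
    obtain ⟨T₂, _, i₂, k₂, h₂⟩ := exists_tensor B T
    obtain ⟨T₃, _, i₃, k₃, h₃⟩ := exists_tensor B H
    obtain ⟨q, hq, hqi, hqk⟩ := h.lift T₂ (i₂.comp ψ) k₂ (h₂.left_dga.comp hψ) h₂.right_dga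
    obtain ⟨q', hq', hqi', hqk'⟩ := h₂.lift T₃ i₃ (k₃.comp p) h₃.left_dga (h₃.right_dga.comp hp)
    have hqs : Function.Surjective q := fun t =>
      h₂.induction (P := fun t => ∃ a, q a = t) t ⟨0, map_zero _⟩
        (fun x y ⟨a, ha⟩ ⟨b, hb⟩ => ⟨a + b, by rw [map_add, ha, hb]⟩) fun b c => by
          obtain ⟨a, rfl⟩ := hs b
          exact ⟨i a * k c, by rw [map_mul, hqi, hqk]; rfl⟩
    have hqs' : Function.Surjective q' := fun t =>
      h₃.induction (P := fun t => ∃ a, q' a = t) t ⟨0, map_zero _⟩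
        (fun x y ⟨a, ha⟩ ⟨b, hb⟩ => ⟨a + b, by rw [map_add, ha, hb]⟩) fun b c => by
          obtain ⟨a, rfl⟩ := hps c
          exact ⟨i₂ b * k₂ a, by rw [map_mul, hqi', hqk']; rfl⟩
    have hgen : ∀ S : Subalgebra ℚ T₁, (∀ a, i a ∈ S) → (∀ j a, k (TP.ι j a) ∈ S) → S = ⊤ :=
      fun S h1 h2 => h.eq_top S h1 fun c => by
        have : S.comap k = ⊤ := htop _ h2
        have hc : c ∈ S.comap k := this.symm ▸ Algebra.mem_top
        exact hc
    have hcoprod : ∀ (W : Type) [GCDGA W] (f : Fin (r + 1 + 1) → (A →ₐ[ℚ] W)),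
        (∀ j, IsDGAHom (f j)) → ∃! g : T₁ →ₐ[ℚ] W, IsDGAHom g ∧
          ∀ j, g.comp (Fin.cases (motive := fun _ => A →ₐ[ℚ] T₁) i (fun j => k.comp (TP.ι j)) j) =
            f j := fun W _ f hf => by
      obtain ⟨g, ⟨hg, hgι⟩, -⟩ := TP.coprod W (fun j => f j.succ) fun j => hf j.succ
      obtain ⟨g', hg', hgi, hgk⟩ := h.lift W (f 0) g (hf 0) hg
      have hcomp : ∀ j, g'.comp (Fin.cases (motive := fun _ => A →ₐ[ℚ] T₁) i
          (fun j => k.comp (TP.ι j)) j) = f j := by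
        refine Fin.cases (AlgHom.ext hgi) fun j => AlgHom.ext fun a => ?_
        exact (hgk _).trans (AlgHom.congr_fun (hgι j) a)
      refine ⟨g', ⟨hg', hcomp⟩, fun g₂ hg₂ => ?_⟩
      have heq : ∀ j a, g₂ (Fin.cases (motive := fun _ => A →ₐ[ℚ] T₁) i
          (fun j => k.comp (TP.ι j)) j a) = g' (Fin.cases (motive := fun _ => A →ₐ[ℚ] T₁) i
          (fun j => k.comp (TP.ι j)) j a) := fun j a =>
        AlgHom.congr_fun ((hg₂.2 j).trans (hcomp j).symm) a
      have := hgen (AlgHom.equalizer g₂ g') (fun a => heq 0 a) fun j a => heq j.succ a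
      exact AlgHom.ext fun x => by
        have hx : x ∈ AlgHom.equalizer g₂ g' := this.symm ▸ Algebra.mem_top
        exact hx
    refine ⟨T₁, inferInstance, ⟨fun j => Fin.cases i (fun j => k.comp (TP.ι j)) j,
      Fin.cases h.left_dga fun j => h.right_dga.comp (TP.ι_dga j), hcoprod⟩, T₃, inferInstance,
      fun j => Fin.cases i₃ (fun j => k₃.comp (ι' j)) j, q'.comp q, h₃.Dd_eq_zero hB hH,
      Fin.cases h₃.left_dga fun j => h₃.right_dga.comp (hι' j), hq'.comp hq, hqs'.comp hqs,
      KerAcyclic.comp hq hqs (h.kerAcyclic_left h₂ hψ hs hk hqi hqk)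
        (h₂.kerAcyclic_right h₃ hp hps hpk hqi' hqk'), ?_, fun S hS => ?_, fun b hb => ?_⟩
    · refine Fin.cases (fun a => ?_) fun j a => ?_
      · exact (congrArg q' (hqi a)).trans (hqi' _)
      · exact (congrArg q' (hqk _)).trans ((hqk' _).trans (congrArg k₃ (hpι j a)))
    · exact hgen S (fun a => hS 0 a) fun j a => hS j.succ a
    · rw [List.ofFn_succ, List.prod_cons]
      have : (List.ofFn fun j : Fin (r + 1) => k₃ (ι' j b)).prod =
          k₃ (List.ofFn fun j => ι' j b).prod := by
        rw [map_list_prod, List.map_ofFn]; rfl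
      simp only [Fin.cases_zero, Fin.cases_succ, AlgHom.comp_apply]
      rw [this]
      exact h₃.mul_ne_zero hb (hne b hb)

end TensorPower

section Homogeneous

variable {A B : Type} [GCDGA A] [GCDGA B]

theorem pr_mul_mem {M : Submodule ℚ A} {a b : A} (h : ∀ i j, pr A i a * pr A j b ∈ M) (n : ℕ) :
    pr A n (a * b) ∈ M := by
  obtain ⟨N, -, hN⟩ := exists_bound a
  obtain ⟨K, -, hK⟩ := exists_bound b
  rw [hN N le_rfl, hK K le_rfl, Finset.sum_mul_sum, map_sum]
  refine Submodule.sum_mem _ fun i _ => ?_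
  rw [map_sum]
  refine Submodule.sum_mem _ fun j _ => ?_
  by_cases hij : i + j = n
  · rw [pr_of_mem (hij ▸ mul_mem_Gr (pr_mem i a) (pr_mem j b))]; exact h i j
  · rw [pr_of_mem_ne (mul_mem_Gr (pr_mem i a) (pr_mem j b)) hij]; exact M.zero_mem

theorem Homog.mul {I J : Submodule ℚ A} (hI : Homog I) (hJ : Homog J) : Homog (I * J) := by
  intro n a ha
  induction ha using Submodule.mul_induction_on' with
  | mem_mul_mem a ha b hb =>
    exact pr_mul_mem (fun i j => Submodule.mul_mem_mul (hI i a ha) (hJ j b hb)) n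
  | add a _ b _ ha hb => rw [map_add]; exact Submodule.add_mem _ ha hb

theorem homog_adjoin {s : Set A} (hs : ∀ a ∈ s, ∃ n, a ∈ Gr A n) :
    Homog (Algebra.adjoin ℚ s).toSubmodule := by
  intro n a ha
  change pr A n a ∈ Algebra.adjoin ℚ s
  revert n
  induction ha using Algebra.adjoin_induction with
  | mem a ha =>
    intro n
    obtain ⟨m, hm⟩ := hs a ha
    by_cases hmn : m = n
    · rw [pr_of_mem (hmn ▸ hm)]; exact Algebra.subset_adjoin ha
    · rw [pr_of_mem_ne hm hmn]; exact Subalgebra.zero_mem _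
  | algebraMap r =>
    intro n
    rw [Algebra.algebraMap_eq_smul_one, map_smul]
    refine Subalgebra.smul_mem _ ?_ _
    by_cases hmn : 0 = n
    · rw [pr_of_mem (hmn ▸ one_mem_Gr)]; exact Subalgebra.one_mem _
    · rw [pr_of_mem_ne one_mem_Gr hmn]; exact Subalgebra.zero_mem _
  | add a b _ _ ha hb => intro n; rw [map_add]; exact Subalgebra.add_mem _ (ha n) (hb n)
  | mul a b _ _ ha hb =>
    exact fun n => pr_mul_mem (M := (Algebra.adjoin ℚ s).toSubmodule)
      (fun i j => Subalgebra.mul_mem _ (ha i) (hb j)) n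

theorem eps_mem_of_homog {I : Submodule ℚ A} (hI : Homog I) {a : A} (ha : a ∈ I) :
    eps A a ∈ I := by
  obtain ⟨N, -, hN⟩ := exists_bound a
  rw [hN N le_rfl, map_sum]
  refine Submodule.sum_mem _ fun n _ => ?_
  rw [eps_of_mem (pr_mem n a)]
  exact Submodule.smul_mem _ _ (hI n a ha)

/-- Homogeneous two-sided ideals stable under the differential. -/
structure IsDGIdeal (I : Submodule ℚ A) : Prop where
  left : ∀ a b, b ∈ I → a * b ∈ I
  right : ∀ a b, a ∈ I → a * b ∈ I
  homog : Homog I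
  diff : ∀ a ∈ I, Dd A a ∈ I

theorem IsDGIdeal.mul {I J : Submodule ℚ A} (hI : IsDGIdeal I) (hJ : IsDGIdeal J) :
    IsDGIdeal (I * J) where
  left a b hb := by
    induction hb using Submodule.mul_induction_on' with
    | mem_mul_mem x hx y hy =>
      rw [← mul_assoc]; exact Submodule.mul_mem_mul (hI.left _ _ hx) hy
    | add x _ y _ hx hy => rw [mul_add]; exact Submodule.add_mem _ hx hy
  right a b ha := by
    induction ha using Submodule.mul_induction_on' with
    | mem_mul_mem x hx y hy =>
      rw [mul_assoc]; exact Submodule.mul_mem_mul hx (hJ.right _ _ hy)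
    | add x _ y _ hx hy => rw [add_mul]; exact Submodule.add_mem _ hx hy
  homog := hI.homog.mul hJ.homog
  diff a ha := by
    induction ha using Submodule.mul_induction_on' with
    | mem_mul_mem x hx y hy =>
      rw [Dd_mul]
      exact Submodule.add_mem _ (Submodule.mul_mem_mul (hI.diff _ hx) hy)
        (Submodule.mul_mem_mul (eps_mem_of_homog hI.homog hx) (hJ.diff _ hy))
    | add x _ y _ hx hy => rw [map_add]; exact Submodule.add_mem _ hx hy

theorem IsDGIdeal.pow {I : Submodule ℚ A} (hI : IsDGIdeal I) (n : ℕ) : IsDGIdeal (I ^ (n + 1)) := by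
  induction n with
  | zero => rwa [zero_add, pow_one]
  | succ n ih => rw [pow_succ]; exact ih.mul hI

theorem IsDGIdeal.pow_le_pow {I : Submodule ℚ A} (hI : IsDGIdeal I) {m n : ℕ} (hmn : m ≤ n) :
    I ^ (n + 1) ≤ I ^ (m + 1) := by
  induction n, hmn using Nat.le_induction with
  | base => exact le_rfl
  | succ n _ ih =>
    refine le_trans ?_ ih
    rw [pow_succ, Submodule.mul_le]
    exact fun a ha b _ => (hI.pow n).right a b ha

theorem IsDGIdeal.exists_quotient {I : Submodule ℚ A} (hI : IsDGIdeal I) :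
    ∃ (Q : Type) (_ : GCDGA Q) (π : A →ₐ[ℚ] Q), IsDGAHom π ∧ Function.Surjective π ∧
      LinearMap.ker π.toLinearMap = I := by
  obtain ⟨Q, i, π, h1, h2, h3⟩ := RHT.exists_quotient I hI.left hI.right hI.homog hI.diff
  exact ⟨Q, i, π, h1, h2, Submodule.ext h3⟩

theorem isDGIdeal_ker {f : A →ₐ[ℚ] B} (hf : IsDGAHom f) :
    IsDGIdeal (LinearMap.ker f.toLinearMap) where
  left a b hb := by
    have hb : f b = 0 := hb
    change f (a * b) = 0; rw [map_mul, hb, mul_zero]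
  right a b ha := by
    have ha : f a = 0 := ha
    change f (a * b) = 0; rw [map_mul, ha, zero_mul]
  homog n a ha := by
    have h := map_pr_of_graded (f := f.toLinearMap) hf.2 n a
    exact h.trans (by rw [show f.toLinearMap a = 0 from ha, map_zero])
  diff a ha := by
    have ha : f a = 0 := ha
    change f (Dd A a) = 0; rw [hf.1, ha, map_zero]

/-- The augmentation ideal, consisting of the elements of positive degree. -/
def Aug (A : Type) [GCDGA A] : Submodule ℚ A := LinearMap.ker (pr A 0)

theorem mem_Aug {n : ℕ} (hn : n ≠ 0) {a : A} (ha : a ∈ Gr A n) : a ∈ Aug A :=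
  pr_of_mem_ne ha hn

theorem isDGIdeal_Aug (A : Type) [GCDGA A] : IsDGIdeal (Aug A) where
  left a b hb := by
    have hb : pr A 0 b = 0 := hb
    change pr A 0 (a * b) = 0; rw [pr_zero_mul, hb, mul_zero]
  right a b ha := by
    have ha : pr A 0 a = 0 := ha
    change pr A 0 (a * b) = 0; rw [pr_zero_mul, ha, zero_mul]
  homog n a ha := by
    change pr A 0 (pr A n a) = 0
    by_cases h : n = 0
    · rw [h, pr_of_mem (pr_mem 0 a)]; exact ha
    · exact pr_of_mem_ne (pr_mem n a) h
  diff a _ := pr_zero_Dd a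

theorem top_mul_comm {s : Set A} (hs : ∀ a ∈ s, ∃ n, a ∈ Gr A n) :
    (⊤ : Submodule ℚ A) * Submodule.span ℚ s = Submodule.span ℚ s * ⊤ := by
  have key : ∀ a ∈ s, ∀ b : A, ∃ c c' : A, a * b = c * a ∧ b * a = a * c' := fun a ha b => by
    obtain ⟨n, hn⟩ := hs a ha
    obtain h | h := Nat.even_or_odd n
    · exact ⟨b, b, even_mul hn h b, (even_mul hn h b).symm⟩
    · exact ⟨eps A b, eps A b, odd_mul hn h b, mul_odd hn h b⟩
  apply le_antisymm <;> rw [← Submodule.span_univ, Submodule.span_mul_span, Submodule.span_le]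
  · rintro _ ⟨b, -, a, ha, rfl⟩
    obtain ⟨-, c, -, hc⟩ := key a ha b
    simp only [hc]
    exact Submodule.mul_mem_mul (Submodule.subset_span ha) (Submodule.subset_span trivial)
  · rintro _ ⟨a, ha, b, -, rfl⟩
    obtain ⟨c, -, hc, -⟩ := key a ha b
    simp only [hc]
    exact Submodule.mul_mem_mul (Submodule.subset_span trivial) (Submodule.subset_span ha)

theorem top_mul_top : (⊤ : Submodule ℚ A) * ⊤ = ⊤ :=
  top_unique fun a _ => by
    rw [← mul_one a]; exact Submodule.mul_mem_mul trivial trivial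

theorem mul_top_pow {U : Submodule ℚ A} (hU : ⊤ * U = U * ⊤) (n : ℕ) :
    (U * ⊤) ^ (n + 1) = U ^ (n + 1) * ⊤ := by
  induction n with
  | zero => rw [zero_add, pow_one, pow_one]
  | succ n ih =>
    rw [pow_succ, ih, mul_assoc, ← mul_assoc ⊤, hU, mul_assoc U, top_mul_top, ← mul_assoc,
      ← pow_succ]

theorem eq_top_of_adjoin_eq_top {s : Set A} (hs : Algebra.adjoin ℚ s = ⊤) {M : Submodule ℚ A}
    (h1 : 1 ∈ M) (hM : M * M ≤ M) (hsM : s ⊆ M) : M = ⊤ := by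
  refine top_unique fun a _ => ?_
  have ha : a ∈ Algebra.adjoin ℚ s := hs ▸ Algebra.mem_top
  exact Algebra.adjoin_le (S := M.toSubalgebra h1 fun x y hx hy =>
    hM (Submodule.mul_mem_mul hx hy)) hsM ha

/-- Subalgebras stable under the projections and the differential are gcdga's. -/
theorem exists_sub (S : Subalgebra ℚ A) (hS : Homog S.toSubmodule) (hd : ∀ a ∈ S, Dd A a ∈ S) :
    ∃ (C : Type) (_ : GCDGA C) (f : C →ₐ[ℚ] A), IsDGAHom f ∧ Function.Injective f ∧
      f.range = S ∧ ∀ n x, f x ∈ Gr A n → x ∈ Gr C n := by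
  have hmem : ∀ x y : A, (x, y) ∈ S.map ((AlgHom.id ℚ A).prod (AlgHom.id ℚ A)) ↔ x ∈ S ∧ x = y :=
    fun x y => ⟨by rintro ⟨a, ha, h⟩; cases h; exact ⟨ha, rfl⟩, by rintro ⟨h, rfl⟩; exact ⟨x, h, rfl⟩⟩
  obtain ⟨C, _, f, g, hf, -, hinj, hfg, hS', hGr⟩ := exists_sub_prod
    (S.map ((AlgHom.id ℚ A).prod (AlgHom.id ℚ A)))
    (by rintro n ⟨x, y⟩ h
        obtain ⟨h1, rfl⟩ := (hmem _ _).1 h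
        exact (hmem _ _).2 ⟨hS n x h1, rfl⟩)
    (by rintro ⟨x, y⟩ h
        obtain ⟨h1, rfl⟩ := (hmem _ _).1 h
        exact (hmem _ _).2 ⟨hd x h1, rfl⟩)
  have heq : ∀ x, f x = g x := fun x => ((hmem _ _).1 (hfg x)).2
  refine ⟨C, inferInstance, f, hf, fun x y h => hinj x y h (by rw [← heq, ← heq, h]), ?_,
    fun n x hx => hGr n x hx (heq x ▸ hx)⟩
  ext a
  constructor
  · rintro ⟨x, rfl⟩; exact ((hmem _ _).1 (hfg x)).1
  · intro ha
    obtain ⟨y, hy, -⟩ := hS' (a, a) ((hmem _ _).2 ⟨ha, rfl⟩)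
    exact ⟨y, hy⟩

end Homogeneous

namespace MinimalSullivan

variable {A : Type} [GCDGA A] (S : MinimalSullivan A)

theorem V_le_lam (n : ℕ) : S.V n ≤ S.lam 1 := by
  rw [S.lam_one]; exact le_iSup S.V n

theorem lam_one_eq_span : S.lam 1 = Submodule.span ℚ {a | ∃ n, a ∈ S.V n} := by
  rw [S.lam_one, Submodule.iSup_eq_span]
  congr 1
  ext a
  simp

theorem adjoin_eq_top (hpure : S.Pure) : Algebra.adjoin ℚ {a | ∃ n, a ∈ S.V n} = ⊤ := by
  set s : Set A := {a | ∃ n, a ∈ S.V n}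
  have hs : ∀ a ∈ s, ∃ n, a ∈ Gr A n := fun a ⟨n, h⟩ => ⟨n, S.V_le n h⟩
  have hhom := homog_adjoin hs
  have hd : ∀ a ∈ Algebra.adjoin ℚ s, Dd A a ∈ Algebra.adjoin ℚ s := fun a ha => by
    induction ha using Algebra.adjoin_induction with
    | mem a ha =>
      obtain ⟨n, hn⟩ := ha
      obtain ⟨k, rfl | rfl⟩ := Nat.even_or_odd' n
      · rw [hpure.1 a (Submodule.mem_iSup_of_mem k hn)]; exact Subalgebra.zero_mem _
      · refine Algebra.adjoin_le ?_ (hpure.2 a (Submodule.mem_iSup_of_mem k hn))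
        intro b hb
        have : S.Veven ≤ (Algebra.adjoin ℚ s).toSubmodule :=
          iSup_le fun j c hc => Algebra.subset_adjoin ⟨2 * j, hc⟩
        exact this hb
    | algebraMap r =>
      rw [Algebra.algebraMap_eq_smul_one, map_smul, Dd_one, smul_zero]
      exact Subalgebra.zero_mem _
    | add a b _ _ ha hb => rw [map_add]; exact Subalgebra.add_mem _ ha hb
    | mul a b ha' hb' ha hb =>
      rw [Dd_mul]
      exact Subalgebra.add_mem _ (Subalgebra.mul_mem _ ha hb')
        (Subalgebra.mul_mem _ (eps_mem_of_homog hhom ha') hb)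
  obtain ⟨C, _, f, hf, hinj, hrange, hGr⟩ := exists_sub _ hhom hd
  let e := LinearEquiv.ofInjective f.toLinearMap hinj
  have hV : ∀ n (v : S.V n), (v : A) ∈ LinearMap.range f.toLinearMap := fun n v => by
    have : (v : A) ∈ f.range := hrange ▸ Algebra.subset_adjoin ⟨n, v.2⟩
    exact this
  let c : ∀ n, S.V n →ₗ[ℚ] C := fun n =>
    e.symm.toLinearMap ∘ₗ (S.V n).subtype.codRestrict (LinearMap.range f.toLinearMap) (hV n)
  have hc : ∀ n v, f (c n v) = v := fun n v =>
    congrArg Subtype.val (e.apply_symm_apply ⟨(v : A), hV n v⟩)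
  obtain ⟨g, ⟨hg, hgv⟩, -⟩ := S.free C c fun n v => hGr n _ (by rw [hc]; exact S.V_le n v.2)
  obtain ⟨i, -, hi⟩ := S.free A (fun n => (S.V n).subtype) fun n v => S.V_le n v.2
  have h1 := hi (f.comp g) ⟨fun n a ha => hf.2 n _ (hg n a ha), fun n v => by
    rw [AlgHom.comp_apply, hgv, hc]; rfl⟩
  have h2 := hi (AlgHom.id ℚ A) ⟨fun n a ha => ha, fun n v => rfl⟩
  refine top_unique fun a _ => ?_
  rw [← hrange]
  exact ⟨g a, AlgHom.congr_fun (h1.trans h2.symm) a⟩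

theorem iSup_lam_one_pow (hpure : S.Pure) : ⨆ k, S.lam 1 ^ k = ⊤ := by
  refine eq_top_of_adjoin_eq_top (S.adjoin_eq_top hpure) ?_ ?_ ?_
  · exact (pow_zero (S.lam 1) ▸ le_iSup (fun k => S.lam 1 ^ k) 0) (Submodule.one_le.1 le_rfl)
  · rw [Submodule.iSup_mul]
    refine iSup_le fun i => ?_
    rw [Submodule.mul_iSup]
    refine iSup_le fun j => ?_
    rw [← pow_add]
    exact le_iSup (fun k => S.lam 1 ^ k) (i + j)
  · rintro a ⟨n, hn⟩
    exact (pow_one (S.lam 1) ▸ le_iSup (fun k => S.lam 1 ^ k) 1) (S.V_le_lam n hn)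

theorem lam_eq_pow (hpure : S.Pure) (k : ℕ) : S.lam k = S.lam 1 ^ k := by
  have hle : (fun k => S.lam 1 ^ k) ≤ S.lam := fun k => by
    induction k with
    | zero => simp only [pow_zero, S.lam_zero, le_refl]
    | succ k ih =>
      simp only [pow_succ]
      exact (mul_le_mul' ih le_rfl).trans (S.lam_mul k 1)
  have := (S.lam_internal.submodule_iSupIndep.le_iff_eq_of_iSup_eq_top
    (S.iSup_lam_one_pow hpure)).mp hle
  exact (congrFun this k).symm

theorem top_mul_lam_one : ⊤ * S.lam 1 = S.lam 1 * ⊤ := by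
  rw [S.lam_one_eq_span]
  exact top_mul_comm fun a ⟨n, h⟩ => ⟨n, S.V_le n h⟩

theorem Aug_eq (hpure : S.Pure) : Aug A = S.lam 1 * ⊤ := by
  have hle : S.lam 1 * ⊤ ≤ Aug A := by
    rw [Submodule.mul_le]
    intro a ha b _
    refine (isDGIdeal_Aug A).right a b ?_
    revert a
    change S.lam 1 ≤ Aug A
    rw [S.lam_one]
    refine iSup_le fun n => ?_
    rcases eq_or_ne n 0 with rfl | hn
    · rw [S.V0]; exact bot_le
    · exact fun a ha => mem_Aug hn (S.V_le n ha)
  refine le_antisymm (fun a ha => ?_) hle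
  have htop : (1 : Submodule ℚ A) ⊔ S.lam 1 * ⊤ = ⊤ := by
    refine top_unique ((S.iSup_lam_one_pow hpure).ge.trans (iSup_le fun k => ?_))
    cases k with
    | zero => rw [pow_zero]; exact le_sup_left
    | succ k =>
      rw [pow_succ']
      refine le_trans ?_ le_sup_right
      exact Submodule.mul_le.2 fun a ha b _ => Submodule.mul_mem_mul ha Submodule.mem_top
  obtain ⟨b, hb, c, hc, rfl⟩ := Submodule.mem_sup.1 (htop ▸ Submodule.mem_top : a ∈ _)
  obtain ⟨q, rfl⟩ := Submodule.mem_one.1 hb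
  have h1 : pr A 0 (algebraMap ℚ A q + c) = 0 := ha
  have h2 : pr A 0 c = 0 := hle hc
  rw [map_add, h2, add_zero, Algebra.algebraMap_eq_smul_one, map_smul, pr_of_mem one_mem_Gr] at h1
  rw [Algebra.algebraMap_eq_smul_one, h1, zero_add]
  exact hc

theorem iSup_lam_gt (hpure : S.Pure) (n : ℕ) : ⨆ k, ⨆ (_ : n < k), S.lam k = Aug A ^ (n + 1) := by
  rw [S.Aug_eq hpure, mul_top_pow S.top_mul_lam_one,
    ← congrArg (S.lam 1 ^ (n + 1) * ·) (S.iSup_lam_one_pow hpure), Submodule.mul_iSup]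
  apply le_antisymm
  · refine iSup₂_le fun k hk => ?_
    refine le_trans ?_ (le_iSup _ (k - (n + 1)))
    rw [S.lam_eq_pow hpure, ← pow_add, Nat.add_sub_cancel' hk]
  · refine iSup_le fun j => ?_
    rw [← pow_add, ← S.lam_eq_pow hpure]
    exact le_iSup₂_of_le (n + 1 + j) (by omega) le_rfl

end MinimalSullivan

theorem Dd_pr_eq_zero {A : Type} [GCDGA A] {a : A} (h : Dd A a = 0) (n : ℕ) :
    Dd A (pr A n a) = 0 := by
  rw [← pr_Dd, h, map_zero]

section QuasiIso

variable {A B : Type} [GCDGA A] [GCDGA B] {ψ : A →ₐ[ℚ] B}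

theorem QuasiIso.exists_lift (h : QuasiIso ψ) (hψ : IsDGAHom ψ) (hB : Dd B = 0) {n : ℕ} {b : B}
    (hb : b ∈ Gr B n) : ∃ a ∈ Gr A n, Dd A a = 0 ∧ ψ a = b := by
  obtain ⟨a, ha, c, hc⟩ := h.1 b (by rw [hB]; rfl)
  rw [hB, LinearMap.zero_apply, sub_eq_zero] at hc
  refine ⟨pr A n a, pr_mem n a, Dd_pr_eq_zero ha n, ?_⟩
  have := map_pr_of_graded (f := ψ.toLinearMap) hψ.2 n a
  refine this.trans ?_
  rw [show ψ.toLinearMap a = b from hc, pr_of_mem hb]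

theorem QuasiIso.surjective (h : QuasiIso ψ) (hB : Dd B = 0) : Function.Surjective ψ := fun b => by
  obtain ⟨a, -, c, hc⟩ := h.1 b (by rw [hB]; rfl)
  exact ⟨a, by rwa [hB, LinearMap.zero_apply, sub_eq_zero] at hc⟩

theorem QuasiIso.kerAcyclic (h : QuasiIso ψ) (hB : Dd B = 0) : KerAcyclic ψ := fun a ha h0 => by
  obtain ⟨e, rfl⟩ := h.2 a ha ⟨0, by rw [h0, map_zero]⟩
  obtain ⟨z, hz, c, hc⟩ := h.1 (ψ e) (by rw [hB]; rfl)
  rw [hB, LinearMap.zero_apply, sub_eq_zero] at hc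
  exact ⟨e - z, by rw [map_sub, hc, sub_self], by rw [map_sub, hz, sub_zero]⟩

end QuasiIso

section Independence

variable {A : Type} [GCDGA A] {W : ℕ → Submodule ℚ A} {κ : ℕ → Type}

theorem linearIndependent_graded (hW : ∀ n, W n ≤ Gr A n) (b : ∀ n, Module.Basis (κ n) ℚ (W n)) :
    LinearIndependent ℚ fun i : Σ n, κ n => (b i.1 i.2 : A) := by
  have hspan : ∀ n, Submodule.span ℚ (Set.range fun j => (b n j : A)) ≤ Gr A n := fun n => by
    rw [Submodule.span_le]
    rintro _ ⟨j, rfl⟩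
    exact hW n (b n j).2
  refine linearIndependent_iUnion_finite (f := fun n j => (b n j : A))
    (fun n => (b n).linearIndependent.map' (W n).subtype (Submodule.ker_subtype _)) ?_
  intro n t _ hn
  refine ((iSupIndep_Gr A) n).mono (hspan n) (iSup₂_le fun m hm => ?_)
  exact (hspan m).trans (le_iSup₂_of_le m (fun h => hn (h ▸ hm)) le_rfl)

theorem span_graded (b : ∀ n, Module.Basis (κ n) ℚ (W n)) (P : ℕ → Prop) :
    Submodule.span ℚ (Set.range fun i : {i : Σ n, κ n // P i.1} => (b i.1.1 i.1.2 : A)) =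
      ⨆ n, ⨆ (_ : P n), W n := by
  apply le_antisymm
  · rw [Submodule.span_le]
    rintro _ ⟨i, rfl⟩
    exact (le_iSup₂_of_le (f := fun n (_ : P n) => W n) i.1.1 i.2 le_rfl) (b i.1.1 i.1.2).2
  · refine iSup₂_le fun n hn a ha => ?_
    have := (b n).mem_span ⟨a, ha⟩
    have h2 := Submodule.mem_map_of_mem (f := (W n).subtype) this
    rw [Submodule.map_span] at h2
    refine Submodule.span_mono ?_ h2
    rintro _ ⟨_, ⟨j, rfl⟩, rfl⟩
    exact ⟨⟨⟨n, j⟩, hn⟩, rfl⟩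

theorem finrank_graded (hW : ∀ n, W n ≤ Gr A n) (b : ∀ n, Module.Basis (κ n) ℚ (W n)) (P : ℕ → Prop)
    [Finite (Σ n, κ n)] :
    Module.finrank ℚ (⨆ n, ⨆ (_ : P n), W n : Submodule ℚ A) =
      Nat.card {i : Σ n, κ n // P i.1} := by
  have := Fintype.ofFinite {i : Σ n, κ n // P i.1}
  rw [← span_graded b P, Nat.card_eq_fintype_card]
  exact finrank_span_eq_card ((linearIndependent_graded hW b).comp _ Subtype.val_injective)

theorem finite_graded (hW : ∀ n, W n ≤ Gr A n) (b : ∀ n, Module.Basis (κ n) ℚ (W n))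
    (hfin : FiniteDimensional ℚ (⨆ n, W n : Submodule ℚ A)) : Finite (Σ n, κ n) := by
  let f : (Σ n, κ n) → (⨆ n, W n : Submodule ℚ A) := fun i =>
    ⟨b i.1 i.2, (le_iSup W i.1) (b i.1 i.2).2⟩
  have : LinearIndependent ℚ f :=
    LinearIndependent.of_comp (⨆ n, W n : Submodule ℚ A).subtype (linearIndependent_graded hW b)
  exact this.finite

end Independence

/-- The decomposable elements of degree `n`. -/
def Dec (A : Type) [GCDGA A] (n : ℕ) : Submodule ℚ A :=
  ⨆ i ∈ Finset.Ioo 0 n, Gr A i * Gr A (n - i)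

theorem Dec_le (A : Type) [GCDGA A] (n : ℕ) : Dec A n ≤ Gr A n := by
  refine iSup₂_le fun i hi => Submodule.mul_le.2 fun a ha b hb => ?_
  have := mul_mem_Gr ha hb
  rwa [Nat.add_sub_cancel' (Finset.mem_Ioo.1 hi).2.le] at this

namespace MinimalSullivan

variable {A : Type} [GCDGA A] (S : MinimalSullivan A)

theorem Gr_eq (hpure : S.Pure) : Gr A = fun n => if n = 0 then 1 else S.V n ⊔ Dec A n := by
  set W : ℕ → Submodule ℚ A := fun n => if n = 0 then 1 else S.V n ⊔ Dec A n with hW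
  have hW0 : W 0 = 1 := if_pos rfl
  have hWn : ∀ n, n ≠ 0 → W n = S.V n ⊔ Dec A n := fun n hn => if_neg hn
  have hle : W ≤ Gr A := fun n => by
    rcases eq_or_ne n 0 with rfl | hn
    · rw [hW0]; exact Submodule.one_le.2 one_mem_Gr
    · rw [hWn n hn]; exact sup_le (S.V_le n) (Dec_le A n)
  have htop : ⨆ n, W n = ⊤ := by
    refine eq_top_of_adjoin_eq_top (S.adjoin_eq_top hpure) ?_ ?_ ?_
    · exact le_iSup W 0 (hW0 ▸ Submodule.one_le.1 le_rfl)
    · rw [Submodule.iSup_mul]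
      refine iSup_le fun i => ?_
      rw [Submodule.mul_iSup]
      refine iSup_le fun j => ?_
      rcases eq_or_ne i 0 with rfl | hi
      · rw [hW0, one_mul]; exact le_iSup W j
      rcases eq_or_ne j 0 with rfl | hj
      · rw [hW0, mul_one]; exact le_iSup W i
      refine le_trans ?_ (le_iSup W (i + j))
      rw [hWn (i + j) (by omega)]
      refine le_trans ?_ le_sup_right
      refine le_trans (mul_le_mul' (hle i) (hle j)) ?_
      refine le_iSup₂_of_le i (Finset.mem_Ioo.2 (by omega)) ?_
      rw [Nat.add_sub_cancel_left]
    · rintro a ⟨n, ha⟩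
      rcases eq_or_ne n 0 with rfl | hn
      · rw [S.V0, Submodule.mem_bot] at ha
        rw [ha]; exact Submodule.zero_mem _
      · exact le_iSup W n (hWn n hn ▸ Submodule.mem_sup_left ha)
  exact (((iSupIndep_Gr A).le_iff_eq_of_iSup_eq_top htop).mp hle).symm

theorem Gr_zero (hpure : S.Pure) : Gr A 0 = 1 := congrFun (S.Gr_eq hpure) 0

theorem Gr_pos (hpure : S.Pure) {n : ℕ} (hn : n ≠ 0) : Gr A n = S.V n ⊔ Dec A n :=
  (congrFun (S.Gr_eq hpure) n).trans (if_neg hn)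

theorem Gr_fg (hpure : S.Pure) (n : ℕ) : (Gr A n).FG := by
  induction n using Nat.strong_induction_on with
  | _ n ih =>
    rcases eq_or_ne n 0 with rfl | hn
    · rw [S.Gr_zero hpure, Submodule.one_eq_span]
      exact Submodule.fg_span_singleton _
    · rw [S.Gr_pos hpure hn]
      refine Submodule.FG.sup ((Submodule.fg_iff_finiteDimensional _).2 (S.V_fin n)) ?_
      refine Submodule.fg_biSup _ _ fun i hi => ?_
      rw [Finset.mem_Ioo] at hi
      exact (ih i hi.2).mul (ih _ (by omega))

theorem bijective_of_graded (hpure : S.Pure) {Θ : A →ₐ[ℚ] A}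
    (hΘ : ∀ n a, a ∈ Gr A n → Θ a ∈ Gr A n) (h : ∀ n, S.V n ≤ LinearMap.range Θ.toLinearMap ⊔ Dec A n) :
    Function.Bijective Θ := by
  have hr : ∀ n, Gr A n ≤ LinearMap.range Θ.toLinearMap := fun n => by
    induction n using Nat.strong_induction_on with
    | _ n ih =>
      rcases eq_or_ne n 0 with rfl | hn
      · rw [S.Gr_zero hpure]; exact Submodule.one_le.2 ⟨1, map_one Θ⟩
      · have hdec : Dec A n ≤ LinearMap.range Θ.toLinearMap := by
          refine iSup₂_le fun i hi => Submodule.mul_le.2 fun a ha b hb => ?_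
          rw [Finset.mem_Ioo] at hi
          obtain ⟨a', rfl⟩ := ih i hi.2 ha
          obtain ⟨b', rfl⟩ := ih _ (by omega) hb
          exact ⟨a' * b', map_mul Θ _ _⟩
        rw [S.Gr_pos hpure hn]
        exact sup_le ((h n).trans (sup_le le_rfl hdec)) hdec
  have hpr : ∀ n a, pr A n (Θ a) = Θ (pr A n a) := fun n a =>
    (map_pr_of_graded (f := Θ.toLinearMap) hΘ n a).symm
  refine ⟨?_, fun a => ?_⟩
  · rw [injective_iff_map_eq_zero]
    intro a ha
    refine eq_of_pr fun n => ?_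
    rw [map_zero]
    have : FiniteDimensional ℚ (Gr A n) := (Submodule.fg_iff_finiteDimensional _).1 (S.Gr_fg hpure n)
    let Θn : Gr A n →ₗ[ℚ] Gr A n := Θ.toLinearMap.restrict (hΘ n)
    have hs : Function.Surjective Θn := by
      rintro ⟨b, hb⟩
      obtain ⟨c, hc⟩ := hr n hb
      have hc : Θ c = b := hc
      refine ⟨⟨pr A n c, pr_mem n c⟩, Subtype.ext ?_⟩
      change Θ (pr A n c) = b
      rw [← hpr, hc, pr_of_mem hb]
    have hi := LinearMap.injective_iff_surjective.2 hs
    have h0 : Θn ⟨pr A n a, pr_mem n a⟩ = 0 := Subtype.ext (by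
      change Θ (pr A n a) = 0
      rw [← hpr, ha, map_zero])
    exact congrArg Subtype.val ((map_eq_zero_iff Θn hi).1 h0)
  · have : (⊤ : Submodule ℚ A) ≤ LinearMap.range Θ.toLinearMap := iSup_Gr A ▸ iSup_le hr
    exact this trivial

end MinimalSullivan

namespace MinimalSullivan

variable {A B : Type} [GCDGA A] [GCDGA B] (S : MinimalSullivan A) {ψ : A →ₐ[ℚ] B}

theorem exists_basis_aux (hpure : S.Pure) (hψ : IsDGAHom ψ) (hq : QuasiIso ψ) (hB : Dd B = 0)
    {n : ℕ} (hn : n ≠ 0) :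
    ∃ (t s : ℕ) (b : Module.Basis (Fin t ⊕ Fin s) ℚ (S.V n)) (f : S.V n →ₗ[ℚ] A),
      (∀ v, f v ∈ Gr A n) ∧ (∀ i, Dd A (f (b (Sum.inl i))) = 0) ∧
      (∀ j, ψ (f (b (Sum.inr j))) = 0 ∧ Dd A (f (b (Sum.inr j))) = Dd A (b (Sum.inr j))) ∧
      S.V n ≤ LinearMap.range f ⊔ Dec A n := by
  have := S.V_fin n
  let Z : Submodule ℚ A := Gr A n ⊓ LinearMap.ker (Dd A)
  let L : Submodule ℚ (S.V n) := (Z ⊔ Dec A n).comap (S.V n).subtype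
  obtain ⟨M, hM⟩ := Submodule.exists_isCompl L
  have hf (K : Submodule ℚ (S.V n)) : Module.Free ℚ K := Module.Free.of_divisionRing ℚ K
  have hfL := hf L
  have hfM := hf M
  let bL := Module.finBasis ℚ L
  let bM := Module.finBasis ℚ M
  let b := (bL.prod bM).map (Submodule.prodEquivOfIsCompl L M hM)
  have hbl : ∀ i, b (Sum.inl i) = (bL i : S.V n) := fun i => by simp [b]
  have hbr : ∀ j, b (Sum.inr j) = (bM j : S.V n) := fun j => by simp [b]
  have h1 : ∀ i, ∃ a ∈ Z, ((bL i : S.V n) : A) - a ∈ Dec A n := fun i => by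
    obtain ⟨a, ha, c, hc, h⟩ := Submodule.mem_sup.1 (bL i).2
    have h : a + c = ((bL i : S.V n) : A) := h
    exact ⟨a, ha, by rw [← h, add_sub_cancel_left]; exact hc⟩
  have h2 : ∀ j, ∃ w ∈ Z, ψ w = ψ ((bM j : S.V n) : A) := fun j => by
    obtain ⟨w, h1, h2, h3⟩ := hq.exists_lift hψ hB (hψ.2 n _ (S.V_le n (bM j : S.V n).2))
    exact ⟨w, ⟨h1, h2⟩, h3⟩
  choose a ha ha' using h1
  choose w hw hw' using h2
  let f : S.V n →ₗ[ℚ] A := b.constr ℚ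
    (Sum.elim a fun j => ((bM j : S.V n) : A) - w j)
  have hfl : ∀ i, f (b (Sum.inl i)) = a i := fun i => by rw [Module.Basis.constr_basis]; rfl
  have hfr : ∀ j, f (b (Sum.inr j)) = ((bM j : S.V n) : A) - w j := fun j => by
    rw [Module.Basis.constr_basis]; rfl
  have hZ : Z ≤ LinearMap.range f ⊔ Dec A n := by
    have hL : L.map (S.V n).subtype ≤ LinearMap.range f ⊔ Dec A n := by
      have htop : L.map (S.V n).subtype = Submodule.span ℚ (Set.range fun i => ((bL i : S.V n) : A)) := by
        have := congrArg (Submodule.map ((S.V n).subtype ∘ₗ L.subtype)) bL.span_eq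
        rw [Submodule.map_top, LinearMap.range_comp, Submodule.range_subtype, Submodule.map_span,
          ← Set.range_comp] at this
        exact this.symm
      rw [htop, Submodule.span_le]
      rintro _ ⟨i, rfl⟩
      rw [SetLike.mem_coe]
      beta_reduce
      rw [← add_sub_cancel (a i) ((bL i : S.V n) : A)]
      exact Submodule.add_mem_sup ⟨_, hfl i⟩ (ha' i)
    intro z hz
    obtain ⟨v, hv, c, hc, h⟩ := Submodule.mem_sup.1 (S.Gr_pos hpure hn ▸ hz.1)
    rw [← h]
    refine Submodule.add_mem _ (hL ⟨⟨v, hv⟩, ?_, rfl⟩) (Submodule.mem_sup_right hc)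
    change v ∈ Z ⊔ Dec A n
    rw [← add_sub_cancel_right v c, h]
    exact Submodule.sub_mem _ (Submodule.mem_sup_left hz) (Submodule.mem_sup_right hc)
  refine ⟨_, _, b, f, fun v => ?_, fun i => by rw [hfl]; exact (ha i).2, fun j => ?_, ?_⟩
  · have : v ∈ Submodule.span ℚ (Set.range b) := b.mem_span v
    induction this using Submodule.span_induction with
    | zero => rw [map_zero]; exact Submodule.zero_mem _
    | add x y _ _ hx hy => rw [map_add]; exact Submodule.add_mem _ hx hy
    | smul c x _ hx => rw [map_smul]; exact Submodule.smul_mem _ _ hx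
    | mem x hx =>
      obtain ⟨i | j, rfl⟩ := hx
      · rw [hfl]; exact (ha i).1
      · rw [hfr]; exact Submodule.sub_mem _ (S.V_le n (bM j : S.V n).2) (hw j).1
  · rw [hfr, hbr, map_sub, hw', sub_self, map_sub, (hw j).2, sub_zero]
    exact ⟨rfl, rfl⟩
  · have hV : S.V n = Submodule.span ℚ (Set.range fun i => (b i : A)) := by
      have := congrArg (Submodule.map (S.V n).subtype) b.span_eq
      rw [Submodule.map_top, Submodule.range_subtype, Submodule.map_span, ← Set.range_comp] at this
      exact this.symm
    refine hV.le.trans (Submodule.span_le.2 ?_)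
    rintro _ ⟨i | j, rfl⟩
    · rw [SetLike.mem_coe]
      beta_reduce
      rw [hbl, ← add_sub_cancel (a i) ((bL i : S.V n) : A)]
      exact Submodule.add_mem_sup ⟨_, hfl i⟩ (ha' i)
    · rw [SetLike.mem_coe]
      beta_reduce
      rw [hbr, ← sub_add_cancel ((bM j : S.V n) : A) (w j)]
      exact Submodule.add_mem _ (Submodule.mem_sup_left ⟨_, hfr j⟩) (hZ (hw j))

theorem exists_basis (hpure : S.Pure) (hψ : IsDGAHom ψ) (hq : QuasiIso ψ) (hB : Dd B = 0) (n : ℕ) :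
    ∃ (t s : ℕ) (b : Module.Basis (Fin t ⊕ Fin s) ℚ (S.V n)) (f : S.V n →ₗ[ℚ] A),
      (∀ v, f v ∈ Gr A n) ∧ (∀ i, Dd A (f (b (Sum.inl i))) = 0) ∧
      (∀ j, ψ (f (b (Sum.inr j))) = 0 ∧ Dd A (f (b (Sum.inr j))) = Dd A (b (Sum.inr j))) ∧
      S.V n ≤ LinearMap.range f ⊔ Dec A n ∧ (Even n → f = (S.V n).subtype ∧ s = 0) := by
  obtain ⟨k, rfl | rfl⟩ := Nat.even_or_odd' n
  · have := S.V_fin (2 * k)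
    have hf : Module.Free ℚ (S.V (2 * k)) := Module.Free.of_divisionRing ℚ _
    refine ⟨_, 0, (Module.finBasis ℚ (S.V (2 * k))).reindex (Equiv.sumEmpty _ _).symm,
      (S.V (2 * k)).subtype, fun v => S.V_le _ v.2, fun i => ?_, fun j => j.elim0, ?_,
      fun _ => ⟨rfl, rfl⟩⟩
    · exact hpure.1 _ (Submodule.mem_iSup_of_mem k (Subtype.mem _))
    · rw [Submodule.range_subtype]; exact le_sup_left
  · obtain ⟨t, s, b, f, h1, h2, h3, h4⟩ := S.exists_basis_aux hpure hψ hq hB (n := 2 * k + 1) (by omega)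
    exact ⟨t, s, b, f, h1, h2, h3, h4, fun h => absurd h (by simp)⟩

end MinimalSullivan

/-- Generators of a pure model `A` adapted to a formality morphism `ψ`: the `x i` are even,
the `z k` are odd cocycles and the `y j` are odd generators killed by `ψ`. -/
structure PureGenerators {A B : Type} [GCDGA A] [GCDGA B] (ψ : A →ₐ[ℚ] B) (p s t : ℕ) where
  x : Fin p → A
  y : Fin s → A
  z : Fin t → A
  dx : Fin p → ℕ
  dy : Fin s → ℕ
  dz : Fin t → ℕ
  dx_pos : ∀ i, dx i ≠ 0
  dx_even : ∀ i, Even (dx i)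
  dy_odd : ∀ i, Odd (dy i)
  dz_odd : ∀ i, Odd (dz i)
  x_mem : ∀ i, x i ∈ Gr A (dx i)
  y_mem : ∀ i, y i ∈ Gr A (dy i)
  z_mem : ∀ i, z i ∈ Gr A (dz i)
  d_x : ∀ i, Dd A (x i) = 0
  d_y : ∀ i, Dd A (y i) ∈ Algebra.adjoin ℚ (Set.range x)
  d_z : ∀ i, Dd A (z i) = 0
  map_y : ∀ i, ψ (y i) = 0
  adjoin : Algebra.adjoin ℚ (Set.range x ∪ Set.range y ∪ Set.range z) = ⊤
  free : ∀ (C : Type) [GCDGA C] (cx : Fin p → C) (cy : Fin s → C) (cz : Fin t → C),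
    (∀ i, cx i ∈ Gr C (dx i)) → (∀ i, cy i ∈ Gr C (dy i)) → (∀ i, cz i ∈ Gr C (dz i)) →
    ∃ g : A →ₐ[ℚ] C, (∀ n a, a ∈ Gr A n → g a ∈ Gr C n) ∧ (∀ i, g (x i) = cx i) ∧
      (∀ i, g (y i) = cy i) ∧ ∀ i, g (z i) = cz i

theorem constr_mem {M N ι : Type} [AddCommGroup M] [Module ℚ M] [AddCommGroup N] [Module ℚ N]
    (b : Module.Basis ι ℚ M) (c : ι → N) (P : Submodule ℚ N) (hc : ∀ i, c i ∈ P) (v : M) :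
    b.constr ℚ c v ∈ P := by
  have : v ∈ Submodule.span ℚ (Set.range b) := b.mem_span v
  induction this using Submodule.span_induction with
  | zero => rw [map_zero]; exact Submodule.zero_mem _
  | add x y _ _ hx hy => rw [map_add]; exact Submodule.add_mem _ hx hy
  | smul r x _ hx => rw [map_smul]; exact Submodule.smul_mem _ _ hx
  | mem x hx =>
    obtain ⟨i, rfl⟩ := hx
    rw [Module.Basis.constr_basis]; exact hc i

namespace MinimalSullivan

variable {A B : Type} [GCDGA A] [GCDGA B] (S : MinimalSullivan A) {ψ : A →ₐ[ℚ] B}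

open Classical in
theorem exists_generators (hpure : S.Pure) (hψ : IsDGAHom ψ) (hq : QuasiIso ψ) (hB : Dd B = 0)
    (hfin : FiniteDimensional ℚ (⨆ n, S.V n : Submodule ℚ A)) :
    ∃ p s t, Nonempty (PureGenerators ψ p s t) ∧ S.chiPi = p - (s + t) := by
  choose t s b f hfm hfz hfy hfr hfe using S.exists_basis hpure hψ hq hB
  let I := Σ n, Fin (t n) ⊕ Fin (s n)
  have hI : Finite I := finite_graded S.V_le b hfin
  let gen : I → A := fun i => f i.1 (b i.1 i.2)
  obtain ⟨Θ, ⟨hΘ, hΘv⟩, -⟩ := S.free A f fun n v => hfm n v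
  have hbij : Function.Bijective Θ := S.bijective_of_graded hpure hΘ fun n =>
    (hfr n).trans (sup_le_sup_right (by rintro _ ⟨v, rfl⟩; exact ⟨v, hΘv n v⟩) _)
  have hgen : ∀ i : I, Θ (b i.1 i.2 : A) = gen i := fun i => hΘv _ _
  have hmemV : ∀ (U : Submodule ℚ A) n, (∀ j, (b n j : A) ∈ U) → S.V n ≤ U := fun U n h v hv => by
    have := constr_mem (b n) (fun j => (b n j : A)) U h ⟨v, hv⟩
    rwa [show (b n).constr ℚ (fun j => (b n j : A)) = (S.V n).subtype from
      (b n).ext fun j => by rw [Module.Basis.constr_basis]; rfl] at this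
  have hpos : ∀ i : I, i.1 ≠ 0 := by
    rintro ⟨n, j⟩ rfl
    have h1 : (b 0 j : A) = 0 := (Submodule.mem_bot ℚ).1 (S.V0 ▸ (b 0 j).2)
    exact (b 0).ne_zero j (Subtype.ext h1)
  have hadj : Algebra.adjoin ℚ (Set.range gen) = ⊤ := by
    have h1 : Algebra.adjoin ℚ {a | ∃ n, a ∈ S.V n} ≤ (Algebra.adjoin ℚ (Set.range gen)).comap Θ := by
      refine Algebra.adjoin_le ?_
      rintro a ⟨n, ha⟩
      refine hmemV ((Algebra.adjoin ℚ (Set.range gen)).comap Θ).toSubmodule n (fun j => ?_) ha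
      exact Algebra.subset_adjoin ⟨⟨n, j⟩, (hgen ⟨n, j⟩).symm⟩
    rw [S.adjoin_eq_top hpure] at h1
    refine top_unique fun a _ => ?_
    obtain ⟨a, rfl⟩ := hbij.2 a
    exact h1 (Algebra.mem_top (x := a))
  let Od := {i : I // Odd i.1}
  let eX := Finite.equivFin {i : I // Even i.1}
  let eY := Finite.equivFin {i : Od // i.1.2.isRight}
  let eZ := Finite.equivFin {i : Od // ¬ i.1.2.isRight}
  refine ⟨_, _, _, ⟨
    { x := fun i => gen (eX.symm i).1
      y := fun i => gen (eY.symm i).1.1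
      z := fun i => gen (eZ.symm i).1.1
      dx := fun i => (eX.symm i).1.1
      dy := fun i => (eY.symm i).1.1.1
      dz := fun i => (eZ.symm i).1.1.1
      dx_pos := fun i => hpos _
      dx_even := fun i => (eX.symm i).2
      dy_odd := fun i => (eY.symm i).1.2
      dz_odd := fun i => (eZ.symm i).1.2
      x_mem := fun i => hfm _ _
      y_mem := fun i => hfm _ _
      z_mem := fun i => hfm _ _
      d_x := ?_
      d_y := ?_
      d_z := ?_
      map_y := ?_
      adjoin := ?_
      free := ?_ }⟩, ?_⟩
  · intro i
    obtain ⟨⟨n, j⟩, hn⟩ := eX.symm i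
    have hn : Even n := hn
    obtain ⟨k, rfl⟩ := even_iff_exists_two_mul.1 hn
    change Dd A (f _ _) = 0
    rw [(hfe _ hn).1]
    exact hpure.1 _ (Submodule.mem_iSup_of_mem k (Subtype.mem _))
  · intro i
    obtain ⟨⟨⟨n, j | j⟩, hn⟩, hj⟩ := eY.symm i
    · simp at hj
    obtain ⟨k, hk⟩ := hn
    change n = _ at hk
    subst hk
    change Dd A (f _ (b _ (Sum.inr j))) ∈ _
    rw [(hfy _ _).2]
    refine Algebra.adjoin_le ?_ (hpure.2 _ (Submodule.mem_iSup_of_mem k (Subtype.mem _)))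
    have : S.Veven ≤ (Algebra.adjoin ℚ (Set.range fun i => gen (eX.symm i).1)).toSubmodule := by
      refine iSup_le fun m => hmemV _ _ fun j => Algebra.subset_adjoin
        ⟨eX ⟨⟨2 * m, j⟩, even_two_mul m⟩, ?_⟩
      dsimp only
      rw [Equiv.symm_apply_apply]
      change f _ _ = _
      rw [(hfe _ (even_two_mul m)).1]; rfl
    exact this
  · intro i
    obtain ⟨⟨⟨n, j | j⟩, hn⟩, hj⟩ := eZ.symm i
    · exact hfz _ _
    · simp at hj
  · intro i
    obtain ⟨⟨⟨n, j | j⟩, hn⟩, hj⟩ := eY.symm i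
    · simp at hj
    exact (hfy _ _).1
  · rw [← top_le_iff, ← hadj]
    refine Algebra.adjoin_mono ?_
    rintro _ ⟨i, rfl⟩
    obtain h | h := Nat.even_or_odd i.1
    · exact Or.inl (Or.inl ⟨eX ⟨i, h⟩, by simp⟩)
    · by_cases h' : i.2.isRight
      · exact Or.inl (Or.inr ⟨eY ⟨⟨i, h⟩, h'⟩, by simp⟩)
      · exact Or.inr ⟨eZ ⟨⟨i, h⟩, h'⟩, by simp⟩
  · intro C _ cx cy cz hcx hcy hcz
    let c : I → C := fun i => if h : Even i.1 then cx (eX ⟨i, h⟩) else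
      if h' : i.2.isRight then cy (eY ⟨⟨i, Nat.not_even_iff_odd.1 h⟩, h'⟩)
      else cz (eZ ⟨⟨i, Nat.not_even_iff_odd.1 h⟩, h'⟩)
    have hc : ∀ i, c i ∈ Gr C i.1 := fun i => by
      simp only [c]
      split_ifs with h h'
      · simpa using hcx (eX ⟨i, h⟩)
      · simpa using hcy (eY ⟨⟨i, Nat.not_even_iff_odd.1 h⟩, h'⟩)
      · simpa using hcz (eZ ⟨⟨i, Nat.not_even_iff_odd.1 h⟩, h'⟩)
    obtain ⟨g, ⟨hg, hgv⟩, -⟩ := S.free C (fun n => (b n).constr ℚ fun j => c ⟨n, j⟩)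
      fun n v => constr_mem _ _ _ (fun j => hc ⟨n, j⟩) v
    let e := AlgEquiv.ofBijective Θ hbij
    have hval : ∀ i, g.comp e.symm.toAlgHom (gen i) = c i := fun i => by
      change g (e.symm (gen i)) = c i
      rw [← hgen, show e.symm (Θ (b i.1 i.2 : A)) = (b i.1 i.2 : A) from e.symm_apply_apply _, hgv,
        Module.Basis.constr_basis]
    refine ⟨g.comp e.symm.toAlgHom, fun n a ha => hg n _ ?_, fun i => ?_, fun i => ?_, fun i => ?_⟩
    · change e.symm a ∈ Gr A n
      have : pr A n (e.symm a) = e.symm a := by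
        apply hbij.1
        have h1 := map_pr_of_graded (f := Θ.toLinearMap) hΘ n (e.symm a)
        refine h1.trans ?_
        rw [show Θ.toLinearMap (e.symm a) = a from e.apply_symm_apply a, pr_of_mem ha]
        exact (e.apply_symm_apply a).symm
      exact this ▸ pr_mem n _
    · rw [hval]
      simp only [c]
      rw [dif_pos (eX.symm i).2]
      simp
    · rw [hval]
      simp only [c]
      rw [dif_neg (Nat.not_even_iff_odd.2 (eY.symm i).1.2), dif_pos (eY.symm i).2]
      simp
    · rw [hval]
      simp only [c]
      rw [dif_neg (Nat.not_even_iff_odd.2 (eZ.symm i).1.2), dif_neg (eZ.symm i).2]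
      simp
  · have h1 : S.Veven = ⨆ n, ⨆ (_ : Even n), S.V n := by
      apply le_antisymm
      · exact iSup_le fun n => le_iSup₂_of_le (2 * n) (even_two_mul n) le_rfl
      · refine iSup₂_le fun n hn => ?_
        obtain ⟨k, rfl⟩ := even_iff_exists_two_mul.1 hn
        exact le_iSup (fun k => S.V (2 * k)) k
    have h2 : S.Vodd = ⨆ n, ⨆ (_ : Odd n), S.V n := by
      apply le_antisymm
      · exact iSup_le fun n => le_iSup₂_of_le (2 * n + 1) ⟨n, rfl⟩ le_rfl
      · refine iSup₂_le fun n hn => ?_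
        obtain ⟨k, rfl⟩ := hn
        exact le_iSup (fun k => S.V (2 * k + 1)) k
    rw [MinimalSullivan.chiPi, h1, h2, finrank_graded S.V_le b, finrank_graded S.V_le b,
      ← Nat.card_congr (Equiv.sumCompl fun i : Od => i.1.2.isRight = true), Nat.card_sum]
    push_cast
    rfl

end MinimalSullivan

section Nilpotence

variable {A : Type} [GCDGA A]

theorem commute_span {s t : Set A} (hs : ∀ a ∈ s, ∃ n, a ∈ Gr A n) (ht : ∀ a ∈ t, ∃ n, a ∈ Gr A n) :
    Commute (Submodule.span ℚ s) (Submodule.span ℚ t) := by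
  have key : ∀ {s t : Set A}, (∀ a ∈ s, ∃ n, a ∈ Gr A n) → (∀ a ∈ t, ∃ n, a ∈ Gr A n) →
      Submodule.span ℚ s * Submodule.span ℚ t ≤ Submodule.span ℚ t * Submodule.span ℚ s := by
    intro s t hs ht
    rw [Submodule.span_mul_span, Submodule.span_le]
    rintro _ ⟨a, ha, b, hb, rfl⟩
    obtain ⟨i, hi⟩ := hs a ha
    obtain ⟨j, hj⟩ := ht b hb
    beta_reduce
    rw [SetLike.mem_coe, Gr_comm hi hj]
    exact Submodule.smul_mem _ _
      (Submodule.mul_mem_mul (Submodule.subset_span hb) (Submodule.subset_span ha))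
  exact le_antisymm (key hs ht) (key ht hs)

theorem sum_pow_eq_zero {R ι : Type} [Semiring R] (s : Finset ι) (E : ι → R) (n : ι → ℕ)
    (hc : ∀ i j, Commute (E i) (E j)) (hE : ∀ i, E i ^ (n i + 1) = 0) :
    (∑ i ∈ s, E i) ^ (∑ i ∈ s, n i + 1) = 0 := by
  classical
  induction s using Finset.induction_on with
  | empty => simp
  | insert a s ha ih =>
    rw [Finset.sum_insert ha, Finset.sum_insert ha]
    exact (Commute.sum_right _ _ _ fun j _ => hc a j).add_pow_eq_zero_of_add_le_succ_of_pow_eq_zero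
      (hE a) ih (by omega)

theorem span_range_eq_sum {ι : Type} [Fintype ι] (v : ι → A) :
    Submodule.span ℚ (Set.range v) = ∑ i, Submodule.span ℚ {v i} := by
  rw [Submodule.span_range_eq_iSup, ← Finset.sup_univ_eq_iSup]
  rfl

/-- A product of more than `m` linear combinations of `m` odd elements vanishes. -/
theorem span_odd_pow {ι : Type} [Fintype ι] (v : ι → A) (hv : ∀ i, ∃ n, Odd n ∧ v i ∈ Gr A n) :
    Submodule.span ℚ (Set.range v) ^ (Fintype.card ι + 1) = ⊥ := by
  have := sum_pow_eq_zero Finset.univ (fun i => Submodule.span ℚ {v i}) (fun _ => 1)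
    (fun i j => commute_span (by rintro _ rfl; exact (hv i).imp fun _ h => h.2)
      (by rintro _ rfl; exact (hv j).imp fun _ h => h.2))
    (fun i => by
      obtain ⟨n, hn, h⟩ := hv i
      rw [pow_two, Submodule.span_mul_span, Set.singleton_mul_singleton, odd_mul_self h hn,
        Submodule.span_zero_singleton]; rfl)
  rw [span_range_eq_sum]
  simpa using this

theorem ofFn_prod_mem_pow {R : Type} [Ring R] [Algebra ℚ R] {I : Submodule ℚ R} :
    ∀ {n : ℕ} (f : Fin n → R), (∀ i, f i ∈ I) → (List.ofFn f).prod ∈ I ^ n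
  | 0, f, _ => by
    rw [List.ofFn_zero, List.prod_nil, pow_zero]; exact Submodule.one_le.1 le_rfl
  | n + 1, f, hf => by
    rw [List.ofFn_succ, List.prod_cons, pow_succ']
    exact Submodule.mul_mem_mul (hf 0) (ofFn_prod_mem_pow _ fun i => hf _)

theorem map_ofFn_prod {R R' : Type} [Ring R] [Algebra ℚ R] [Ring R'] [Algebra ℚ R']
    (φ : R →ₐ[ℚ] R') {n : ℕ} (f : Fin n → R) :
    φ (List.ofFn f).prod = (List.ofFn fun i => φ (f i)).prod := by
  rw [map_list_prod, List.map_ofFn]; rfl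

end Nilpotence

namespace PureGenerators

variable {A B : Type} [GCDGA A] [GCDGA B] {ψ : A →ₐ[ℚ] B} {p s t : ℕ} (P : PureGenerators ψ p s t)

theorem adjoin_x_le_evenSub : Algebra.adjoin ℚ (Set.range P.x) ≤ evenSub A :=
  Algebra.adjoin_le (by rintro _ ⟨i, rfl⟩; exact mem_evenSub (P.x_mem i) (P.dx_even i))

theorem adjoin_x_le_cocycles : Algebra.adjoin ℚ (Set.range P.x) ≤ cocycles A :=
  Algebra.adjoin_le (by rintro _ ⟨i, rfl⟩; exact P.d_x i)

theorem exists_coeff {a : A} (ha : a ∈ Algebra.adjoin ℚ (Set.range P.x)) (h0 : pr A 0 a = 0) :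
    ∃ g : Fin p → A, (∀ i, g i ∈ Algebra.adjoin ℚ (Set.range P.x)) ∧ a = ∑ i, g i * P.x i := by
  have key : ∃ (c : ℚ) (g : Fin p → A), (∀ i, g i ∈ Algebra.adjoin ℚ (Set.range P.x)) ∧
      a = algebraMap ℚ A c + ∑ i, g i * P.x i := by
    clear h0
    induction ha using Algebra.adjoin_induction with
    | mem a ha =>
      obtain ⟨i, rfl⟩ := ha
      refine ⟨0, fun j => if j = i then 1 else 0, fun j => ?_, ?_⟩
      · dsimp only; split_ifs <;> simp
      · simp
    | algebraMap c => exact ⟨c, 0, fun _ => zero_mem _, by simp⟩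
    | add a b _ _ ha hb =>
      obtain ⟨c, g, hg, h⟩ := ha
      obtain ⟨c', g', hg', h'⟩ := hb
      refine ⟨c + c', g + g', fun i => add_mem (hg i) (hg' i), ?_⟩
      rw [h, h', map_add]
      simp only [Pi.add_apply, add_mul, Finset.sum_add_distrib]
      abel
    | mul a b ha' hb' ha hb =>
      obtain ⟨c, g, hg, h⟩ := ha
      obtain ⟨c', g', hg', h'⟩ := hb
      refine ⟨c * c', fun i => a * g' i + algebraMap ℚ A c' * g i, fun i => add_mem (mul_mem ha' (hg' i))
        (mul_mem (Subalgebra.algebraMap_mem _ _) (hg i)), ?_⟩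
      simp only [add_mul, Finset.sum_add_distrib, mul_assoc, ← Finset.mul_sum]
      rw [h', mul_add, ← Algebra.commutes c' a]
      nth_rewrite 1 [h]
      rw [mul_add, map_mul, Algebra.commutes c (algebraMap ℚ A c')]
      abel
  obtain ⟨c, g, hg, h⟩ := key
  refine ⟨g, hg, ?_⟩
  have hc : pr A 0 a = algebraMap ℚ A c := by
    rw [h, map_add, map_sum, Finset.sum_eq_zero, add_zero, Algebra.algebraMap_eq_smul_one, map_smul,
      pr_of_mem one_mem_Gr]
    intro i _
    rw [pr_zero_mul, pr_of_mem_ne (P.x_mem i) (P.dx_pos i), mul_zero]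
  rw [h0] at hc
  rw [h, ← hc, zero_add]

theorem exists_coeff_d_y (j : Fin s) :
    ∃ g : Fin p → A, (∀ i, g i ∈ Algebra.adjoin ℚ (Set.range P.x)) ∧
      Dd A (P.y j) = ∑ i, g i * P.x i :=
  P.exists_coeff (P.d_y j) (pr_zero_Dd _)

theorem s_le_p (P : PureGenerators ψ p s t) (hψ : IsDGAHom ψ) (hk : KerAcyclic ψ) (hB : Dd B = 0)
    (h1 : (1 : B) ≠ 0) : s ≤ p := by
  by_contra! hps
  choose g hg hdy using P.exists_coeff_d_y
  have hodd : ∀ i, Odd (P.dx i - 1) := fun i => by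
    have := P.dx_pos i
    have := P.dx_even i
    exact Nat.Even.sub_odd (by omega) this odd_one
  obtain ⟨D, _, F, _, α, β, Ψ, u, hα, hΨ, hΨk, hc, hu, hdu, hW⟩ := exists_killing p hψ hk P.x
    (fun i => P.dx i - 1) hodd (fun i => by
      have := P.dx_pos i
      rw [Nat.sub_add_cancel (by omega)]; exact P.x_mem i) P.d_x
  let ω : Fin s → D := fun j => α (P.y j) - ∑ i, α (g j i) * u i
  have hω : ∀ j, Dd D (ω j) = 0 := fun j => by
    have : ∀ i, Dd D (α (g j i) * u i) = α (g j i * P.x i) := fun i => by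
      rw [Dd_mul, ← hα.1, P.adjoin_x_le_cocycles (hg j i), map_zero, zero_mul, zero_add,
        ← graded_eps hα.2, evenSub_eps (P.adjoin_x_le_evenSub (hg j i)), hdu, map_mul]
    simp only [ω, map_sub, map_sum, this]
    rw [← hα.1, hdy, map_sum, sub_self]
  have hprod : Dd D (List.ofFn ω).prod = 0 := by
    change _ ∈ cocycles D
    refine Subalgebra.list_prod_mem _ fun a ha => ?_
    obtain ⟨j, rfl⟩ := (List.mem_ofFn' _ _).1 ha
    exact hω j
  let U : Submodule ℚ F := Submodule.span ℚ (Set.range fun i => Ψ (u i))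
  have hhom : ∀ i, ∃ n, Odd n ∧ Ψ (u i) ∈ Gr F n := fun i => ⟨_, hodd i, hΨ.2 _ _ (hu i)⟩
  have hU : ⊤ * U = U * ⊤ := top_mul_comm (by rintro _ ⟨i, rfl⟩; exact (hhom i).imp fun _ h => h.2)
  have hUp : (U * ⊤) ^ (p + 1) = ⊥ := by
    have := span_odd_pow _ hhom
    rw [Fintype.card_fin] at this
    rw [mul_top_pow hU, this, Submodule.bot_mul]
  have hmem : ∀ j, Ψ (ω j) ∈ U * ⊤ := fun j => by
    rw [← hU]
    simp only [ω, map_sub, hc, P.map_y, map_zero, zero_sub, map_sum, map_mul]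
    exact Submodule.neg_mem _ (Submodule.sum_mem _ fun i _ => Submodule.mul_mem_mul trivial
      (Submodule.subset_span ⟨i, rfl⟩))
  have hzero : Ψ (List.ofFn ω).prod = 0 := by
    have := ofFn_prod_mem_pow _ hmem
    rw [← map_ofFn_prod] at this
    rwa [show (U * ⊤) ^ s = ⊥ from by
      rw [← Nat.add_sub_of_le (Nat.succ_le_of_lt hps), pow_add, hUp, Submodule.bot_mul],
      Submodule.mem_bot] at this
  obtain ⟨e, -, he⟩ := hΨk _ hprod hzero
  obtain ⟨W, _, b, w, hW0, -, hw, hne⟩ := exists_odd_generators hB s P.dy P.dy_odd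
  obtain ⟨f, hf, hfx, hfy, hfz⟩ := P.free W (fun _ => 0) w (fun _ => 0) (fun _ => zero_mem _) hw
    (fun _ => zero_mem _)
  have hfd : IsDGAHom f := by
    refine isDGAHom_of_adjoin hf P.adjoin ?_
    rintro _ ((⟨i, rfl⟩ | ⟨i, rfl⟩) | ⟨i, rfl⟩)
    · rw [P.d_x, hW0]; simp
    · rw [hdy, hW0]; simp [hfx]
    · rw [P.d_z, hW0]; simp
  obtain ⟨h, hh, hhα, hhu⟩ := hW W f hfd hfx
  refine hne 1 h1 ?_
  have h2 : h (List.ofFn ω).prod = (List.ofFn w).prod := by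
    rw [map_ofFn_prod]
    congr 2
    funext j
    simp [ω, hhα, hhu, hfy]
  rw [map_one, one_mul, ← h2, he, hh.1, hW0, LinearMap.zero_apply]

end PureGenerators

theorem le_of_fg_mul_adjoin {p s : ℕ} (g : Fin s → MvPolynomial (Fin p) ℚ)
    (M : Submodule ℚ (MvPolynomial (Fin p) ℚ)) (hM : M.FG)
    (h : M * Subalgebra.toSubmodule (Algebra.adjoin ℚ (Set.range g)) = ⊤) : p ≤ s := by
  obtain ⟨T, rfl⟩ := hM
  have hfin : Module.Finite (Algebra.adjoin ℚ (Set.range g)) (MvPolynomial (Fin p) ℚ) := by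
    refine ⟨⟨T, ?_⟩⟩
    rw [eq_top_iff]
    intro a _
    have ha : a ∈ Submodule.span ℚ (T : Set (MvPolynomial (Fin p) ℚ)) *
      Subalgebra.toSubmodule (Algebra.adjoin ℚ (Set.range g)) := h ▸ Submodule.mem_top
    refine Submodule.mul_induction_on ha (fun m hm k hk => ?_) fun _ _ => add_mem
    · have hm' : m ∈ Submodule.span (Algebra.adjoin ℚ (Set.range g))
          (T : Set (MvPolynomial (Fin p) ℚ)) :=
        Submodule.span_le_restrictScalars ℚ _ _ hm
      have := Submodule.smul_mem _ (⟨k, hk⟩ : Algebra.adjoin ℚ (Set.range g)) hm'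
      rwa [Subalgebra.smul_def, smul_eq_mul, mul_comm] at this
  have : Algebra.IsAlgebraic (Algebra.adjoin ℚ (Set.range g)) (MvPolynomial (Fin p) ℚ) :=
    Algebra.IsIntegral.isAlgebraic
  have h1 := Algebra.IsAlgebraic.trdeg_le_cardinalMk ℚ (Set.range g)
  rw [MvPolynomial.trdeg_of_isDomain] at h1
  have h2 := h1.trans (Cardinal.mk_range_le (f := g))
  simpa using h2

/-- Polynomial algebras on even generators, as gcdga's with zero differential. -/
theorem exists_polynomial {p : ℕ} (w : Fin p → ℕ) (hw : ∀ i, Even (w i)) :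
    ∃ (R : Type) (_ : GCDGA R) (c : Fin p → R), Dd R = 0 ∧ (∀ i, c i ∈ Gr R (w i)) ∧
      Algebra.adjoin ℚ (Set.range c) = ⊤ ∧
      ∀ (s : ℕ) (g : Fin s → R) (M : Submodule ℚ R), M.FG →
        M * Subalgebra.toSubmodule (Algebra.adjoin ℚ (Set.range g)) = ⊤ → p ≤ s := by
  have heven : ∀ n, ∀ a ∈ MvPolynomial.weightedHomogeneousSubmodule ℚ w n, ¬ Even n → a = 0 := by
    intro n a ha hn
    refine ha.eq_zero_of_no_monomials fun d hd => hn ?_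
    rw [← hd, Finsupp.weight_apply]
    exact Finset.even_sum _ fun i _ => (hw i).mul_left (d i)
  let I : GCDGA (MvPolynomial (Fin p) ℚ) :=
    { (inferInstance : Ring (MvPolynomial (Fin p) ℚ)),
      (inferInstance : Algebra ℚ (MvPolynomial (Fin p) ℚ)) with
      grading := MvPolynomial.weightedHomogeneousSubmodule ℚ w
      gradedAlgebra := MvPolynomial.weightedGradedAlgebra ℚ w
      grading_comm := fun i j a b ha hb => by
        by_cases hi : Even i
        · rw [(hi.mul_right j).neg_one_pow, one_smul, mul_comm]
        · rw [heven i a ha hi, zero_mul, mul_zero, smul_zero]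
      d := 0
      d_sq := fun _ => rfl
      d_grading := fun _ _ _ => Submodule.zero_mem _
      d_leibniz := fun _ _ _ _ => by simp }
  exact ⟨MvPolynomial (Fin p) ℚ, I, MvPolynomial.X, rfl,
    fun i => MvPolynomial.isWeightedHomogeneous_X ℚ w i, MvPolynomial.adjoin_range_X,
    fun s g M hM h => le_of_fg_mul_adjoin g M hM h⟩

namespace PureGenerators

variable {A B : Type} [GCDGA A] [GCDGA B] {ψ : A →ₐ[ℚ] B} {p s t : ℕ}

theorem p_le_s (P : PureGenerators ψ p s t) (hψ : IsDGAHom ψ) (hk : KerAcyclic ψ)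
    {N : ℕ} (hN : ∀ n, N ≤ n → Gr B n = ⊥)
    (hfg : ∀ n, (Gr A n).FG) : p ≤ s := by
  obtain ⟨R, _, c, hR, hc, hcs, hle⟩ := exists_polynomial P.dx P.dx_even
  obtain ⟨π, hπ, hπx, hπy, hπz⟩ := P.free R c (fun _ => 0) (fun _ => 0) hc (fun _ => zero_mem _)
    (fun _ => zero_mem _)
  have hcomm : ∀ a b : R, a * b = b * a := fun a b => by
    have : evenSub R = ⊤ := by
      rw [eq_top_iff, ← hcs]
      exact Algebra.adjoin_le (by rintro _ ⟨i, rfl⟩; exact mem_evenSub (hc i) (P.dx_even i))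
    exact evenSub_comm (this ▸ Algebra.mem_top) b
  have hlift : ∀ a, ∃ a0 ∈ Algebra.adjoin ℚ (Set.range P.x), π a0 = a := fun a => by
    have h : (Algebra.adjoin ℚ (Set.range P.x)).map π = ⊤ := by
      rw [AlgHom.map_adjoin, ← Set.range_comp, show (π ∘ P.x) = c from funext hπx, hcs]
    exact Subalgebra.mem_map.1 (h ▸ Algebra.mem_top : a ∈ (Algebra.adjoin ℚ (Set.range P.x)).map π)
  let k : Fin s → R := fun j => π (Dd A (P.y j))
  have hkm : ∀ j, k j ∈ Gr R (P.dy j + 1) := fun j => hπ _ _ (Dd_mem (P.y_mem j))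
  let U : Submodule ℚ R := Submodule.span ℚ (Set.range k)
  have hJl : ∀ a b, b ∈ U * ⊤ → a * b ∈ U * ⊤ := fun a b hb => by
    have := Submodule.mul_mem_mul hb (Submodule.mem_top (x := a))
    rwa [mul_assoc, top_mul_top, hcomm] at this
  have hJr : ∀ a b, a ∈ U * ⊤ → a * b ∈ U * ⊤ := fun a b ha => by rw [hcomm]; exact hJl _ _ ha
  have hd : ∀ e, π (Dd A e) ∈ U * ⊤ := fun e => by
    have : e ∈ Algebra.adjoin ℚ (Set.range P.x ∪ Set.range P.y ∪ Set.range P.z) :=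
      P.adjoin ▸ Algebra.mem_top
    induction this using Algebra.adjoin_induction with
    | mem e he =>
      rcases he with (⟨i, rfl⟩ | ⟨i, rfl⟩) | ⟨i, rfl⟩
      · rw [P.d_x, map_zero]; exact zero_mem _
      · have := Submodule.mul_mem_mul (Submodule.subset_span (R := ℚ) (Set.mem_range_self (f := k) i))
          (Submodule.mem_top (x := (1 : R)))
        rwa [mul_one] at this
      · rw [P.d_z, map_zero]; exact zero_mem _
    | algebraMap q =>
      rw [Algebra.algebraMap_eq_smul_one, map_smul, Dd_one, smul_zero, map_zero]; exact zero_mem _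
    | add a b _ _ ha hb => rw [map_add, map_add]; exact add_mem ha hb
    | mul a b _ _ ha hb =>
      rw [Dd_mul, map_add, map_mul, map_mul]
      exact add_mem (hJr _ _ ha) (hJl _ _ hb)
  have hlarge : ∀ n, N ≤ n → ∀ a ∈ Gr R n, a ∈ U * ⊤ := fun n hn a ha => by
    obtain ⟨a0, ha0, rfl⟩ := hlift a
    have h1 : π (pr A n a0) = π a0 :=
      (map_pr_of_graded (f := π.toLinearMap) hπ n a0).trans (pr_of_mem ha)
    have h2 : Dd A (pr A n a0) = 0 := by
      rw [← pr_Dd, P.adjoin_x_le_cocycles ha0, map_zero]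
    have h3 : ψ (pr A n a0) = 0 := by
      have := hψ.2 n _ (pr_mem n a0)
      rwa [hN n hn, Submodule.mem_bot] at this
    obtain ⟨e, -, he⟩ := hk _ h2 h3
    rw [← h1, he]
    exact hd e
  let F : Submodule ℚ R := (⨆ n : Fin N, Gr A n).map π.toLinearMap
  let K := Subalgebra.toSubmodule (Algebra.adjoin ℚ (Set.range k))
  have hKK : ∀ a ∈ F * K, ∀ j, k j * a ∈ F * K := fun a ha j => by
    rw [hcomm]
    have := Submodule.mul_mem_mul ha
      (show k j ∈ K from Algebra.subset_adjoin (Set.mem_range_self j))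
    rwa [mul_assoc, Subalgebra.isIdempotentElem_toSubmodule] at this
  have hall : ∀ n, Gr R n ≤ F * K := fun n => by
    induction n using Nat.strong_induction_on with
    | _ n ih =>
      intro a ha
      rcases lt_or_ge n N with hn | hn
      · obtain ⟨a0, -, rfl⟩ := hlift a
        have h1 : π (pr A n a0) = π a0 :=
          (map_pr_of_graded (f := π.toLinearMap) hπ n a0).trans (pr_of_mem ha)
        rw [← h1, ← mul_one (π _)]
        exact Submodule.mul_mem_mul ⟨_, Submodule.mem_iSup_of_mem (⟨n, hn⟩ : Fin N) (pr_mem n a0), rfl⟩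
          (Subalgebra.one_mem _)
      · rw [← pr_of_mem ha]
        refine Submodule.mul_induction_on (hlarge n hn a ha) (fun u hu b _ => ?_) fun x y hx hy => by
          rw [map_add]; exact add_mem hx hy
        induction hu using Submodule.span_induction with
        | zero => rw [zero_mul, map_zero]; exact zero_mem _
        | add x y _ _ hx hy => rw [add_mul, map_add]; exact add_mem hx hy
        | smul q x _ hx => rw [smul_mul_assoc, map_smul]; exact Submodule.smul_mem _ _ hx
        | mem x hx =>
          obtain ⟨j, rfl⟩ := hx
          induction b using Gr_induction with
          | h0 => rw [mul_zero, map_zero]; exact zero_mem _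
          | hadd x y hx hy => rw [mul_add, map_add]; exact add_mem (hx trivial) (hy trivial)
          | hom m b hb =>
            have hm := mul_mem_Gr (hkm j) hb
            by_cases h : P.dy j + 1 + m = n
            · rw [pr_of_mem (h ▸ hm)]
              exact hKK _ (ih m (by omega) hb) j
            · rw [pr_of_mem_ne hm h]; exact zero_mem _
  refine hle s k F (Submodule.FG.map _ (Submodule.fg_iSup _ fun n => hfg n)) ?_
  rw [eq_top_iff, ← iSup_Gr]
  exact iSup_le hall

end PureGenerators

theorem eq_zero_of_sum_pow_smul {M : Type} [AddCommGroup M] [Module ℚ M] {n : ℕ} {f : ℕ → M}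
    (h : ∀ c : ℚ, ∑ j ∈ Finset.range n, c ^ j • f j = 0) {j : ℕ} (hj : j < n) : f j = 0 := by
  rw [← Module.forall_dual_apply_eq_zero_iff ℚ]
  intro l
  have h0 : ∑ i ∈ Finset.range n, Polynomial.C (l (f i)) * Polynomial.X ^ i = 0 :=
    Polynomial.funext fun c => by
      have := congrArg l (h c)
      rw [map_sum, map_zero] at this
      rw [Polynomial.eval_finsetSum, Polynomial.eval_zero, ← this]
      exact Finset.sum_congr rfl fun i _ => by
        rw [Polynomial.eval_mul, Polynomial.eval_C, Polynomial.eval_pow, Polynomial.eval_X, map_smul,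
          smul_eq_mul, mul_comm]
  have := congrArg (fun q => Polynomial.coeff q j) h0
  simpa [Polynomial.finsetSum_coeff, Polynomial.coeff_C_mul, Polynomial.coeff_X_pow,
    Finset.sum_ite_eq, hj] using this

/-- Polarization: a space of commuting elements all of whose `m`-th powers vanish has vanishing
`m`-th power. -/
theorem pow_eq_bot_of_forall_pow {R : Type} [Ring R] [Algebra ℚ R] (Z : Submodule ℚ R)
    (hc : ∀ a ∈ Z, ∀ b ∈ Z, Commute a b) {m : ℕ} (h : ∀ a ∈ Z, a ^ m = 0) : Z ^ m = ⊥ := by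
  have key : ∀ k ≤ m, ∀ u ∈ Z, ∀ q ∈ Z ^ k, u ^ (m - k) * q = 0 := by
    intro k
    induction k with
    | zero => intro _ u hu q _; rw [Nat.sub_zero, h u hu, zero_mul]
    | succ k ih =>
      intro hk u hu q hq
      rw [pow_succ'] at hq
      refine Submodule.mul_induction_on hq (fun w hw q hq => ?_) fun a b ha hb => by
        rw [mul_add, ha, hb, add_zero]
      have hs : ∀ c : ℚ, ∑ j ∈ Finset.range (m - k + 1),
          c ^ j • (w ^ j * u ^ (m - k - j) * ((m - k).choose j : R) * q) = 0 := fun c => by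
        have hcw : c • w ∈ Z := Submodule.smul_mem _ c hw
        have := ih (by omega) (c • w + u) (add_mem hcw hu) q hq
        rw [(hc _ hcw _ hu).add_pow, Finset.sum_mul] at this
        rw [← this]
        exact Finset.sum_congr rfl fun j _ => by simp only [smul_pow, smul_mul_assoc]
      have := eq_zero_of_sum_pow_smul hs (j := 1) (by omega)
      have e : ∀ (N : ℕ) (a : R), (N : R) = (N : ℚ) • 1 := fun N a => by
        rw [← Algebra.algebraMap_eq_smul_one, map_natCast]
      rw [Nat.choose_one_right, pow_one, e (m - k) 1, mul_smul_comm, mul_one, smul_mul_assoc,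
        smul_eq_zero] at this
      rcases this with h0 | h0
      · exact absurd h0 (by exact_mod_cast (by omega : m - k ≠ 0))
      · rw [← ((hc _ hw _ hu).pow_right _).eq.symm, mul_assoc] at h0
        rwa [Nat.sub_add_eq]
  rw [eq_bot_iff]
  intro q hq
  rcases eq_or_ne (Z ^ m) ⊥ with h0 | h0
  · exact h0 ▸ hq
  · have := key m le_rfl 0 (zero_mem _) q hq
    rwa [Nat.sub_self, pow_zero, one_mul] at this

theorem exists_sum_pow {R : Type} [Ring R] [Algebra ℚ R] {m : ℕ} : ∀ {r : ℕ} (c : Fin r → ℚ)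
    (X : Fin r → R), (∀ i, c i ≠ 0) → (∀ i j, Commute (X i) (X j)) → (∀ i, X i ^ (m + 1) = 0) →
    ∃ K : ℚ, K ≠ 0 ∧ (∑ i, c i • X i) ^ (r * m) = K • (List.ofFn fun i => X i ^ m).prod
  | 0, _, _, _, _, _ => ⟨1, one_ne_zero, by simp⟩
  | r + 1, c, X, hc, hX, h0 => by
    obtain ⟨K, hK, hs⟩ := exists_sum_pow (fun i => c i.succ) (fun i => X i.succ) (fun i => hc _)
      (fun i j => hX _ _) (fun i => h0 _)
    have hcc : ∀ i j, Commute (c i • X i) (c j • X j) := fun i j =>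
      ((hX i j).smul_left _).smul_right _
    have hz : (∑ i : Fin r, c i.succ • X i.succ) ^ (r * m + 1) = 0 := by
      have := sum_pow_eq_zero Finset.univ (fun i : Fin r => c i.succ • X i.succ) (fun _ => m)
        (fun i j => hcc _ _) fun i => by rw [smul_pow, h0, smul_zero]
      simpa using this
    refine ⟨c 0 ^ m * K * ((r + 1) * m).choose m, ?_, ?_⟩
    · refine mul_ne_zero (mul_ne_zero (pow_ne_zero _ (hc 0)) hK) ?_
      exact_mod_cast (Nat.choose_pos (Nat.le_mul_of_pos_left _ r.succ_pos)).ne'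
    · rw [Fin.sum_univ_succ, (Commute.sum_right _ _ _ fun j _ => hcc 0 j.succ).add_pow,
        Finset.sum_eq_single_of_mem m (Finset.mem_range.2 (by nlinarith)), List.ofFn_succ,
        List.prod_cons, show (r + 1) * m - m = r * m by rw [add_mul, one_mul, Nat.add_sub_cancel], hs,
        smul_pow, smul_mul_smul_comm, ← nsmul_eq_mul', ← Nat.cast_smul_eq_nsmul ℚ, smul_smul, mul_comm]
      intro j _ hjm
      rcases lt_or_gt_of_ne hjm with hj | hj
      · obtain ⟨k, hk⟩ : ∃ k, (r + 1) * m - j = r * m + 1 + k :=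
          ⟨(r + 1) * m - j - (r * m + 1), by have : (r + 1) * m = r * m + m := by ring
                                             omega⟩
        rw [hk, pow_add, hz, zero_mul, mul_zero, zero_mul]
      · obtain ⟨k, rfl⟩ := Nat.exists_eq_add_of_lt hj
        rw [show m + k + 1 = m + 1 + k by omega, pow_add, smul_pow, h0, smul_zero, zero_mul, zero_mul,
          zero_mul]

section Finite

variable {B : Type} [GCDGA B]

theorem exists_Gr_eq_bot (hB : FiniteDimensional ℚ B) : ∃ N, ∀ n, N ≤ n → Gr B n = ⊥ := by
  obtain ⟨T, hT⟩ := hB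
  choose f hf _ using fun b : B => exists_bound b
  refine ⟨T.sup f, fun n hn => (eq_bot_iff).2 fun b hb => ?_⟩
  have h : (⊤ : Submodule ℚ B) ≤ LinearMap.ker (pr B n) := by
    rw [← hT, Submodule.span_le]
    exact fun x hx => hf x n ((Finset.le_sup hx).trans hn)
  rw [Submodule.mem_bot, ← pr_of_mem hb]
  exact h trivial

theorem exists_pow_eq_bot {N : ℕ} (hN : ∀ n, N ≤ n → Gr B n = ⊥) (X : Submodule ℚ B)
    (hX : X ≤ ⨆ k, ⨆ (_ : 1 ≤ k), Gr B k) : X ^ N = ⊥ := by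
  have key : ∀ n, X ^ n ≤ ⨆ k, ⨆ (_ : n ≤ k), Gr B k := by
    intro n
    induction n with
    | zero =>
      rw [pow_zero, Submodule.one_le]
      exact Submodule.mem_iSup_of_mem 0 (Submodule.mem_iSup_of_mem le_rfl one_mem_Gr)
    | succ n ih =>
      rw [pow_succ]
      refine (mul_le_mul' ih hX).trans ?_
      simp only [Submodule.iSup_mul, Submodule.mul_iSup, iSup_le_iff]
      intro j hj i hi
      refine Submodule.mul_le.2 fun a ha b hb => ?_
      exact Submodule.mem_iSup_of_mem (i + j) (Submodule.mem_iSup_of_mem (by omega) (mul_mem_Gr ha hb))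
  rw [eq_bot_iff]
  refine (key N).trans (iSup_le fun k => iSup_le fun hk => (hN k hk).le)

theorem exists_nilpotency {N : ℕ} (hN : ∀ n, N ≤ n → Gr B n = ⊥) (h1 : (1 : B) ≠ 0) (X : Submodule ℚ B)
    (hX : X ≤ ⨆ k, ⨆ (_ : 1 ≤ k), Gr B k) : ∃ m, X ^ m ≠ ⊥ ∧ X ^ (m + 1) = ⊥ := by
  classical
  have hex : ∃ n, X ^ n = ⊥ := ⟨N, exists_pow_eq_bot hN X hX⟩
  have h0 : Nat.find hex ≠ 0 := fun h => by
    have := Nat.find_spec hex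
    rw [h, pow_zero, eq_bot_iff, Submodule.one_le] at this
    exact h1 this
  refine ⟨Nat.find hex - 1, Nat.find_min hex (by omega), ?_⟩
  rw [Nat.sub_add_cancel (by omega)]
  exact Nat.find_spec hex

end Finite

theorem HtpyRetraction.exact {T Q : Type} [GCDGA T] [GCDGA Q] {ρ : T →ₐ[ℚ] Q} (R : HtpyRetraction ρ)
    {a : T} (ha : Dd T a = 0) (h0 : ρ a = 0) : ∃ e, a = Dd T e := by
  obtain ⟨c, hc⟩ := R.q_quasi.2 (R.j a) (by rw [← R.j_dga.1, ha, map_zero])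
    ⟨0, (DFunLike.congr_fun R.hqj a).trans (h0.trans (map_zero _).symm)⟩
  refine ⟨R.τ c, ?_⟩
  rw [← R.τ_dga.1, ← hc]
  exact (DFunLike.congr_fun R.hτj a).symm

theorem eq_zero_of_mem_pow {A B : Type} [GCDGA A] [GCDGA B] {f : A →ₐ[ℚ] B} {I : Submodule ℚ A}
    {U : Submodule ℚ B} (hI : ∀ a ∈ I, f a ∈ U * ⊤) (hU : ⊤ * U = U * ⊤) {n : ℕ}
    (hUn : U ^ (n + 1) = ⊥) {a : A} (ha : a ∈ I ^ (n + 1)) : f a = 0 := by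
  have h : I.map f.toLinearMap ≤ U * ⊤ := by
    rintro _ ⟨b, hb, rfl⟩
    exact hI b hb
  have h1 : f a ∈ (I.map f.toLinearMap) ^ (n + 1) := by
    rw [← Submodule.map_pow]; exact ⟨a, ha, rfl⟩
  have h2 := pow_le_pow_left' h (n + 1) h1
  rwa [mul_top_pow hU, hUn, Submodule.bot_mul, Submodule.mem_bot] at h2

namespace PureGenerators

variable {A B : Type} [GCDGA A] [GCDGA B] {ψ : A →ₐ[ℚ] B} {p s t : ℕ} (P : PureGenerators ψ p s t)

/-- The span of the images of the even generators. -/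
def X : Submodule ℚ B := Submodule.span ℚ (Set.range fun i => ψ (P.x i))

/-- The span of the images of the odd generators which are cocycles. -/
def Z : Submodule ℚ B := Submodule.span ℚ (Set.range fun k => ψ (P.z k))

theorem X_eq_map : P.X = (Submodule.span ℚ (Set.range P.x)).map ψ.toLinearMap := by
  rw [Submodule.map_span, ← Set.range_comp]; rfl

theorem span_x_le : Submodule.span ℚ (Set.range P.x) ≤
    Subalgebra.toSubmodule (Algebra.adjoin ℚ (Set.range P.x)) :=
  Submodule.span_le.2 Algebra.subset_adjoin

theorem span_x_le_Aug : Submodule.span ℚ (Set.range P.x) ≤ Aug A :=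
  Submodule.span_le.2 (by rintro _ ⟨i, rfl⟩; exact mem_Aug (P.dx_pos i) (P.x_mem i))

theorem exists_pow_ne_zero {m : ℕ} (hm : P.X ^ m ≠ ⊥) :
    ∃ ξ ∈ Submodule.span ℚ (Set.range P.x), ψ ξ ^ m ≠ 0 := by
  by_contra! h
  refine hm (pow_eq_bot_of_forall_pow _ ?_ ?_)
  · rw [X_eq_map]
    rintro _ ⟨a, ha, rfl⟩ _ ⟨b, -, rfl⟩
    have := congrArg ψ (evenSub_comm (P.adjoin_x_le_evenSub (P.span_x_le ha)) b)
    rwa [map_mul, map_mul] at this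
  · rw [X_eq_map]
    rintro _ ⟨a, ha, rfl⟩
    exact h a ha

theorem X_le (hψ : IsDGAHom ψ) : P.X ≤ ⨆ k, ⨆ (_ : 1 ≤ k), Gr B k := by
  refine Submodule.span_le.2 ?_
  rintro _ ⟨i, rfl⟩
  exact Submodule.mem_iSup_of_mem (P.dx i) (Submodule.mem_iSup_of_mem
    (Nat.one_le_iff_ne_zero.2 (P.dx_pos i)) (hψ.2 _ _ (P.x_mem i)))

theorem X_hom (hψ : IsDGAHom ψ) : ∀ a ∈ Set.range fun i => ψ (P.x i), ∃ n, a ∈ Gr B n := by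
  rintro _ ⟨i, rfl⟩
  exact ⟨_, hψ.2 _ _ (P.x_mem i)⟩

theorem Z_hom (hψ : IsDGAHom ψ) : ∀ a ∈ Set.range fun k => ψ (P.z k), ∃ n, a ∈ Gr B n := by
  rintro _ ⟨i, rfl⟩
  exact ⟨_, hψ.2 _ _ (P.z_mem i)⟩

theorem sup_pow_eq_bot (hψ : IsDGAHom ψ) {m : ℕ} (hm : P.X ^ (m + 1) = ⊥) :
    (P.X ⊔ P.Z) ^ (m + t + 1) = ⊥ := by
  have h := span_odd_pow (fun k => ψ (P.z k)) fun k => ⟨_, P.dz_odd k, hψ.2 _ _ (P.z_mem k)⟩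
  rw [Fintype.card_fin] at h
  exact (commute_span (P.X_hom hψ) (P.Z_hom hψ)).add_pow_eq_zero_of_add_le_succ_of_pow_eq_zero hm h
    (by omega)

theorem Aug_le (hψ : IsDGAHom ψ) (hs : Function.Surjective ψ) : Aug B ≤ (P.X ⊔ P.Z) * ⊤ := by
  have hadj : Algebra.adjoin ℚ (ψ '' (Set.range P.x ∪ Set.range P.y ∪ Set.range P.z)) = ⊤ := by
    rw [← AlgHom.map_adjoin, P.adjoin, Algebra.map_top, (AlgHom.range_eq_top ψ).2 hs]
  have hle : P.X ⊔ P.Z ≤ (P.X ⊔ P.Z) * ⊤ := fun a ha => by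
    have := Submodule.mul_mem_mul ha (Submodule.mem_top (x := (1 : B)))
    rwa [mul_one] at this
  have htop : (1 : Submodule ℚ B) ⊔ (P.X ⊔ P.Z) * ⊤ = ⊤ := by
    refine eq_top_of_adjoin_eq_top hadj (Submodule.mem_sup_left (Submodule.one_le.1 le_rfl)) ?_ ?_
    · rw [Submodule.mul_sup _ 1, mul_one, Submodule.sup_mul 1, one_mul]
      refine sup_le le_rfl (sup_le le_sup_right (le_trans ?_ le_sup_right))
      rw [mul_assoc]
      exact mul_le_mul' le_rfl le_top
    · rintro _ ⟨_, ((⟨i, rfl⟩ | ⟨i, rfl⟩) | ⟨i, rfl⟩), rfl⟩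
      · exact Submodule.mem_sup_right (hle (Submodule.mem_sup_left (Submodule.subset_span ⟨i, rfl⟩)))
      · rw [P.map_y]; exact zero_mem _
      · exact Submodule.mem_sup_right (hle (Submodule.mem_sup_right (Submodule.subset_span ⟨i, rfl⟩)))
  have hAug : (P.X ⊔ P.Z) * ⊤ ≤ Aug B := by
    refine Submodule.mul_le.2 fun a ha b _ => (isDGIdeal_Aug B).right _ _ ?_
    refine (sup_le (Submodule.span_le.2 ?_) (Submodule.span_le.2 ?_) : P.X ⊔ P.Z ≤ Aug B) ha
    · rintro _ ⟨i, rfl⟩; exact mem_Aug (P.dx_pos i) (hψ.2 _ _ (P.x_mem i))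
    · rintro _ ⟨i, rfl⟩; exact mem_Aug (P.dz_odd i).pos.ne' (hψ.2 _ _ (P.z_mem i))
  intro a ha
  obtain ⟨c, hc, b, hb, rfl⟩ := Submodule.mem_sup.1 (htop ▸ Submodule.mem_top (x := a))
  obtain ⟨q, rfl⟩ := Submodule.mem_one.1 hc
  have h1 : pr B 0 (algebraMap ℚ B q) = algebraMap ℚ B q := by
    rw [Algebra.algebraMap_eq_smul_one, map_smul, pr_of_mem one_mem_Gr]
  have h2 : pr B 0 (algebraMap ℚ B q + b) = 0 := ha
  have h3 : pr B 0 b = 0 := hAug hb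
  rw [map_add, h1, h3, add_zero] at h2
  rwa [h2, zero_add]

theorem top_mul_sup (hψ : IsDGAHom ψ) : ⊤ * (P.X ⊔ P.Z) = (P.X ⊔ P.Z) * ⊤ := by
  rw [Submodule.mul_sup, Submodule.sup_mul]
  exact congrArg₂ _ (top_mul_comm (P.X_hom hψ)) (top_mul_comm (P.Z_hom hψ))

theorem exists_hom (hψ : IsDGAHom ψ) (hB : Dd B = 0) {E : Type} [GCDGA E] (hE : Dd E = 0)
    {φ : B →ₐ[ℚ] E} (hφ : IsDGAHom φ) (cz : Fin t → E) (hcz : ∀ k, cz k ∈ Gr E (P.dz k)) :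
    ∃ f : A →ₐ[ℚ] E, IsDGAHom f ∧ (∀ a ∈ Algebra.adjoin ℚ (Set.range P.x), f a = φ (ψ a)) ∧
      ∀ k, f (P.z k) = cz k := by
  obtain ⟨f, hf, hfx, hfy, hfz⟩ := P.free E (fun i => φ (ψ (P.x i))) (fun _ => 0) cz
    (fun i => hφ.2 _ _ (hψ.2 _ _ (P.x_mem i))) (fun _ => zero_mem _) hcz
  have hadj : ∀ a ∈ Algebra.adjoin ℚ (Set.range P.x), f a = φ (ψ a) := fun a ha => by
    have : Algebra.adjoin ℚ (Set.range P.x) ≤ AlgHom.equalizer f (φ.comp ψ) :=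
      Algebra.adjoin_le (by rintro _ ⟨i, rfl⟩; exact hfx i)
    exact this ha
  refine ⟨f, isDGAHom_of_adjoin hf P.adjoin ?_, hadj, hfz⟩
  rintro _ ((⟨i, rfl⟩ | ⟨i, rfl⟩) | ⟨i, rfl⟩)
  · rw [P.d_x, hE]; simp
  · rw [hadj _ (P.d_y i), hψ.1, hB, hE]; simp
  · rw [P.d_z, hE]; simp

theorem cat_eq {S : MinimalSullivan A} (hpure : S.Pure) (hψ : IsDGAHom ψ) (hs : Function.Surjective ψ)
    (hk : KerAcyclic ψ) (hB : Dd B = 0) {m : ℕ} (hm : P.X ^ m ≠ ⊥) (hm1 : P.X ^ (m + 1) = ⊥) :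
    cat A S = m + t := by
  have hup : Nonempty (CatWitness A S (m + t)) := by
    obtain ⟨Q, _, π, hπ, hπs, hπk⟩ := ((isDGIdeal_Aug A).pow (m + t)).exists_quotient
    refine ⟨⟨Q, π, hπ, hπs, hπk.trans (S.iSup_lam_gt hpure _).symm,
      nonempty_htpyRetraction hψ hk hB hπ hπs fun a ha => ?_⟩⟩
    refine eq_zero_of_mem_pow ?_ (P.top_mul_sup hψ) (P.sup_pow_eq_bot hψ hm1)
      (hπk ▸ (show a ∈ LinearMap.ker π.toLinearMap from ha) : a ∈ Aug A ^ (m + t + 1))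
    intro b hb
    refine P.Aug_le hψ hs ?_
    have h := map_pr_of_graded (f := ψ.toLinearMap) hψ.2 0 b
    rw [show pr A 0 b = 0 from hb, map_zero] at h
    exact h.symm
  refine le_antisymm (Nat.sInf_le hup) (le_csInf ⟨_, hup⟩ ?_)
  · rintro n ⟨W⟩
    by_contra! hn
    obtain ⟨ξ, hξ, hξm⟩ := P.exists_pow_ne_zero hm
    have hξa := P.span_x_le hξ
    let _ := W.instQ
    let a := ξ ^ m * (List.ofFn P.z).prod
    have ha : Dd A a = 0 := by
      change a ∈ cocycles A
      refine mul_mem (pow_mem (P.adjoin_x_le_cocycles hξa) m)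
        (Subalgebra.list_prod_mem _ fun b hb => ?_)
      obtain ⟨k, rfl⟩ := (List.mem_ofFn' _ _).1 hb
      exact P.d_z k
    have hmem : a ∈ Aug A ^ (m + t) := by
      rw [pow_add]
      exact Submodule.mul_mem_mul (Submodule.pow_mem_pow _ (P.span_x_le_Aug hξ) m)
        (ofFn_prod_mem_pow _ fun k => mem_Aug (P.dz_odd k).pos.ne' (P.z_mem k))
    have h0 : W.π a = 0 := by
      have h := (isDGIdeal_Aug A).pow_le_pow (show n ≤ m + t - 1 by omega)
      rw [Nat.sub_add_cancel (by omega), ← S.iSup_lam_gt hpure, ← W.π_ker] at h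
      exact h hmem
    obtain ⟨R⟩ := W.retr
    obtain ⟨e, he⟩ := R.exact ha h0
    obtain ⟨E, _, β, w, hE, hβ, hw, hne⟩ := exists_odd_generators hB t P.dz P.dz_odd
    obtain ⟨f, hf, hfx, hfz⟩ := P.exists_hom hψ hB hE hβ w hw
    refine hne _ hξm ?_
    have h1 : f a = β (ψ ξ ^ m) * (List.ofFn w).prod := by
      rw [map_mul, map_ofFn_prod, map_pow, hfx ξ hξa, map_pow]
      simp only [hfz]
    rw [← h1, he, hf.1, hE, LinearMap.zero_apply]

end PureGenerators

namespace TensorPower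

variable {A : Type} [GCDGA A] {r : ℕ} {T : Type} [GCDGA T] (TP : TensorPower A r T)

theorem mu_dga : IsDGAHom TP.mu :=
  (TP.coprod A (fun _ => AlgHom.id ℚ A) (fun _ => isDGAHom_id A)).choose_spec.1.1

theorem mu_ι (j : Fin r) (a : A) : TP.mu (TP.ι j a) = a :=
  DFunLike.congr_fun
    ((TP.coprod A (fun _ => AlgHom.id ℚ A) (fun _ => isDGAHom_id A)).choose_spec.1.2 j) a

theorem isDGIdeal_kerMu : IsDGIdeal TP.kerMu := isDGIdeal_ker TP.mu_dga

end TensorPower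

theorem sub_mem_of_adjoin {R R' : Type} [Ring R] [Algebra ℚ R] [Ring R'] [Algebra ℚ R']
    {f g : R →ₐ[ℚ] R'} {W : Submodule ℚ R'} (hl : ∀ a, ∀ b ∈ W, a * b ∈ W)
    (hr : ∀ a ∈ W, ∀ b, a * b ∈ W) {s : Set R} (hs : Algebra.adjoin ℚ s = ⊤)
    (h : ∀ a ∈ s, f a - g a ∈ W) (a : R) : f a - g a ∈ W := by
  have ha : a ∈ Algebra.adjoin ℚ s := hs ▸ Algebra.mem_top
  induction ha using Algebra.adjoin_induction with
  | mem a ha => exact h a ha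
  | algebraMap q => simp
  | add a b _ _ iha ihb =>
    rw [map_add, map_add, add_sub_add_comm]; exact add_mem iha ihb
  | mul a b _ _ iha ihb =>
    have : f (a * b) - g (a * b) = f a * (f b - g b) + (f a - g a) * g b := by
      rw [map_mul, map_mul]; noncomm_ring
    rw [this]
    exact add_mem (hl _ _ ihb) (hr _ iha _)

namespace PureGenerators

variable {A B : Type} [GCDGA A] [GCDGA B] {ψ : A →ₐ[ℚ] B} {p s t : ℕ} (P : PureGenerators ψ p s t)
  {r : ℕ} {H : Type} [GCDGA H] (φ : Fin (r + 1) → (B →ₐ[ℚ] H))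

/-- The span of the differences of the images of the even generators. -/
def diffX : Submodule ℚ H := Submodule.span ℚ
  (Set.range fun q : Fin r × Fin p => φ q.1.succ (ψ (P.x q.2)) - φ 0 (ψ (P.x q.2)))

/-- The span of the differences of the images of the odd generators which are cocycles. -/
def diffZ : Submodule ℚ H := Submodule.span ℚ
  (Set.range fun q : Fin r × Fin t => φ q.1.succ (ψ (P.z q.2)) - φ 0 (ψ (P.z q.2)))

variable {φ}

theorem diffX_hom (hψ : IsDGAHom ψ) (hφ : ∀ j, IsDGAHom (φ j)) : ∀ a ∈ Set.range fun q : Fin r × Fin p =>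
    φ q.1.succ (ψ (P.x q.2)) - φ 0 (ψ (P.x q.2)), ∃ n, a ∈ Gr H n := by
  rintro _ ⟨q, rfl⟩
  have h := fun j => (hφ j).2 _ _ (hψ.2 _ _ (P.x_mem q.2))
  exact ⟨_, sub_mem (h _) (h 0)⟩

theorem diffZ_mem (hψ : IsDGAHom ψ) (hφ : ∀ j, IsDGAHom (φ j))
    (q : Fin r × Fin t) :
    φ q.1.succ (ψ (P.z q.2)) - φ 0 (ψ (P.z q.2)) ∈ Gr H (P.dz q.2) := by
  have h := fun j => (hφ j).2 _ _ (hψ.2 _ _ (P.z_mem q.2))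
  exact sub_mem (h _) (h 0)

theorem diffZ_hom (hψ : IsDGAHom ψ) (hφ : ∀ j, IsDGAHom (φ j)) : ∀ a ∈ Set.range fun q : Fin r × Fin t =>
    φ q.1.succ (ψ (P.z q.2)) - φ 0 (ψ (P.z q.2)), ∃ n, a ∈ Gr H n := by
  rintro _ ⟨q, rfl⟩
  exact ⟨_, P.diffZ_mem hψ hφ q⟩

theorem top_mul_diff (hψ : IsDGAHom ψ) (hφ : ∀ j, IsDGAHom (φ j)) :
    ⊤ * (P.diffX φ ⊔ P.diffZ φ) = (P.diffX φ ⊔ P.diffZ φ) * ⊤ := by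
  rw [Submodule.mul_sup, Submodule.sup_mul]
  exact congrArg₂ _ (top_mul_comm (P.diffX_hom hψ hφ)) (top_mul_comm (P.diffZ_hom hψ hφ))

theorem diffX_pow (hψ : IsDGAHom ψ) (hφ : ∀ j, IsDGAHom (φ j)) {m : ℕ}
    (hm : P.X ^ (m + 1) = ⊥) : P.diffX φ ^ ((r + 1) * m + 1) = ⊥ := by
  have hle : P.diffX φ ≤ ∑ j, P.X.map (φ j).toLinearMap := by
    have hj : ∀ j i, φ j (ψ (P.x i)) ∈ ∑ j, P.X.map (φ j).toLinearMap := fun j i =>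
      Finset.single_le_sum (f := fun j => P.X.map (φ j).toLinearMap) (fun _ _ => bot_le)
        (Finset.mem_univ j) ⟨_, Submodule.subset_span ⟨i, rfl⟩, rfl⟩
    refine Submodule.span_le.2 ?_
    rintro _ ⟨q, rfl⟩
    exact sub_mem (hj _ _) (hj _ _)
  have hX : ∀ j, P.X.map (φ j).toLinearMap =
      Submodule.span ℚ (Set.range fun i => φ j (ψ (P.x i))) := fun j => by
    rw [X, Submodule.map_span, ← Set.range_comp]; rfl
  have hhom : ∀ j, ∀ a ∈ Set.range fun i => φ j (ψ (P.x i)), ∃ n, a ∈ Gr H n := by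
    rintro j _ ⟨i, rfl⟩
    exact ⟨_, (hφ j).2 _ _ (hψ.2 _ _ (P.x_mem i))⟩
  have h0 := sum_pow_eq_zero Finset.univ (fun j => P.X.map (φ j).toLinearMap) (fun _ => m)
    (fun i j => by rw [hX, hX]; exact commute_span (hhom i) (hhom j))
    (fun j => by rw [← Submodule.map_pow, hm, Submodule.map_bot]; rfl)
  rw [Finset.sum_const, Finset.card_univ, Fintype.card_fin, smul_eq_mul] at h0
  exact le_bot_iff.1 ((pow_le_pow_left' hle _).trans h0.le)

theorem diff_pow (hψ : IsDGAHom ψ) (hφ : ∀ j, IsDGAHom (φ j)) {m : ℕ}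
    (hm : P.X ^ (m + 1) = ⊥) :
    (P.diffX φ ⊔ P.diffZ φ) ^ ((r + 1) * m + r * t + 1) = ⊥ := by
  have h := span_odd_pow (fun q : Fin r × Fin t => φ q.1.succ (ψ (P.z q.2)) - φ 0 (ψ (P.z q.2)))
    fun q => ⟨_, P.dz_odd q.2, P.diffZ_mem hψ hφ q⟩
  rw [Fintype.card_prod, Fintype.card_fin, Fintype.card_fin] at h
  exact (commute_span (P.diffX_hom hψ hφ)
    (P.diffZ_hom hψ hφ)).add_pow_eq_zero_of_add_le_succ_of_pow_eq_zero
      (P.diffX_pow hψ hφ hm) h (by omega)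

theorem sub_mem_diff (hψ : IsDGAHom ψ) (hφ : ∀ j, IsDGAHom (φ j))
    {T : Type} [GCDGA T] (TP : TensorPower A (r + 1) T) {π : T →ₐ[ℚ] H}
    (hπ : ∀ j a, π (TP.ι j a) = φ j (ψ a))
    (hT : ∀ S : Subalgebra ℚ T, (∀ j a, TP.ι j a ∈ S) → S = ⊤) {a : T} (ha : TP.mu a = 0) :
    π a ∈ (P.diffX φ ⊔ P.diffZ φ) * ⊤ := by
  set U := P.diffX φ ⊔ P.diffZ φ with hU
  have hr : ∀ a ∈ U * ⊤, ∀ b, a * b ∈ U * ⊤ := fun a ha b => by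
    have := Submodule.mul_mem_mul ha (Submodule.mem_top (x := b))
    rwa [mul_assoc, top_mul_top] at this
  have hl : ∀ a, ∀ b ∈ U * ⊤, a * b ∈ U * ⊤ := fun a b hb => by
    have := Submodule.mul_mem_mul (Submodule.mem_top (x := a)) hb
    rwa [← mul_assoc, P.top_mul_diff hψ hφ, mul_assoc, top_mul_top] at this
  have hle : U ≤ U * ⊤ := fun a ha => by
    have := Submodule.mul_mem_mul ha (Submodule.mem_top (x := (1 : H)))
    rwa [mul_one] at this
  have hφ0 : ∀ j a, (φ j).comp ψ a - (φ 0).comp ψ a ∈ U * ⊤ := by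
    intro j
    refine sub_mem_of_adjoin hl hr P.adjoin ?_
    induction j using Fin.cases with
    | zero => intro a _; rw [sub_self]; exact zero_mem _
    | succ j =>
      rintro _ ((⟨i, rfl⟩ | ⟨i, rfl⟩) | ⟨i, rfl⟩)
      · exact hle (Submodule.mem_sup_left (Submodule.subset_span ⟨(j, i), rfl⟩))
      · simp [P.map_y]
      · exact hle (Submodule.mem_sup_right (Submodule.subset_span ⟨(j, i), rfl⟩))
  have h := sub_mem_of_adjoin (f := π) (g := ((φ 0).comp ψ).comp TP.mu) hl hr
    (hT (Algebra.adjoin ℚ {b | ∃ j a, b = TP.ι j a})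
      fun j a => Algebra.subset_adjoin ⟨j, a, rfl⟩)
    (by
      rintro _ ⟨j, a, rfl⟩
      rw [hπ, AlgHom.comp_apply _ TP.mu, TP.mu_ι]
      exact hφ0 j a) a
  rwa [AlgHom.comp_apply _ TP.mu, ha, map_zero, sub_zero] at h

theorem TC_eq (hψ : IsDGAHom ψ) (hs : Function.Surjective ψ)
    (hk : KerAcyclic ψ) (hB : Dd B = 0) {m : ℕ} (hm : P.X ^ m ≠ ⊥) (hm1 : P.X ^ (m + 1) = ⊥)
    {r : ℕ} (hr : r ≠ 0) : TC A (r + 1) = (r + 1) * m + r * t := by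
  obtain ⟨T, _, TP, H, _, φ, π, hH, hφ, hπ, -, hπk, hπι, hT, hne⟩ :=
    exists_tensorPower hψ hs hk hB r
  have hup : Nonempty (TCWitness A (r + 1) ((r + 1) * m + r * t)) := by
    obtain ⟨Q, _, ρ, hρ, hρs, hρk⟩ :=
      (TP.isDGIdeal_kerMu.pow ((r + 1) * m + r * t)).exists_quotient
    refine ⟨⟨T, TP, Q, ρ, hρ, hρs, hρk, nonempty_htpyRetraction hπ hπk hH hρ hρs fun a ha => ?_⟩⟩
    exact eq_zero_of_mem_pow (fun b hb => P.sub_mem_diff hψ hφ TP hπι hT hb)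
      (P.top_mul_diff hψ hφ) (P.diff_pow hψ hφ hm1)
      (hρk ▸ (show a ∈ LinearMap.ker ρ.toLinearMap from ha))
  refine le_antisymm (Nat.sInf_le hup) (le_csInf ⟨_, hup⟩ ?_)
  rintro n ⟨W⟩
  by_contra! hn
  let _ := W.instT
  let _ := W.instQ
  obtain ⟨R⟩ := W.retr
  obtain ⟨ξ, hξ, hξm⟩ := P.exists_pow_ne_zero hm
  have hξa := P.span_x_le hξ
  let c : Fin (r + 1) → ℚ := Fin.cons (-r) fun _ => 1
  have hc : ∀ i, c i ≠ 0 := by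
    intro i
    induction i using Fin.cases with
    | zero => simpa [c] using hr
    | succ i => simp [c]
  have hc0 : ∑ i, c i = 0 := by simp [c, Fin.sum_univ_succ]
  let α := ∑ i, c i • W.TP.ι i ξ
  let v : Fin (r * t) → W.T := fun k =>
    W.TP.ι (finProdFinEquiv.symm k).1.succ (P.z (finProdFinEquiv.symm k).2) -
      W.TP.ι 0 (P.z (finProdFinEquiv.symm k).2)
  let a := α ^ ((r + 1) * m) * (List.ofFn v).prod
  have hιd : ∀ j b, Dd A b = 0 → W.TP.ι j b ∈ cocycles W.T := fun j b hb => by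
    change Dd W.T _ = 0
    rw [← (W.TP.ι_dga j).1, hb, map_zero]
  have ha : Dd W.T a = 0 := by
    change a ∈ cocycles W.T
    refine mul_mem (pow_mem (sum_mem fun i _ => Subalgebra.smul_mem _
      (hιd i ξ (P.adjoin_x_le_cocycles hξa)) _) _) (Subalgebra.list_prod_mem _ fun b hb => ?_)
    obtain ⟨k, rfl⟩ := (List.mem_ofFn' _ _).1 hb
    exact sub_mem (hιd _ _ (P.d_z _)) (hιd _ _ (P.d_z _))
  have hα : α ∈ W.TP.kerMu := by
    change W.TP.mu α = 0
    simp only [α, map_sum, map_smul, W.TP.mu_ι]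
    rw [← Finset.sum_smul, hc0, zero_smul]
  have hv : ∀ k, v k ∈ W.TP.kerMu := fun k => by
    change W.TP.mu (v k) = 0
    rw [map_sub, W.TP.mu_ι, W.TP.mu_ι, sub_self]
  have hmem : a ∈ W.TP.kerMu ^ ((r + 1) * m + r * t) := by
    rw [pow_add]
    exact Submodule.mul_mem_mul (Submodule.pow_mem_pow _ hα _) (ofFn_prod_mem_pow _ hv)
  have h0 : W.ρ a = 0 := by
    have h := W.TP.isDGIdeal_kerMu.pow_le_pow (show n ≤ (r + 1) * m + r * t - 1 by omega)
    rw [Nat.sub_add_cancel (by omega), ← W.ρ_ker] at h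
    exact h hmem
  obtain ⟨e, he⟩ := R.exact ha h0
  obtain ⟨E, _, β, w, hE, hβ, hw, hEne⟩ := exists_odd_generators hH (r * t)
    (fun k => P.dz (finProdFinEquiv.symm k).2) fun k => P.dz_odd _
  let cz : Fin (r + 1) → Fin t → E :=
    Fin.cons (fun _ => 0) fun i k => w (finProdFinEquiv (i, k))
  have hcz0 : ∀ k, cz 0 k = 0 := fun _ => rfl
  have hczs : ∀ i k, cz (Fin.succ i) k = w (finProdFinEquiv (i, k)) := fun _ _ => rfl
  have hcz : ∀ j k, cz j k ∈ Gr E (P.dz k) := by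
    intro j k
    induction j using Fin.cases with
    | zero => exact zero_mem _
    | succ i => simpa [hczs] using hw (finProdFinEquiv (i, k))
  choose f hf hfx hfz using fun j =>
    P.exists_hom hψ hB hE (φ := β.comp (φ j)) (hβ.comp (hφ j)) (cz j) (hcz j)
  obtain ⟨g, ⟨hg, hgι⟩, -⟩ := W.TP.coprod E f hf
  have hgι' : ∀ j b, g (W.TP.ι j b) = f j b := fun j b => DFunLike.congr_fun (hgι j) b
  obtain ⟨K, hK, hsum⟩ := exists_sum_pow (m := m) c (fun i => φ i (ψ ξ)) hc
    (fun i j => by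
      have hx : Algebra.adjoin ℚ (Set.range P.x) ≤ (evenSub H).comap ((φ i).comp ψ) := by
        refine Algebra.adjoin_le ?_
        rintro _ ⟨k, rfl⟩
        exact mem_evenSub ((hφ i).2 _ _ (hψ.2 _ _ (P.x_mem k))) (P.dx_even k)
      exact evenSub_comm (hx hξa) _)
    (fun i => by
      have h1 : ψ ξ ^ (m + 1) ∈ P.X ^ (m + 1) :=
        Submodule.pow_mem_pow _ (by rw [X_eq_map]; exact ⟨ξ, hξ, rfl⟩) _
      rw [hm1, Submodule.mem_bot] at h1
      rw [← map_pow, h1, map_zero])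
  have hgv : ∀ k, g (v k) = w k := fun k => by
    rw [map_sub, hgι', hgι', hfz, hfz, hcz0, hczs, sub_zero, Equiv.apply_symm_apply]
  have hga : g a = K • (β (List.ofFn fun i => φ i (ψ ξ ^ m)).prod * (List.ofFn w).prod) := by
    have hgα : g α = β (∑ i, c i • φ i (ψ ξ)) := by
      simp only [α, map_sum, map_smul, hgι', hfx _ ξ hξa, AlgHom.comp_apply]
    rw [map_mul, map_pow, hgα, ← map_pow, hsum, map_smul, smul_mul_assoc, map_ofFn_prod g]
    simp only [hgv, map_pow]
  refine smul_ne_zero hK (hEne _ (hne _ hξm)) ?_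
  rw [← hga, he, hg.1, hE, LinearMap.zero_apply]

end PureGenerators

theorem PureGenerators.one_ne_zero {A B : Type} [GCDGA A] [GCDGA B] {ψ : A →ₐ[ℚ] B} {p s t : ℕ}
    (P : PureGenerators ψ p s t) (hk : KerAcyclic ψ) : (1 : B) ≠ 0 := by
  intro h1
  obtain ⟨e, -, he⟩ := hk 1 Dd_one (by rw [map_one, h1])
  have hA : (1 : A) = 0 := by
    rw [← pr_of_mem (one_mem_Gr (A := A)), he, pr_zero_Dd]
  obtain ⟨R, _, c, -, -, -, hR⟩ := exists_polynomial (fun _ : Fin 1 => 0) fun _ => Even.zero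
  obtain ⟨f, -⟩ := P.free R (fun _ => 0) (fun _ => 0) (fun _ => 0) (fun _ => zero_mem _)
    (fun _ => zero_mem _) (fun _ => zero_mem _)
  have h0 : (1 : R) = 0 := by rw [← map_one f, hA, map_zero]
  have := hR 0 Fin.elim0 ⊥ Submodule.fg_bot
    (Submodule.ext fun a => by simp [eq_zero_of_zero_eq_one h0.symm a])
  omega

theorem QuasiIso.finiteDimensional {A B : Type} [GCDGA A] [GCDGA B] {ψ : A →ₐ[ℚ] B}
    (hq : QuasiIso ψ) (hψ : IsDGAHom ψ) (hB : Dd B = 0) (hfin : FiniteDimensional ℚ (CohClasses A)) :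
    FiniteDimensional ℚ B := by
  let g : CohClasses A →ₗ[ℚ] B :=
    Submodule.liftQ _ (ψ.toLinearMap.comp (LinearMap.ker (Dd A)).subtype) (by
      rintro ⟨_, -⟩ ⟨e, rfl⟩
      change ψ (Dd A e) = 0
      rw [hψ.1, hB, LinearMap.zero_apply])
  refine Module.Finite.of_surjective g fun b => ?_
  obtain ⟨a, ha, c, hc⟩ := hq.1 b (by rw [hB]; rfl)
  rw [hB, LinearMap.zero_apply, sub_eq_zero] at hc
  exact ⟨Submodule.Quotient.mk ⟨a, ha⟩, hc⟩

/-- For a pure elliptic minimal Sullivan model which is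
formal, and any `r ≥ 2`, `TC_r(ΛV) = r·cat(ΛV) + χ_π(ΛV)`. -/
theorem TC_eq_of_pure_elliptic_formal (A : Type) [GCDGA A] (S : MinimalSullivan A)
    (hpure : S.Pure) (hell : Elliptic A S) (hformal : Formal A)
    (r : ℕ) (hr : 2 ≤ r) :
    (TC A r : ℤ) = r * cat A S + S.chiPi := by
  obtain ⟨F⟩ := hformal
  let _ := F.instB
  have hs := F.ψ_quasi.surjective F.hd
  have hk := F.ψ_quasi.kerAcyclic F.hd
  obtain ⟨p, s, t, ⟨P⟩, hχ⟩ := S.exists_generators hpure F.ψ_dga F.ψ_quasi F.hd hell.1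
  have h1 := P.one_ne_zero hk
  obtain ⟨N, hN⟩ := exists_Gr_eq_bot (F.ψ_quasi.finiteDimensional F.ψ_dga F.hd hell.2)
  have hps : p = s := le_antisymm (P.p_le_s F.ψ_dga hk hN (S.Gr_fg hpure))
    (P.s_le_p F.ψ_dga hk F.hd h1)
  obtain ⟨m, hm, hm1⟩ := exists_nilpotency hN h1 P.X (P.X_le F.ψ_dga)
  obtain ⟨q, rfl⟩ : ∃ q, r = q + 1 := ⟨r - 1, by omega⟩
  rw [P.TC_eq F.ψ_dga hs hk F.hd hm hm1 (by omega),
    P.cat_eq hpure F.ψ_dga hs hk F.hd hm hm1, hχ, hps]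
  push_cast
  ring

end RHT
end
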